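/- arXiv:2202.02780 — 4 statements merged into one kernel-verified Lean document; each statement's English description precedes it below -/
import Mathlib

section
/- Let p be an odd prime, k > 0 an even integer, and χ₂ the Legendre symbol mod p. For all pairwise distinct elements a₁, ..., a_k ∈ 𝔽_p, one has ∑_{x ∈ 𝔽_p} χ₂((x+a₁)···(x+a_k)) ≤ (k-2)√p − 1. -/
open Polynomial

namespace WB

section Bombieri
variable {F : Type*} [Field F]

/-- minus the order at infinity -/
noncomputable def ord {f : F[X]} (z : QuadraticAlgebra F[X] f 0) : WithBot ℕ :=
  (QuadraticAlgebra.norm z).degree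

theorem degree_two_odd {f u v : F[X]} (hf : Odd f.natDegree) :
    (u * u - f * (v * v)).degree = max (u * u).degree (f * (v * v)).degree := by
  have hf0 : f ≠ 0 := by rintro rfl; simp at hf
  by_cases hu : u = 0
  · subst hu; simp
  by_cases hv : v = 0
  · subst hv; simp
  have hne : (u * u).degree ≠ (-(f * (v * v))).degree := by
    rw [degree_neg, degree_eq_natDegree (by simp [hu]), degree_eq_natDegree (by simp [hv, hf0])]
    rw [natDegree_mul hu hu, natDegree_mul hf0 (by simp [hv]), natDegree_mul hv hv]
    intro h
    have := WithBot.coe_injective h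
    obtain ⟨k, hk⟩ := hf
    change _ + _ = _ + (_ + _) at this
    omega
  rw [sub_eq_add_neg, ← degree_neg (f * (v * v))]
  rcases lt_or_gt_of_ne hne with h | h
  · rw [degree_add_eq_right_of_degree_lt h, max_eq_right h.le]
  · rw [degree_add_eq_left_of_degree_lt h, max_eq_left h.le]

theorem ord_eq {f : F[X]} (hf : Odd f.natDegree) (z : QuadraticAlgebra F[X] f 0) :
    ord z = max (z.re.degree + z.re.degree) (f.degree + (z.im.degree + z.im.degree)) := by
  have : QuadraticAlgebra.norm z = z.re * z.re - f * (z.im * z.im) := by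
    rw [QuadraticAlgebra.norm_def]; ring
  rw [ord, this, degree_two_odd hf, degree_mul, degree_mul, degree_mul]

theorem ord_mul {f : F[X]} (z w : QuadraticAlgebra F[X] f 0) : ord (z * w) = ord z + ord w := by
  simp [ord]

theorem ord_pow {f : F[X]} (z : QuadraticAlgebra F[X] f 0) (n : ℕ) : ord (z ^ n) = n • ord z := by
  simp [ord]

theorem ord_add_le {f : F[X]} (hf : Odd f.natDegree) (z w : QuadraticAlgebra F[X] f 0) :
    ord (z + w) ≤ max (ord z) (ord w) := by
  simp only [ord_eq hf, QuadraticAlgebra.re_add, QuadraticAlgebra.im_add]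
  have h1 := degree_add_le z.re w.re
  have h2 := degree_add_le z.im w.im
  refine max_le ?_ ?_
  · rcases le_max_iff.1 h1 with h | h
    · exact le_max_of_le_left (le_max_of_le_left (add_le_add h h))
    · exact le_max_of_le_right (le_max_of_le_left (add_le_add h h))
  · rcases le_max_iff.1 h2 with h | h
    · exact le_max_of_le_left (le_max_of_le_right (add_le_add le_rfl (add_le_add h h)))
    · exact le_max_of_le_right (le_max_of_le_right (add_le_add le_rfl (add_le_add h h)))

theorem ord_zero {f : F[X]} : ord (0 : QuadraticAlgebra F[X] f 0) = ⊥ := by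
  simp [ord]

theorem ord_neg {f : F[X]} (z : QuadraticAlgebra F[X] f 0) : ord (-z) = ord z := by
  simp [ord]

theorem ord_eq_bot {f : F[X]} (hf : Odd f.natDegree) {z : QuadraticAlgebra F[X] f 0}
    (h : ord z = ⊥) : z = 0 := by
  have hf0 : f ≠ 0 := by rintro rfl; simp at hf
  rw [ord_eq hf, max_eq_bot] at h
  have h' : z.re = 0 ∧ z.im = 0 := by simpa [hf0] using h
  exact QuadraticAlgebra.ext h'.1 h'.2

theorem ord_sum_le {f : F[X]} (hf : Odd f.natDegree) {ι : Type*} (s : Finset ι)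
    (z : ι → QuadraticAlgebra F[X] f 0) (n : WithBot ℕ) (h : ∀ i ∈ s, ord (z i) ≤ n) :
    ord (∑ i ∈ s, z i) ≤ n := by
  classical
  induction s using Finset.induction_on with
  | empty => simp [ord_zero]
  | insert a s ha ih =>
    rw [Finset.sum_insert ha]
    exact (ord_add_le hf _ _).trans (max_le (h _ (by simp)) (ih fun i hi => h i (by simp [hi])))

theorem ord_sum_lt {f : F[X]} (hf : Odd f.natDegree) {ι : Type*} (s : Finset ι)
    (z : ι → QuadraticAlgebra F[X] f 0) (n : WithBot ℕ) (hn : ⊥ < n) (h : ∀ i ∈ s, ord (z i) < n) :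
    ord (∑ i ∈ s, z i) < n := by
  classical
  induction s using Finset.induction_on with
  | empty => simpa [ord_zero] using hn
  | insert a s ha ih =>
    rw [Finset.sum_insert ha]
    exact (ord_add_le hf _ _).trans_lt (max_lt (h _ (by simp)) (ih fun i hi => h i (by simp [hi])))

theorem sum_ne_zero {f : F[X]} (hf : Odd f.natDegree) {ι : Type*} (s : Finset ι)
    (z : ι → QuadraticAlgebra F[X] f 0)
    (hinj : ∀ i ∈ s, ∀ j ∈ s, z i ≠ 0 → ord (z i) = ord (z j) → i = j)
    (hne : ∃ i ∈ s, z i ≠ 0) : ∑ i ∈ s, z i ≠ 0 := by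
  classical
  obtain ⟨i0, hi0, hz0⟩ := hne
  obtain ⟨m, hm, hmax⟩ := s.exists_max_image (fun i => ord (z i)) ⟨i0, hi0⟩
  have hmz : ⊥ < ord (z m) := by
    refine lt_of_lt_of_le (bot_lt_iff_ne_bot.2 fun h => hz0 (ord_eq_bot hf h)) (hmax i0 hi0)
  intro h0
  rw [← Finset.add_sum_erase s z hm] at h0
  have h1 : ord (∑ i ∈ s.erase m, z i) < ord (z m) := by
    refine ord_sum_lt hf _ _ _ hmz fun i hi => ?_
    rw [Finset.mem_erase] at hi
    refine lt_of_le_of_ne (hmax i hi.2) fun h => hi.1 ?_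
    refine (hinj m hm i hi.2 ?_ h.symm).symm
    rintro h; rw [h, ord_zero] at hmz; exact lt_irrefl _ hmz
  rw [eq_neg_of_add_eq_zero_right h0, ord_neg] at h1
  exact lt_irrefl _ h1

/-- element of prescribed pole order. -/
noncomputable def mon (f : F[X]) (g t : ℕ) : QuadraticAlgebra F[X] f 0 :=
  if Even t then ⟨X ^ (g + t / 2), 0⟩ else ⟨0, X ^ (t / 2)⟩

theorem ord_mon {f : F[X]} {g : ℕ} (hf : f.natDegree = 2 * g + 1) (t : ℕ) :
    ord (mon f g t) = ((2 * g + t : ℕ) : WithBot ℕ) := by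
  have hfo : Odd f.natDegree := ⟨g, hf⟩
  have hf0 : f ≠ 0 := by rintro rfl; simp at hf
  rw [ord_eq hfo, mon]
  split_ifs with h
  · simp only [degree_zero, degree_X_pow, WithBot.bot_add, WithBot.add_bot, max_bot_right]
    norm_cast
    obtain ⟨k, rfl⟩ := h
    change (_ + _) = _
    omega
  · simp only [degree_zero, degree_X_pow, WithBot.bot_add, degree_eq_natDegree hf0, max_bot_left, hf]
    norm_cast
    obtain ⟨k, rfl⟩ := Nat.not_even_iff_odd.1 h
    change _ + (_ + _) = _
    omega

theorem ord_const {f : F[X]} {c : F} (hc : c ≠ 0) :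
    ord (algebraMap F[X] (QuadraticAlgebra F[X] f 0) (C c)) = 0 := by
  simp [ord, hc]

theorem coeff_re_eq_zero {f : F[X]} (hf : Odd f.natDegree) {z : QuadraticAlgebra F[X] f 0} {B : ℕ}
    (h : ord z ≤ B) {i : ℕ} (hi : B < 2 * i) : z.re.coeff i = 0 := by
  rw [ord_eq hf, max_le_iff] at h
  apply coeff_eq_zero_of_degree_lt
  by_contra! h1
  have h2 := (add_le_add h1 h1).trans h.1
  have h3 : i + i ≤ B := by exact_mod_cast h2
  omega

theorem coeff_im_eq_zero {f : F[X]} (hf : Odd f.natDegree) {z : QuadraticAlgebra F[X] f 0} {B : ℕ}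
    (h : ord z ≤ B) {i : ℕ} (hi : B < 2 * i + f.natDegree) : z.im.coeff i = 0 := by
  have hf0 : f ≠ 0 := by rintro rfl; simp at hf
  rw [ord_eq hf, max_le_iff, degree_eq_natDegree hf0] at h
  apply coeff_eq_zero_of_degree_lt
  by_contra! h1
  have h2 := (add_le_add le_rfl (add_le_add h1 h1)).trans h.2
  have h3 : f.natDegree + (i + i) ≤ B := by exact_mod_cast h2
  omega

/-- coordinates -/
noncomputable def coords {f : F[X]} (B : ℕ) (z : QuadraticAlgebra F[X] f 0) : Fin (B + 1) → F :=
  fun t => if Even (t : ℕ) then z.re.coeff (t / 2) else z.im.coeff ((t - f.natDegree) / 2)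

theorem coords_inj {f : F[X]} (hf : Odd f.natDegree) {B : ℕ} {z w : QuadraticAlgebra F[X] f 0}
    (hz : ord z ≤ B) (hw : ord w ≤ B) (h : coords B z = coords B w) : z = w := by
  ext i
  · by_cases hi : B < 2 * i
    · rw [coeff_re_eq_zero hf hz hi, coeff_re_eq_zero hf hw hi]
    · have := congrFun h ⟨2 * i, by omega⟩
      simpa [coords] using this
  · by_cases hi : B < 2 * i + f.natDegree
    · rw [coeff_im_eq_zero hf hz hi, coeff_im_eq_zero hf hw hi]
    · have := congrFun h ⟨2 * i + f.natDegree, by omega⟩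
      have h2 : ¬ Even (2 * i + f.natDegree) := by
        rw [Nat.not_even_iff_odd]; exact (even_two_mul i).add_odd hf
      simpa [coords, h2] using this

/-- evaluation at a point -/
noncomputable def ev {f : F[X]} (x y : F) (h : y ^ 2 = f.eval x) :
    QuadraticAlgebra F[X] f 0 →+* F where
  toFun z := z.re.eval x + z.im.eval x * y
  map_one' := by simp [QuadraticAlgebra.re_one, QuadraticAlgebra.im_one]
  map_zero' := by simp
  map_add' z w := by simp; ring
  map_mul' z w := by simp; linear_combination (-(eval x z.im * eval x w.im)) * h

theorem ev_const {f : F[X]} (x y : F) (h : y ^ 2 = f.eval x) (c : F) :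
    ev x y h (algebraMap F[X] (QuadraticAlgebra F[X] f 0) (C c)) = c := by
  simp [ev]

theorem card_le_of_vanish [Fintype F] [DecidableEq F] (h2 : (2 : F) ≠ 0) {f : F[X]}
    (hf : Odd f.natDegree) (z : QuadraticAlgebra F[X] f 0) (hz : z ≠ 0) (B : ℕ) (hB : ord z ≤ B)
    (hv : ∀ x y (h : y ^ 2 = f.eval x), ev x y h z = 0) :
    (Finset.univ.filter fun t : F × F => t.2 ^ 2 = f.eval t.1).card ≤ B := by
  set N := QuadraticAlgebra.norm z with hN
  have hNe : N = z.re * z.re - f * (z.im * z.im) := by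
    rw [hN, QuadraticAlgebra.norm_def]; ring
  have hN0 : N ≠ 0 := by
    intro h; apply hz; apply ord_eq_bot hf; rw [ord, ← hN, h, degree_zero]
  have hdeg : N.natDegree ≤ B := natDegree_le_of_degree_le hB
  refine le_trans ?_ ((card_roots' N).trans hdeg)
  rw [Finset.card_eq_sum_card_fiberwise (f := Prod.fst) (t := Finset.univ) (by simp)]
  rw [← Multiset.sum_count_eq_card (s := Finset.univ) (by simp)]
  refine Finset.sum_le_sum fun x _ => ?_
  rw [count_roots]
  rcases Finset.eq_empty_or_nonempty
    ((Finset.univ.filter fun t : F × F => t.2 ^ 2 = f.eval t.1).filter (fun t => t.1 = x)) with h0 | ⟨⟨x', y⟩, hxy⟩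
  · rw [h0]; simp
  simp only [Finset.mem_filter, Finset.mem_univ, true_and] at hxy
  obtain ⟨hy, rfl⟩ := hxy
  have e1 : z.re.eval x' + z.im.eval x' * y = 0 := hv x' y hy
  have e2 : z.re.eval x' + z.im.eval x' * (-y) = 0 := hv x' (-y) (by rw [neg_sq, hy])
  have hsub : (Finset.univ.filter fun t : F × F => t.2 ^ 2 = f.eval t.1).filter (fun t => t.1 = x')
      ⊆ {(x', y), (x', -y)} := by
    rintro ⟨a, b⟩ hab
    simp only [Finset.mem_filter, Finset.mem_univ, true_and] at hab
    obtain ⟨hb, rfl⟩ := hab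
    have : b ^ 2 = y ^ 2 := by rw [hb, hy]
    rcases sq_eq_sq_iff_eq_or_eq_neg.1 this with h | h <;> simp [h]
  refine (Finset.card_le_card hsub).trans ?_
  by_cases hy0 : y = 0
  · subst hy0
    simp only [neg_zero, Finset.mem_singleton, Finset.insert_eq_of_mem, Finset.card_singleton]
    rw [Nat.one_le_iff_ne_zero, ← Nat.pos_iff_ne_zero, rootMultiplicity_pos hN0, IsRoot, hNe]
    simp at e1 hy
    simp [e1, ← hy]
  · have him : z.im.eval x' = 0 := by
      have : 2 * (z.im.eval x' * y) = 0 := by linear_combination e1 - e2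
      simpa [h2, hy0] using this
    have hre : z.re.eval x' = 0 := by simpa [him] using e1
    refine Finset.card_le_two.trans ?_
    rw [le_rootMultiplicity_iff hN0, hNe]
    have d1 := dvd_iff_isRoot.2 hre
    have d2 := dvd_iff_isRoot.2 him
    rw [pow_two]
    exact dvd_sub (mul_dvd_mul d1 d1) (dvd_mul_of_dvd_right (mul_dvd_mul d2 d2) _)

theorem bombieri [Fintype F] [DecidableEq F] (p α : ℕ) [Fact p.Prime] [CharP F p]
    (h2 : (2 : F) ≠ 0) (hcard : Fintype.card F = (p ^ α) ^ 2)
    {f : F[X]} (hf : Odd f.natDegree) :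
    (Finset.univ.filter fun t : F × F => t.2 ^ 2 = f.eval t.1).card
      ≤ (p ^ α) ^ 2 + 5 * f.natDegree * p ^ α := by
  obtain ⟨g, hg⟩ := id hf
  set s := p ^ α with hs
  have hs2 : 2 ≤ s := by
    have := Fintype.one_lt_card (α := F)
    rw [hcard] at this
    by_contra! h
    interval_cases s <;> simp at this
  set M := s + 6 * g + 1 with hM
  set B := s * (2 * g + (s - 1)) + (2 * g + (M - 1)) with hB
  let A := QuadraticAlgebra F[X] f 0
  let cst : F → A := fun c => algebraMap F[X] A (C c)
  let D : (Fin s × Fin M → F) → A := fun b =>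
    ∑ i, cst (b i) * (mon f g i.1 ^ s * mon f g i.2)
  have hordc : ∀ c : F, ∀ z : A, ord (cst c * z) ≤ ord z := by
    intro c z
    by_cases hc : c = 0
    · simp [cst, hc, ord_zero]
    · rw [ord_mul, ord_const hc, zero_add]
  have hD : ∀ b, ord (D b) ≤ (B : WithBot ℕ) := by
    intro b
    refine ord_sum_le hf _ _ _ fun i _ => (hordc _ _).trans ?_
    rw [ord_mul, ord_pow, ord_mon hg, ord_mon hg]
    have h1 : s * (2 * g + i.1) + (2 * g + i.2) ≤ B := by
      have := i.1.2
      have := i.2.2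
      rw [hB]
      gcongr <;> omega
    rw [nsmul_eq_mul]
    exact_mod_cast h1
  have hcardlt : Fintype.card (Fin (B + 1) → F) < Fintype.card (Fin s × Fin M → F) := by
    simp only [Fintype.card_fun, Fintype.card_fin, Fintype.card_prod]
    refine Nat.pow_lt_pow_right Fintype.one_lt_card ?_
    rw [hB, hM]
    obtain ⟨r, hr⟩ := Nat.exists_eq_add_of_le hs2
    rw [hr]
    have : 2 + r - 1 = 1 + r := by omega
    rw [this]
    simp only [Nat.add_sub_cancel]
    nlinarith
  obtain ⟨b1, b2, hne, hb⟩ := Fintype.exists_ne_map_eq_of_card_lt (fun b => coords B (D b)) hcardlt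
  have hDD := coords_inj hf (hD b1) (hD b2) hb
  let b : Fin s × Fin M → F := b1 - b2
  have hDb : D b = 0 := by
    have : D b = D b1 - D b2 := by
      simp only [D]
      rw [← Finset.sum_sub_distrib]
      refine Finset.sum_congr rfl fun i _ => ?_
      simp only [b, cst, Pi.sub_apply, map_sub]; ring
    rw [this, hDD, sub_self]
  let t : Fin s × Fin M → A := fun i => cst (b i ^ s) * (mon f g i.1 * mon f g i.2 ^ s)
  have hordt : ∀ i, b i ≠ 0 → ord (t i) = ((2 * g + i.1 + s * (2 * g + i.2) : ℕ) : WithBot ℕ) := by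
    intro i hi
    simp only [t, cst]
    rw [ord_mul, ord_const (pow_ne_zero _ hi), zero_add, ord_mul, ord_pow, ord_mon hg, ord_mon hg]
    rw [nsmul_eq_mul]
    norm_cast
  have ht0 : ∀ i, b i = 0 → t i = 0 := by
    intro i hi
    have : s ≠ 0 := by omega
    simp [t, cst, hi, this]
  have hGne : ∑ i, t i ≠ 0 := by
    apply sum_ne_zero hf
    · intro i _ j _ hi hij
      have hbi : b i ≠ 0 := fun h => hi (ht0 i h)
      by_cases hbj : b j = 0
      · rw [hordt i hbi, ht0 j hbj, ord_zero] at hij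
        exact absurd hij (WithBot.coe_ne_bot)
      · rw [hordt i hbi, hordt j hbj] at hij
        have h3 : 2 * g + i.1 + s * (2 * g + i.2) = 2 * g + j.1 + s * (2 * g + j.2) := by
          exact_mod_cast hij
        have h4 : (i.1 : ℕ) + s * i.2 = j.1 + s * j.2 := by linarith
        have h5 : (i.1 : ℕ) = j.1 := by
          have := congrArg (· % s) h4
          simpa [Nat.add_mul_mod_self_left, Nat.mod_eq_of_lt i.1.2, Nat.mod_eq_of_lt j.1.2] using this
        have h6 : (i.2 : ℕ) = j.2 := by
          rw [h5] at h4
          exact Nat.eq_of_mul_eq_mul_left (by omega) (Nat.add_left_cancel h4)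
        exact Prod.ext (Fin.ext h5) (Fin.ext h6)
    · have : b ≠ 0 := sub_ne_zero.2 hne
      obtain ⟨i, hi⟩ := Function.ne_iff.1 this
      refine ⟨i, Finset.mem_univ _, fun h => ?_⟩
      have h1 := hordt i hi
      rw [h, ord_zero] at h1
      exact absurd h1.symm WithBot.coe_ne_bot
  have hordG : ord (∑ i, t i) ≤ ((2 * g + (s - 1) + s * (2 * g + (M - 1)) : ℕ) : WithBot ℕ) := by
    refine ord_sum_le hf _ _ _ fun i _ => ?_
    by_cases hi : b i = 0
    · rw [ht0 i hi, ord_zero]; exact bot_le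
    · rw [hordt i hi]
      have : 2 * g + i.1 + s * (2 * g + i.2) ≤ 2 * g + (s - 1) + s * (2 * g + (M - 1)) := by
        have := i.1.2
        have := i.2.2
        gcongr <;> omega
      exact_mod_cast this
  refine (card_le_of_vanish h2 hf _ hGne _ hordG ?_).trans ?_
  · intro x y h
    have hq : ∀ a : F, (a ^ s) ^ s = a := by
      intro a
      rw [← pow_mul, ← pow_two, ← hcard]; exact FiniteField.pow_card a
    have hkey : (ev x y h (∑ i, t i)) ^ s = ev x y h (D b) := by
      have hfrob : ∀ G : Fin s × Fin M → F, (∑ i, G i) ^ s = ∑ i, G i ^ s :=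
        fun G => sum_pow_char_pow p α _ G
      rw [map_sum, hfrob, map_sum]
      refine Finset.sum_congr rfl fun i _ => ?_
      simp only [t, cst, map_mul, map_pow, ev_const, mul_pow, hq]
    rw [hDb, map_zero] at hkey
    exact pow_eq_zero_iff (by omega : s ≠ 0) |>.1 hkey
  · rw [hM, hg]
    simp only [Nat.add_sub_cancel]
    have : s - 1 ≤ s := by omega
    have h3 : 2 * g ≤ g * s := by nlinarith
    nlinarith

end Bombieri

section CharBound
variable {F : Type*} [Field F] [Fintype F] [DecidableEq F]

theorem charsum_le (p α : ℕ) [Fact p.Prime] [CharP F p]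
    (hp : p ≠ 2) (hcard : Fintype.card F = (p ^ α) ^ 2)
    {f : F[X]} (hf : Odd f.natDegree) :
    ∑ x, quadraticChar F (f.eval x) ≤ 5 * f.natDegree * p ^ α := by
  have hchar : ringChar F ≠ 2 := by rwa [ringChar.eq F p]
  have h2 : (2 : F) ≠ 0 := Ring.two_ne_zero hchar
  have h := bombieri p α h2 hcard hf
  have hc : ((Finset.univ.filter fun t : F × F => t.2 ^ 2 = f.eval t.1).card : ℤ)
      = ∑ x, (quadraticChar F (f.eval x) + 1) := by
    rw [Finset.card_eq_sum_card_fiberwise (f := Prod.fst) (t := Finset.univ) (by simp)]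
    push_cast
    refine Finset.sum_congr rfl fun x _ => ?_
    rw [← quadraticChar_card_sqrts hchar]
    norm_cast
    refine Finset.card_bij' (fun t _ => t.2) (fun y _ => (x, y)) ?_ ?_ ?_ ?_
    · rintro ⟨a, b⟩ h; simp at h ⊢; obtain ⟨h, rfl⟩ := h; exact h
    · intro y h; simpa using h
    · rintro ⟨a, b⟩ h; simp at h ⊢; exact h.2.symm
    · intro y h; rfl
  rw [Finset.sum_add_distrib] at hc
  simp only [Finset.sum_const, Finset.card_univ, hcard, nsmul_eq_mul, mul_one] at hc
  zify at h
  rw [hc] at h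
  push_cast at h
  linarith

theorem abs_charsum_le (p α : ℕ) [Fact p.Prime] [CharP F p]
    (hp : p ≠ 2) (hcard : Fintype.card F = (p ^ α) ^ 2)
    {f : F[X]} (hf : Odd f.natDegree) :
    |∑ x, quadraticChar F (f.eval x)| ≤ 5 * f.natDegree * p ^ α := by
  have hchar : ringChar F ≠ 2 := by rwa [ringChar.eq F p]
  obtain ⟨c, hc⟩ := quadraticChar_exists_neg_one hchar
  have hc0 : c ≠ 0 := by rintro rfl; simp at hc
  have hd : (C c * f).natDegree = f.natDegree := natDegree_C_mul hc0
  have h1 := charsum_le p α hp hcard hf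
  have h2 := charsum_le p α hp hcard (f := C c * f) (by rwa [hd])
  rw [hd] at h2
  simp only [eval_mul, eval_C, map_mul, hc, neg_one_mul, Finset.sum_neg_distrib] at h2
  exact abs_le.2 ⟨by linarith, h1⟩

end CharBound

section NormStuff

theorem quadraticChar_norm (p : ℕ) [Fact p.Prime] (hp : p ≠ 2) {L : Type*} [Field L] [Fintype L]
    [DecidableEq L] [Algebra (ZMod p) L] (z : L) :
    quadraticChar L z = quadraticChar (ZMod p) (Algebra.norm (ZMod p) z) := by
  have : CharP L p := charP_of_injective_algebraMap (algebraMap (ZMod p) L).injective p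
  have hchar : ringChar L ≠ 2 := by rwa [ringChar.eq L p]
  have hchar' : ringChar (ZMod p) ≠ 2 := by rwa [ringChar.eq (ZMod p) p]
  have h2 : (2 : L) ≠ 0 := Ring.two_ne_zero hchar
  have e1 := quadraticChar_eq_pow_of_char_ne_two' hchar z
  have e2 := congrArg (algebraMap (ZMod p) L)
    (quadraticChar_eq_pow_of_char_ne_two' hchar' (Algebra.norm (ZMod p) z))
  rw [map_pow, FiniteField.algebraMap_norm_eq_pow, ← pow_mul, map_intCast] at e2
  have e3 : (Nat.card L - 1) / (Nat.card (ZMod p) - 1) * (Fintype.card (ZMod p) / 2)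
      = Fintype.card L / 2 := by
    rw [Nat.card_eq_fintype_card, Nat.card_zmod, ZMod.card]
    have hodd : Fintype.card L % 2 = 1 := FiniteField.odd_card_of_char_ne_two hchar
    have hpo : p % 2 = 1 := by
      rcases (Fact.out : p.Prime).eq_two_or_odd with h | h
      · exact absurd h hp
      · exact h
    have hdvd : p - 1 ∣ Fintype.card L - 1 := by
      obtain ⟨n, hn⟩ := FiniteField.card L p
      rw [hn.2]
      simpa using Nat.sub_dvd_pow_sub_pow p 1 n
    obtain ⟨k, hk⟩ := hdvd
    have hp2 := (Fact.out : p.Prime).two_le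
    obtain ⟨m, hm⟩ : ∃ m, p = 2 * m + 1 := ⟨p / 2, by omega⟩
    rw [hk, Nat.mul_div_cancel_left _ (by omega)]
    have hL : Fintype.card L = (p - 1) * k + 1 := by
      have := Fintype.card_pos (α := L)
      omega
    rw [hL, hm]
    have a1 : (2 * m + 1) / 2 = m := by omega
    have a2 : 2 * m + 1 - 1 = 2 * m := by omega
    rw [a1, a2]
    have a3 : 2 * m * k = 2 * (k * m) := by ring
    omega
  rw [e3, ← e1] at e2
  have q1 := quadraticChar_isQuadratic L z
  have q2 := quadraticChar_isQuadratic (ZMod p) (Algebra.norm (ZMod p) z)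
  have hne : (-1 : L) ≠ 1 := by
    intro h; apply h2; linear_combination -h
  rcases q1 with q1 | q1 | q1 <;> rcases q2 with q2 | q2 | q2 <;> rw [q1, q2] at e2 ⊢ <;>
    simp [hne, hne.symm] at e2

theorem eval_minpoly_pow {K L : Type*} [Field K] [Field L] [Algebra K L] [FiniteDimensional K L]
    (x : L) (b : K) :
    (minpoly K x ^ (Module.finrank K L / (minpoly K x).natDegree)).eval b
      = Algebra.norm K (algebraMap K L b - x) := by
  have hx : IsIntegral K x := Algebra.IsIntegral.isIntegral x
  set z := x - algebraMap K L b with hz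
  have hzi : IsIntegral K z := Algebra.IsIntegral.isIntegral z
  have hmin : minpoly K z = (minpoly K x).comp (X + C b) := minpoly.sub_algebraMap x b
  have hdeg : (minpoly K z).natDegree = (minpoly K x).natDegree := by
    rw [hmin, natDegree_comp, natDegree_X_add_C, mul_one]
  have hfr : Module.finrank K (IntermediateField.adjoin K {z}) = (minpoly K x).natDegree := by
    rw [IntermediateField.adjoin.finrank hzi, hdeg]
  have hmul := Module.finrank_mul_finrank K (IntermediateField.adjoin K {z}) L
  rw [hfr] at hmul
  have hpos : 0 < (minpoly K x).natDegree := minpoly.natDegree_pos hx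
  have hneg : algebraMap K L b - x = algebraMap K L (-1) * z := by
    rw [hz]; simp
  rw [hneg, map_mul, Algebra.norm_algebraMap, Algebra.norm_eq_norm_adjoin K z]
  rw [← hmul, Nat.mul_div_cancel_left _ hpos]
  have := Algebra.PowerBasis.norm_gen_eq_coeff_zero_minpoly (IntermediateField.adjoin.powerBasis hzi)
  rw [IntermediateField.adjoin.powerBasis_gen, IntermediateField.minpoly_gen,
    IntermediateField.adjoin.powerBasis_dim, hdeg, hmin, coeff_zero_eq_eval_zero] at this
  rw [this]
  simp only [eval_pow, eval_comp, eval_add, eval_X, eval_C, zero_add, mul_pow]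
  rw [← mul_assoc, ← pow_mul, ← mul_pow]
  simp
end NormStuff

section Count
open UniqueFactorizationMonoid

noncomputable instance galFintype (p : ℕ) [Fact p.Prime] (j : ℕ) : Fintype (GaloisField p j) :=
  Fintype.ofFinite _

/-- characteristic polynomial of an element of the degree `j` extension. -/
noncomputable def cp (p : ℕ) [Fact p.Prime] (j : ℕ) (x : GaloisField p j) : (ZMod p)[X] :=
  minpoly (ZMod p) x ^ (j / (minpoly (ZMod p) x).natDegree)

theorem natDegree_minpoly_dvd (p : ℕ) [Fact p.Prime] {j : ℕ} (hj : j ≠ 0) (x : GaloisField p j) :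
    (minpoly (ZMod p) x).natDegree ∣ j := by
  have h := minpoly.degree_dvd (Algebra.IsIntegral.isIntegral (R := ZMod p) x)
  rwa [GaloisField.finrank p hj] at h

theorem cp_monic (p : ℕ) [Fact p.Prime] (j : ℕ) (x : GaloisField p j) : (cp p j x).Monic :=
  (minpoly.monic (Algebra.IsIntegral.isIntegral x)).pow _

theorem cp_natDegree (p : ℕ) [Fact p.Prime] {j : ℕ} (hj : j ≠ 0) (x : GaloisField p j) :
    (cp p j x).natDegree = j := by
  rw [cp, natDegree_pow]
  exact Nat.div_mul_cancel (natDegree_minpoly_dvd p hj x)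

open Classical in
theorem card_roots_gal (p : ℕ) [Fact p.Prime] {j : ℕ} (hj : j ≠ 0) {P : (ZMod p)[X]}
    (hP : Irreducible P) (hm : P.Monic) (hd : P.natDegree ∣ j) :
    (Finset.univ.filter fun x : GaloisField p j => minpoly (ZMod p) x = P).card = P.natDegree := by
  have hsplit : (P.map (algebraMap (ZMod p) (GaloisField p j))).Splits := by
    have h1 := (hP.natDegree_dvd_iff_dvd_X_pow_card_pow_sub_X).1 hd
    rw [Nat.card_zmod] at h1
    refine Splits.of_dvd ?_ ?_ (map_dvd (algebraMap _ (GaloisField p j)) h1)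
    · have := FiniteField.isSplittingField_sub (GaloisField p j) (ZMod p)
      have hc : Fintype.card (GaloisField p j) = p ^ j := by
        rw [← Nat.card_eq_fintype_card, GaloisField.card p j hj]
      rw [hc] at this
      exact IsSplittingField.splits (GaloisField p j) (X ^ p ^ j - X : (ZMod p)[X])
    · exact map_ne_zero (FiniteField.X_pow_card_pow_sub_X_ne_zero _ hj (Fact.out : p.Prime).one_lt)
  rw [← card_rootSet_eq_natDegree (PerfectField.separable_of_irreducible hP) hsplit, ← Set.toFinset_card]
  congr 1
  ext x
  simp only [Finset.mem_filter, Finset.mem_univ, true_and, Set.mem_toFinset]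
  rw [mem_rootSet_of_ne hP.ne_zero]
  constructor
  · rintro rfl; exact minpoly.aeval _ _
  · intro h; exact (minpoly.eq_of_irreducible_of_monic hP h hm).symm

open Classical in
theorem card_cp_dvd (p : ℕ) [Fact p.Prime] {j : ℕ} (hj : j ≠ 0) {h : (ZMod p)[X]} (h0 : h ≠ 0) :
    (Finset.univ.filter fun x : GaloisField p j => cp p j x ∣ h).card
      = ∑ P ∈ (normalizedFactors h).toFinset,
          if P.natDegree ∣ j ∧ P ^ (j / P.natDegree) ∣ h then P.natDegree else 0 := by
  rw [Finset.card_eq_sum_card_fiberwise (f := fun x => minpoly (ZMod p) x)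
    (t := (normalizedFactors h).toFinset)]
  · refine Finset.sum_congr rfl fun P hP => ?_
    rw [Multiset.mem_toFinset, mem_normalizedFactors_iff' h0] at hP
    have hm : P.Monic := by
      rw [← hP.2.1]; exact monic_normalize hP.1.ne_zero
    split_ifs with hc
    · rw [← card_roots_gal p hj hP.1 hm hc.1]
      congr 1
      ext x
      simp only [Finset.mem_filter, Finset.mem_univ, true_and, and_iff_right_iff_imp]
      rintro rfl
      exact hc.2
    · rw [Finset.card_eq_zero, Finset.filter_eq_empty_iff]
      intro x hx
      simp only [Finset.mem_filter, Finset.mem_univ, true_and] at hx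
      rintro rfl
      exact hc ⟨natDegree_minpoly_dvd p hj x, hx⟩
  · intro x hx
    simp only [Finset.coe_filter, Finset.mem_univ, true_and, Set.mem_ofPred_eq] at hx
    have hxi := Algebra.IsIntegral.isIntegral (R := ZMod p) x
    simp only [Finset.mem_coe, Multiset.mem_toFinset]
    rw [mem_normalizedFactors_iff' h0]
    refine ⟨minpoly.irreducible hxi, (minpoly.monic hxi).normalize_eq_self, ?_⟩
    refine dvd_trans (dvd_pow_self _ ?_) hx
    have := Nat.div_pos (Nat.le_of_dvd (Nat.pos_of_ne_zero hj) (natDegree_minpoly_dvd p hj x))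
      (minpoly.natDegree_pos hxi)
    omega

open Classical in
theorem count_cp (p : ℕ) [Fact p.Prime] {h : (ZMod p)[X]} (hmon : h.Monic) :
    ∑ j ∈ Finset.Icc 1 h.natDegree,
      (Finset.univ.filter fun x : GaloisField p j => cp p j x ∣ h).card = h.natDegree := by
  have h0 := hmon.ne_zero
  have e1 : ∀ j ∈ Finset.Icc 1 h.natDegree,
      (Finset.univ.filter fun x : GaloisField p j => cp p j x ∣ h).card
      = ∑ P ∈ (normalizedFactors h).toFinset,
          if P.natDegree ∣ j ∧ P ^ (j / P.natDegree) ∣ h then P.natDegree else 0 := by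
    intro j hj
    rw [Finset.mem_Icc] at hj
    exact card_cp_dvd p (by omega) h0
  rw [Finset.sum_congr rfl e1, Finset.sum_comm]
  have e2 : h.natDegree = ((normalizedFactors h).map natDegree).sum := by
    rw [← natDegree_multiset_prod _ (zero_notMem_normalizedFactors h), prod_normalizedFactors_eq h0,
      hmon.normalize_eq_self]
  conv_rhs => rw [e2, Finset.sum_multiset_map_count]
  refine Finset.sum_congr rfl fun P hP => ?_
  rw [Multiset.mem_toFinset, mem_normalizedFactors_iff' h0] at hP
  rw [← Finset.sum_filter, Finset.sum_const]
  congr 1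
  have hpos : 0 < P.natDegree := hP.1.natDegree_pos
  have hcount : ∀ e, P ^ e ∣ h ↔ e ≤ (normalizedFactors h).count P := by
    intro e
    rw [pow_dvd_iff_le_emultiplicity, emultiplicity_eq_count_normalizedFactors hP.1 h0, hP.2.1]
    exact Nat.cast_le
  trans (Finset.Icc 1 ((normalizedFactors h).count P)).card
  · refine Finset.card_bij' (fun j _ => j / P.natDegree) (fun e _ => P.natDegree * e) ?_ ?_ ?_ ?_
    · intro j hj
      simp only [Finset.mem_filter, Finset.mem_Icc] at hj ⊢
      refine ⟨Nat.div_pos (Nat.le_of_dvd (by omega) hj.2.1) hpos, (hcount _).1 hj.2.2⟩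
    · intro e he
      simp only [Finset.mem_filter, Finset.mem_Icc] at he ⊢
      rw [Nat.mul_div_cancel_left _ hpos]
      have hd := (hcount e).2 he.2
      refine ⟨⟨Nat.mul_pos hpos he.1, ?_⟩, dvd_mul_right _ _, hd⟩
      have := natDegree_le_of_dvd hd h0
      rwa [natDegree_pow, mul_comm] at this
    · intro j hj
      simp only [Finset.mem_filter, Finset.mem_Icc] at hj
      exact Nat.mul_div_cancel' hj.2.1
    · intro e he
      exact Nat.mul_div_cancel_left _ hpos
  · simp
end Count

section Ana

theorem root_bound {D : ℕ} (v : Fin D → ℂ) (K R : ℝ) (hR : 0 < R)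
    (h : ∀ n : ℕ, 1 ≤ n → ‖∑ i, v i ^ n‖ ≤ K * R ^ n) (i0 : Fin D) : ‖v i0‖ ≤ R := by
  classical
  set z := v i0 with hz
  set P : ℂ[X] := ∏ y ∈ (Finset.univ.image v).erase z, (X - C y) with hP
  set m : ℕ := (Finset.univ.filter fun i => v i = z).card with hm
  have hm0 : m ≠ 0 := by
    rw [hm]; exact Finset.card_ne_zero.2 ⟨i0, by simp [hz]⟩
  have hPz : P.eval z ≠ 0 := by
    rw [hP, eval_prod]
    refine Finset.prod_ne_zero_iff.2 fun y hy => ?_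
    rw [Finset.mem_erase] at hy
    simpa [sub_eq_zero] using hy.1.symm
  have hPv : ∀ i, v i ≠ z → P.eval (v i) = 0 := by
    intro i hi
    rw [hP, eval_prod]
    exact Finset.prod_eq_zero (i := v i) (by simp [hi]) (by simp)
  have key : ∀ n, ∑ l ∈ Finset.range (P.natDegree + 1), P.coeff l * ∑ i, v i ^ (n + l)
      = m * P.eval z * z ^ n := by
    intro n
    simp only [Finset.mul_sum]
    rw [Finset.sum_comm]
    have : ∀ i, ∑ l ∈ Finset.range (P.natDegree + 1), P.coeff l * v i ^ (n + l)
        = if v i = z then P.eval z * z ^ n else 0 := by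
      intro i
      have h1 : ∑ l ∈ Finset.range (P.natDegree + 1), P.coeff l * v i ^ (n + l)
        = P.eval (v i) * v i ^ n := by
        rw [eval_eq_sum_range, Finset.sum_mul]
        refine Finset.sum_congr rfl fun l _ => ?_
        ring
      rw [h1]
      split_ifs with hi
      · rw [hi]
      · rw [hPv i hi, zero_mul]
    simp only [this]
    rw [← Finset.sum_filter, Finset.sum_const, nsmul_eq_mul, ← hm, mul_assoc]
  set K' := ∑ l ∈ Finset.range (P.natDegree + 1), ‖P.coeff l‖ * (K * R ^ l) with hK'
  have hb : ∀ n, 1 ≤ n → ‖(m : ℂ) * P.eval z‖ * ‖z‖ ^ n ≤ K' * R ^ n := by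
    intro n hn
    rw [← norm_pow, ← norm_mul, ← key n, hK', Finset.sum_mul]
    refine (norm_sum_le _ _).trans (Finset.sum_le_sum fun l _ => ?_)
    rw [norm_mul, mul_assoc]
    refine mul_le_mul_of_nonneg_left ?_ (norm_nonneg _)
    refine (h (n + l) (by omega)).trans (le_of_eq ?_)
    rw [pow_add]; ring
  by_contra! hlt
  have hc : 0 < ‖(m : ℂ) * P.eval z‖ := norm_pos_iff.2 (mul_ne_zero (by exact_mod_cast hm0) hPz)
  have h1 : 1 < ‖z‖ / R := (one_lt_div hR).2 hlt
  obtain ⟨n, hn⟩ := pow_unbounded_of_one_lt (K' / ‖(m : ℂ) * P.eval z‖) h1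
  have hn' : K' / ‖(m : ℂ) * P.eval z‖ < (‖z‖ / R) ^ (n + 1) :=
    hn.trans (pow_lt_pow_right₀ h1 (Nat.lt_succ_self n))
  have := hb (n + 1) (by omega)
  rw [div_pow, div_lt_div_iff₀ hc (pow_pos hR _)] at hn'
  linarith

theorem exists_omega (A T : ℕ → ℂ) (D : ℕ) (hA0 : A 0 = 1) (hA : ∀ m, D < m → A m = 0)
    (hrec : ∀ n : ℕ, (n : ℂ) * A n = ∑ a ∈ Finset.HasAntidiagonal.antidiagonal n with a.1 < n, A a.1 * T a.2) :
    ∃ w : Fin D → ℂ, ∀ n, 1 ≤ n → T n = -∑ i, w i ^ n := by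
  set Q : ℂ[X] := ∑ m ∈ Finset.range (D + 1), C (A m) * X ^ (D - m) with hQ
  have hcoeff : ∀ m ≤ D, Q.coeff (D - m) = A m := by
    intro m hm
    rw [hQ, finsetSum_coeff, Finset.sum_eq_single m]
    · simp
    · intro b hb hne
      rw [Finset.mem_range] at hb
      rw [coeff_C_mul, coeff_X_pow, if_neg (by omega), mul_zero]
    · intro h; exact absurd (Finset.mem_range.2 (by omega)) h
  have hdegle : Q.natDegree ≤ D := by
    refine natDegree_sum_le_of_forall_le _ _ fun m _ => ?_
    exact (natDegree_C_mul_X_pow_le _ _).trans (by omega)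
  have hlead : Q.coeff D = 1 := by simpa [hA0] using hcoeff 0 (by omega)
  have hdeg : Q.natDegree = D :=
    le_antisymm hdegle (le_natDegree_of_ne_zero (by rw [hlead]; exact one_ne_zero))
  have hlc : Q.leadingCoeff = 1 := by rw [leadingCoeff, hdeg, hlead]
  have hcard : Q.roots.card = Q.natDegree := (IsAlgClosed.splits Q).natDegree_eq_card_roots.symm
  have hlen : Q.roots.toList.length = D := by rw [Multiset.length_toList, hcard, hdeg]
  let w : Fin D → ℂ := fun i => Q.roots.toList.get (i.cast hlen.symm)
  have hw : Multiset.map w Finset.univ.val = Q.roots := by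
    rw [Fin.univ_val_map]
    conv_rhs => rw [← Multiset.coe_toList Q.roots]
    congr 1
    apply List.ext_get
    · simp [hlen]
    · intro n h1 h2
      simp [w]
  have hAe : ∀ m, A m = (-1) ^ m * MvPolynomial.aeval w (MvPolynomial.esymm (Fin D) ℂ m) := by
    intro m
    rcases le_or_gt m D with hm | hm
    · rw [MvPolynomial.aeval_esymm_eq_multiset_esymm, hw, ← hcoeff m hm,
        coeff_eq_esymm_roots_of_card hcard (by omega), hlc, hdeg, one_mul]
      have : D - (D - m) = m := by omega
      rw [this]
    · rw [hA m hm, MvPolynomial.esymm, Finset.powersetCard_eq_empty.2 (by simpa using hm)]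
      simp
  refine ⟨w, ?_⟩
  have hnewton : ∀ n : ℕ, (n : ℂ) * A n
      = -∑ a ∈ Finset.HasAntidiagonal.antidiagonal n with a.1 < n, A a.1 * ∑ i, w i ^ a.2 := by
    intro n
    have h := congrArg (MvPolynomial.aeval w) (MvPolynomial.mul_esymm_eq_sum (Fin D) ℂ n)
    simp only [map_mul, map_sum, map_pow, map_neg, map_one, map_natCast, MvPolynomial.psum,
      MvPolynomial.aeval_X] at h
    rw [hAe n, mul_left_comm, h, ← mul_assoc, ← pow_add]
    have : (-1 : ℂ) ^ (n + (n + 1)) = -1 := by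
      rw [Odd.neg_one_pow]; exact ⟨n, by ring⟩
    rw [this, neg_one_mul]
    congr 1
    refine Finset.sum_congr rfl fun a _ => ?_
    rw [hAe a.1]
  intro n
  induction n using Nat.strong_induction_on with
  | _ n ih =>
    intro hn
    have h1 : ∑ a ∈ Finset.HasAntidiagonal.antidiagonal n with a.1 < n, A a.1 * (T a.2 + ∑ i, w i ^ a.2) = 0 := by
      simp only [mul_add, Finset.sum_add_distrib]
      rw [← hrec, hnewton]; ring
    rw [Finset.sum_eq_single (0, n)] at h1
    · rw [hA0, one_mul] at h1
      exact eq_neg_of_add_eq_zero_left h1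
    · rintro ⟨a, b⟩ hab hne
      simp only [Finset.mem_filter, Finset.HasAntidiagonal.mem_antidiagonal] at hab
      have hb : b < n := by
        rcases Nat.eq_zero_or_pos a with h | h
        · subst h; exfalso; apply hne; ext <;> simp <;> omega
        · omega
      simp only
      rw [ih b hb (by omega)]; ring
    · intro h; exfalso; apply h; simp; omega
end Ana


section LFun

theorem finite_monic (p : ℕ) [Fact p.Prime] (n : ℕ) :
    {h : (ZMod p)[X] | h.Monic ∧ h.natDegree = n}.Finite := by
  refine Set.Finite.of_finite_image (f := fun h => fun i : Fin (n + 1) => h.coeff i)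
    (Set.toFinite _) ?_
  intro h1 m1 h2 m2 he
  ext i
  by_cases hi : i < n + 1
  · exact congrFun he ⟨i, hi⟩
  · rw [coeff_eq_zero_of_natDegree_lt (by rw [m1.2]; omega),
      coeff_eq_zero_of_natDegree_lt (by rw [m2.2]; omega)]

/-- monic polynomials of degree n -/
noncomputable def mn (p : ℕ) [Fact p.Prime] (n : ℕ) : Finset (ZMod p)[X] :=
  (finite_monic p n).toFinset

theorem mem_mn {p : ℕ} [Fact p.Prime] {n : ℕ} {h : (ZMod p)[X]} :
    h ∈ mn p n ↔ h.Monic ∧ h.natDegree = n := by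
  rw [mn, Set.Finite.mem_toFinset]; rfl

variable {p : ℕ} [Fact p.Prime] {d : ℕ} (b : Fin d → ZMod p)

/-- the Dirichlet character on polynomials -/
noncomputable def lam (h : (ZMod p)[X]) : ℤ := quadraticChar (ZMod p) (∏ j, h.eval (b j))

theorem lam_mul (h h' : (ZMod p)[X]) : lam b (h * h') = lam b h * lam b h' := by
  simp only [lam, eval_mul, Finset.prod_mul_distrib]
  exact map_mul (quadraticChar (ZMod p)) _ _

/-- coefficients of the L-function -/
noncomputable def lA (n : ℕ) : ℤ := ∑ h ∈ mn p n, lam b h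

/-- character sums over extensions -/
noncomputable def lT (n : ℕ) : ℤ := ∑ x : GaloisField p n, lam b (cp p n x)

theorem lA_zero : lA b 0 = 1 := by
  have : mn p 0 = {1} := by
    ext h
    rw [mem_mn, Finset.mem_singleton]
    constructor
    · rintro ⟨h1, h2⟩; exact h1.natDegree_eq_zero.1 h2
    · rintro rfl; simp
  rw [lA, this, Finset.sum_singleton, lam]
  simp

theorem lA_one : lA b 1 = ∑ x : ZMod p, quadraticChar (ZMod p) (∏ j, (b j - x)) := by
  rw [lA]
  symm
  refine Finset.sum_bij (fun x _ => X - C x) ?_ ?_ ?_ ?_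
  · intro x _; rw [mem_mn]; exact ⟨monic_X_sub_C x, natDegree_X_sub_C x⟩
  · intro x _ y _ h; simpa using h
  · intro h hh
    rw [mem_mn] at hh
    refine ⟨-h.coeff 0, Finset.mem_univ _, ?_⟩
    have := hh.1.eq_X_add_C hh.2
    rw [map_neg, sub_neg_eq_add]; exact this.symm
  · intro x _; simp [lam]

theorem sum_dvd (n j : ℕ) (hj : j ≤ n) (c : (ZMod p)[X]) (hc : c.Monic) (hcj : c.natDegree = j)
    [DecidablePred fun h => c ∣ h] :
    ∑ h ∈ (mn p n).filter (fun h => c ∣ h), lam b h = lam b c * lA b (n - j) := by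
  rw [lA, Finset.mul_sum]
  symm
  refine Finset.sum_bij (fun h _ => c * h) ?_ ?_ ?_ ?_
  · intro h hh
    rw [mem_mn] at hh
    rw [Finset.mem_filter, mem_mn]
    refine ⟨⟨hc.mul hh.1, ?_⟩, dvd_mul_right _ _⟩
    rw [hc.natDegree_mul hh.1, hcj, hh.2]; omega
  · intro h _ h' _ he
    exact mul_left_cancel₀ hc.ne_zero he
  · intro h hh
    rw [Finset.mem_filter, mem_mn] at hh
    obtain ⟨⟨h1, h2⟩, r, rfl⟩ := hh
    have hr : r.Monic := hc.of_mul_monic_left h1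
    refine ⟨r, ?_, rfl⟩
    rw [hc.natDegree_mul hr] at h2
    rw [mem_mn]
    exact ⟨hr, by omega⟩
  · intro h _; rw [lam_mul]

open Classical in
theorem lrec (n : ℕ) : (n : ℤ) * lA b n = ∑ j ∈ Finset.Icc 1 n, lT b j * lA b (n - j) := by
  have h1 : (n : ℤ) * lA b n = ∑ h ∈ mn p n, ∑ j ∈ Finset.Icc 1 n,
      ∑ x : GaloisField p j, if cp p j x ∣ h then lam b h else 0 := by
    rw [lA, Finset.mul_sum]
    refine Finset.sum_congr rfl fun h hh => ?_
    rw [mem_mn] at hh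
    have := count_cp p hh.1
    rw [hh.2] at this
    conv_lhs => rw [← this]
    rw [Nat.cast_sum, Finset.sum_mul]
    refine Finset.sum_congr rfl fun j _ => ?_
    rw [← Finset.sum_filter, Finset.sum_const, nsmul_eq_mul]
  rw [h1, Finset.sum_comm]
  refine Finset.sum_congr rfl fun j hj => ?_
  rw [Finset.mem_Icc] at hj
  rw [Finset.sum_comm, lT, Finset.sum_mul]
  refine Finset.sum_congr rfl fun x _ => ?_
  rw [← Finset.sum_filter]
  exact sum_dvd b n j hj.2 _ (cp_monic p j x) (cp_natDegree p (by omega) x)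

theorem lA_vanish (hp : p ≠ 2) (hb : Function.Injective b) (hd : 0 < d) {n : ℕ} (hn : d ≤ n) :
    lA b n = 0 := by
  classical
  have hchar' : ringChar (ZMod p) ≠ 2 := by rwa [ringChar.eq (ZMod p) p]
  let i0 : Fin d := ⟨0, hd⟩
  let e := Lagrange.basis Finset.univ b i0
  have he0 : e.eval (b i0) = 1 := Lagrange.eval_basis_self hb.injOn (Finset.mem_univ _)
  have he : ∀ j, j ≠ i0 → e.eval (b j) = 0 := fun j hj =>
    Lagrange.eval_basis_of_ne hj.symm (Finset.mem_univ _)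
  have hedeg : e.degree < n := by
    rw [Lagrange.degree_basis hb.injOn (Finset.mem_univ _)]
    simp only [Finset.card_univ, Fintype.card_fin]
    exact_mod_cast (by omega : d - 1 < n)
  have hstep : ∀ t : ZMod p, ∀ h ∈ mn p n, h + C t * e ∈ mn p n := by
    intro t h hh
    rw [mem_mn] at hh ⊢
    have hlt : (C t * e).degree < h.degree := by
      rw [degree_eq_natDegree hh.1.ne_zero, hh.2]
      refine lt_of_le_of_lt ?_ hedeg
      by_cases ht : t = 0
      · simp [ht]
      · rw [degree_C_mul ht]
    refine ⟨hh.1.add_of_left hlt, ?_⟩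
    rw [natDegree_add_eq_left_of_degree_lt hlt, hh.2]
  have hshift : ∀ t : ZMod p, lA b n = ∑ h ∈ mn p n, lam b (h + C t * e) := by
    intro t
    rw [lA]
    refine Finset.sum_bij' (fun h _ => h + C (-t) * e) (fun h _ => h + C t * e)
      (fun h hh => hstep _ h hh) (fun h hh => hstep _ h hh) ?_ ?_ ?_
    · intro h _; simp
    · intro h _; simp
    · intro h _; simp
  have hsum : ∑ t : ZMod p, lA b n = 0 := by
    rw [Finset.sum_congr rfl (fun t _ => hshift t), Finset.sum_comm]
    refine Finset.sum_eq_zero fun h _ => ?_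
    have hl : ∀ t : ZMod p, lam b (h + C t * e)
        = quadraticChar (ZMod p) (h.eval (b i0) + t) *
          quadraticChar (ZMod p) (∏ j ∈ Finset.univ.erase i0, h.eval (b j)) := by
      intro t
      rw [lam, ← map_mul, ← Finset.mul_prod_erase Finset.univ _ (Finset.mem_univ i0)]
      congr 2
      · simp [he0]
      · refine Finset.prod_congr rfl fun j hj => ?_
        simp [he j (Finset.ne_of_mem_erase hj)]
    simp only [hl]
    rw [← Finset.sum_mul]
    have := Equiv.sum_comp (Equiv.addLeft (h.eval (b i0))) (fun t => quadraticChar (ZMod p) t)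
    simp only [Equiv.coe_addLeft] at this
    rw [this, quadraticChar_sum_zero hchar', zero_mul]
  simp only [Finset.sum_const, Finset.card_univ, ZMod.card, nsmul_eq_mul] at hsum
  rcases mul_eq_zero.1 hsum with h | h
  · exact absurd h (by exact_mod_cast (Fact.out : p.Prime).ne_zero)
  · exact h

open Classical in
theorem lT_bound (hp : p ≠ 2) (hd : Odd d) {α : ℕ} (hα : 1 ≤ α) :
    |lT b (2 * α)| ≤ 5 * d * p ^ α := by
  set L := GaloisField p (2 * α)
  have hL0 : 2 * α ≠ 0 := by omega
  have : CharP L p := charP_of_injective_algebraMap (algebraMap (ZMod p) L).injective p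
  set f : L[X] := ∏ i, (C (algebraMap (ZMod p) L (b i)) - X) with hf
  have hdeg : f.natDegree = d := by
    have h1 : ∀ i, (C (algebraMap (ZMod p) L (b i)) - X).natDegree = 1 := by
      intro i
      rw [← natDegree_neg, neg_sub, natDegree_X_sub_C]
    rw [hf, natDegree_prod]
    · simp [h1]
    · intro i _ h
      have := h1 i
      rw [h] at this; simp at this
  have hcard : Fintype.card L = (p ^ α) ^ 2 := by
    rw [← Nat.card_eq_fintype_card, GaloisField.card p _ hL0]; ring
  have h := abs_charsum_le (F := L) p α hp hcard (f := f) (by rwa [hdeg])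
  rw [hdeg] at h
  convert h using 2
  rw [lT]
  refine Finset.sum_congr rfl fun x _ => ?_
  have hN : Algebra.norm (ZMod p) (f.eval x) = ∏ i, (cp p (2 * α) x).eval (b i) := by
    rw [hf, eval_prod, map_prod]
    refine Finset.prod_congr rfl fun i _ => ?_
    have := eval_minpoly_pow (K := ZMod p) x (b i)
    rw [GaloisField.finrank p hL0] at this
    rw [cp, this]
    simp only [eval_sub, eval_C, eval_X]
    rfl
  rw [quadraticChar_norm p hp, lam, hN]

theorem weil_odd (hp : p ≠ 2) (hb : Function.Injective b) (hd : Odd d) :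
    |((∑ x : ZMod p, quadraticChar (ZMod p) (∏ j, (b j - x)) : ℤ) : ℝ)|
      ≤ ((d : ℝ) - 1) * Real.sqrt p := by
  have hd0 : 0 < d := hd.pos
  have hp0 : (0 : ℝ) < p := by exact_mod_cast (Fact.out : p.Prime).pos
  obtain ⟨w, hw⟩ := exists_omega (fun n => (lA b n : ℂ)) (fun n => (lT b n : ℂ)) (d - 1)
    (by simp [lA_zero]) (fun m hm => by
      have := lA_vanish b hp hb hd0 (n := m) (by omega)
      simp [this]) (fun n => by
      have h := congrArg (Int.cast (R := ℂ)) (lrec b n)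
      push_cast at h
      rw [h]
      refine Finset.sum_bij' (fun j _ => (n - j, j)) (fun a _ => a.2) ?_ ?_ ?_ ?_ ?_
      · intro j hj
        simp only [Finset.mem_Icc, Finset.mem_filter, Finset.HasAntidiagonal.mem_antidiagonal] at hj ⊢
        omega
      · rintro ⟨a, c⟩ hj
        simp only [Finset.mem_Icc, Finset.mem_filter, Finset.HasAntidiagonal.mem_antidiagonal] at hj ⊢
        omega
      · intro j _; rfl
      · rintro ⟨a, c⟩ hj
        simp only [Finset.mem_filter, Finset.HasAntidiagonal.mem_antidiagonal] at hj
        ext <;> simp; omega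
      · intro j _; simp [mul_comm])
  have hbound : ∀ i, ‖w i‖ ≤ Real.sqrt p := by
    intro i
    have := root_bound (fun i => w i ^ 2) (5 * d) p hp0 (fun n hn => by
      have h1 := hw (2 * n) (by omega)
      have h2 : ‖((lT b (2 * n) : ℤ) : ℂ)‖ ≤ 5 * d * p ^ n := by
        rw [Complex.norm_intCast]
        exact_mod_cast lT_bound b hp hd hn
      rw [h1, norm_neg] at h2
      simpa only [← pow_mul] using h2) i
    rw [norm_pow] at this
    exact Real.le_sqrt_of_sq_le this
  have h1 := hw 1 le_rfl
  have hr := lrec b 1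
  simp [lA_zero] at hr
  rw [← lA_one, hr]
  have h2 : |((lT b 1 : ℤ) : ℝ)| = ‖((lT b 1 : ℤ) : ℂ)‖ := by rw [Complex.norm_intCast]
  rw [h2, h1, norm_neg]
  refine (norm_sum_le _ _).trans ?_
  refine (Finset.sum_le_sum (g := fun _ => Real.sqrt p) fun i _ => by simpa using hbound i).trans ?_
  simp [Nat.cast_sub (show 1 ≤ d by omega)]

end LFun

end WB

theorem stmt_1 (p : ℕ) [Fact p.Prime] (hp : p ≠ 2) (k : ℕ) (hk : 0 < k) (hke : Even k)
    (a : Fin k → ZMod p) (ha : Function.Injective a) :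
    ((∑ x : ZMod p, quadraticChar (ZMod p) (∏ i, (x + a i)) : ℤ) : ℝ)
      ≤ ((k : ℝ) - 2) * Real.sqrt p - 1 := by
  obtain ⟨d, rfl⟩ : ∃ d, k = d + 1 := ⟨k - 1, by omega⟩
  have hd : Odd d := by
    rw [Nat.even_add_one] at hke; exact Nat.not_even_iff_odd.1 hke
  let c : Fin d → ZMod p := fun i => a i.succ - a 0
  have hc0 : ∀ i, c i ≠ 0 := fun i h => by
    have := ha (sub_eq_zero.1 h)
    exact absurd this (Fin.succ_ne_zero i)
  have hcinj : Function.Injective c := by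
    intro i j h
    have : a i.succ = a j.succ := by simpa [c] using h
    exact Fin.succ_injective _ (ha this)
  let b : Fin d → ZMod p := fun i => (c i)⁻¹
  have hbinj : Function.Injective b := fun i j h => hcinj (inv_injective h)
  have hW := WB.weil_odd b hp hbinj hd
  have e1 : ∑ x : ZMod p, quadraticChar (ZMod p) (∏ i, (x + a i))
      = ∑ u : ZMod p, quadraticChar (ZMod p) (u * ∏ i, (u + c i)) := by
    rw [← Equiv.sum_comp (Equiv.subRight (a 0))
      (fun x => quadraticChar (ZMod p) (∏ i, (x + a i)))]
    refine Finset.sum_congr rfl fun u _ => ?_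
    rw [Fin.prod_univ_succ]
    congr 2
    · simp
    · refine Finset.prod_congr rfl fun i _ => ?_
      simp only [Equiv.subRight_apply, c]
      ring
  have e2 : ∑ u : ZMod p, quadraticChar (ZMod p) (u * ∏ i, (u + c i))
      = ∑ y : ZMod p, quadraticChar (ZMod p) (∏ i, (1 + c i * y)) - 1 := by
    rw [← Equiv.sum_comp (Equiv.inv (ZMod p))
      (fun u => quadraticChar (ZMod p) (u * ∏ i, (u + c i)))]
    rw [← Finset.add_sum_erase _ _ (Finset.mem_univ (0 : ZMod p)),
      ← Finset.add_sum_erase _ (fun y => quadraticChar (ZMod p) (∏ i, (1 + c i * y)))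
        (Finset.mem_univ (0 : ZMod p))]
    have h0 : ∑ y ∈ Finset.univ.erase (0 : ZMod p), quadraticChar (ZMod p)
        ((Equiv.inv (ZMod p)) y *
          ∏ i, ((Equiv.inv (ZMod p)) y + c i))
        = ∑ y ∈ Finset.univ.erase (0 : ZMod p),
          quadraticChar (ZMod p) (∏ i, (1 + c i * y)) := by
      refine Finset.sum_congr rfl fun y hy => ?_
      have hy0 : y ≠ 0 := Finset.ne_of_mem_erase hy
      simp only [Equiv.inv_apply]
      obtain ⟨r, hr⟩ := hke
      have : y⁻¹ * ∏ i, (y⁻¹ + c i) = (y⁻¹ ^ r) ^ 2 * ∏ i, (1 + c i * y) := by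
        have h3 : ∀ i, y⁻¹ + c i = y⁻¹ * (1 + c i * y) := by
          intro i; field_simp
        rw [Finset.prod_congr rfl (fun i _ => h3 i), Finset.prod_mul_distrib]
        simp only [Finset.prod_const, Finset.card_univ, Fintype.card_fin]
        rw [← mul_assoc, ← pow_succ', hr, ← pow_mul, mul_two]
      rw [this, map_mul, quadraticChar_sq_one' (pow_ne_zero _ (inv_ne_zero hy0)), one_mul]
    rw [h0]
    simp
  have e3 : ∑ y : ZMod p, quadraticChar (ZMod p) (∏ i, (1 + c i * y))
      = quadraticChar (ZMod p) (∏ i, c i)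
        * ∑ y : ZMod p, quadraticChar (ZMod p) (∏ j, (b j - y)) := by
    rw [← Equiv.sum_comp (Equiv.neg (ZMod p)), Finset.mul_sum]
    refine Finset.sum_congr rfl fun y _ => ?_
    rw [← map_mul, ← Finset.prod_mul_distrib]
    congr 1
    refine Finset.prod_congr rfl fun i _ => ?_
    simp only [Equiv.neg_apply, b]
    have := hc0 i
    field_simp
    ring
  have hsq : |((quadraticChar (ZMod p) (∏ i, c i) : ℤ) : ℝ)| ≤ 1 := by
    rcases quadraticChar_dichotomy 
        (show ∏ i, c i ≠ 0 from Finset.prod_ne_zero_iff.2 fun i _ => hc0 i) with h | h <;>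
      rw [h] <;> norm_num
  rw [e1, e2, e3]
  push_cast at hW ⊢
  refine sub_le_sub_right ((le_abs_self _).trans ?_) 1
  rw [abs_mul]
  refine (mul_le_of_le_one_left (abs_nonneg _) hsq).trans (hW.trans (le_of_eq ?_))
  ring
end

section
/- Let p be an odd prime and A, B ⊆ 𝔽_p nonempty subsets with A + B ⊆ R_p (nonzero quadratic residues mod p). Then |B|·|A|·(|A|+2)² ≤ 2√p·(|A|²−1)·(|A|−2) − |A|³ + 11|A| − 15 + p·(3|A|+2). -/
open scoped Pointwise

def Rp (p : ℕ) [NeZero p] : Finset (ZMod p) :=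
  Finset.univ.filter fun x => x ≠ 0 ∧ IsSquare x

section HassePart

open Polynomial WeierstrassCurve

section FieldLevel
variable {K : Type*} [Field K]

abbrev WC (a2 a4 : K) : WeierstrassCurve.Affine K := ⟨0, a2, 0, a4, 0⟩


lemma addsub_generic (a2 a4 x1 y1 x2 y2 : K) (hx : x1 ≠ x2)
    (e1 : y1 ^ 2 = x1 ^ 3 + a2 * x1 ^ 2 + a4 * x1)
    (e2 : y2 ^ 2 = x2 ^ 3 + a2 * x2 ^ 2 + a4 * x2) :
    (x1 * x2 - a4) ^ 2 = (x1 - x2) ^ 2 *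
      ((((y1 - y2) / (x1 - x2)) ^ 2 - a2 - x1 - x2) *
       (((y1 + y2) / (x1 - x2)) ^ 2 - a2 - x1 - x2)) ∧
    2 * (x1 * x2 * (x1 + x2) + 2 * a2 * x1 * x2 + a4 * (x1 + x2)) = (x1 - x2) ^ 2 *
      ((((y1 - y2) / (x1 - x2)) ^ 2 - a2 - x1 - x2) +
       (((y1 + y2) / (x1 - x2)) ^ 2 - a2 - x1 - x2)) := by
  have h : x1 - x2 ≠ 0 := sub_ne_zero.mpr hx
  constructor
  · have : ((y1 - y2) ^ 2 - (a2 + x1 + x2) * (x1 - x2) ^ 2) *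
      ((y1 + y2) ^ 2 - (a2 + x1 + x2) * (x1 - x2) ^ 2) =
      (x1 * x2 - a4) ^ 2 * (x1 - x2) ^ 2 := by
      have h1 : ((y1 - y2) ^ 2 - (a2 + x1 + x2) * (x1 - x2) ^ 2) *
        ((y1 + y2) ^ 2 - (a2 + x1 + x2) * (x1 - x2) ^ 2) =
        (y1 ^ 2 - y2 ^ 2) ^ 2 - 2 * (y1 ^ 2 + y2 ^ 2) * ((a2 + x1 + x2) * (x1 - x2) ^ 2) +
        ((a2 + x1 + x2) * (x1 - x2) ^ 2) ^ 2 := by ring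
      rw [h1, e1, e2]; ring
    field_simp
    linear_combination -this
  · field_simp
    linear_combination -2 * e1 - 2 * e2

/-- the vector `w` is a scalar multiple of the vector `v` -/
lemma addsub [DecidableEq K] (h2 : (2 : K) ≠ 0) (a2 a4 : K) (P : (WC a2 a4).Point) (x2 y2 : K)
    (hQ : (WC a2 a4).Nonsingular x2 y2) (hy : y2 ≠ 0) :
    ∃ m : K,
      (P.xRep 0 * x2 - a4 * P.xRep 1) ^ 2 = m *
        ((P + .some x2 y2 hQ).xRep 0 * (P - .some x2 y2 hQ).xRep 0) ∧
      2 * (P.xRep 0 * x2 * (P.xRep 0 + x2 * P.xRep 1) + 2 * a2 * P.xRep 0 * x2 * P.xRep 1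
        + a4 * P.xRep 1 * (P.xRep 0 + x2 * P.xRep 1)) = m *
        ((P + .some x2 y2 hQ).xRep 0 * (P - .some x2 y2 hQ).xRep 1 +
         (P + .some x2 y2 hQ).xRep 1 * (P - .some x2 y2 hQ).xRep 0) ∧
      (P.xRep 0 - x2 * P.xRep 1) ^ 2 = m *
        ((P + .some x2 y2 hQ).xRep 1 * (P - .some x2 y2 hQ).xRep 1) := by
  have e2 : y2 ^ 2 = x2 ^ 3 + a2 * x2 ^ 2 + a4 * x2 := by
    have := ((WC a2 a4).equation_iff x2 y2).1 hQ.1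
    simpa using this
  have hyne : y2 ≠ (WC a2 a4).negY x2 y2 := by
    simp only [Affine.negY]
    intro h
    apply hy
    have : 2 * y2 = 0 := by linear_combination h
    exact (mul_eq_zero.1 this).resolve_left h2
  have hdbl : ∃ m : K, (x2 * x2 - a4) ^ 2 = m *
        ((Affine.Point.some x2 y2 hQ + .some x2 y2 hQ).xRep 0) ∧
      4 * (x2 ^ 3 + a2 * x2 ^ 2 + a4 * x2) = m *
        ((Affine.Point.some x2 y2 hQ + .some x2 y2 hQ).xRep 1) := by
    rw [Affine.Point.add_self_of_Y_ne hyne]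
    refine ⟨4 * y2 ^ 2, ?_, ?_⟩
    · rw [Affine.Point.xRep_some, Affine.slope_of_Y_ne rfl hyne]
      simp only [Affine.addX, Affine.negY, Matrix.cons_val_zero]
      have : y2 - (-y2 - 0 * x2 - 0) = 2 * y2 := by ring
      rw [this]
      field_simp
      rw [e2]
      ring
    · rw [Affine.Point.xRep_some, e2]; simp
  rcases P with _ | ⟨x1, y1, hP⟩
  · refine ⟨1, ?_⟩
    simp only [← Affine.Point.zero_def, zero_add, zero_sub, Affine.Point.xRep_neg,
      Affine.Point.xRep_some, Affine.Point.xRep_zero, Matrix.cons_val_zero, Matrix.cons_val_one]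
    refine ⟨by ring, by ring, by ring⟩
  · have e1 : y1 ^ 2 = x1 ^ 3 + a2 * x1 ^ 2 + a4 * x1 := by
      have := ((WC a2 a4).equation_iff x1 y1).1 hP.1
      simpa using this
    by_cases hx : x1 = x2
    · subst hx
      obtain ⟨m, hm1, hm2⟩ := hdbl
      rcases Affine.Point.X_eq_iff (h₁ := hP) (h₂ := hQ) |>.1 rfl with h | h
      · rw [h, sub_self]
        refine ⟨m, ?_⟩
        simp only [Affine.Point.xRep_zero, Affine.Point.xRep_some, Matrix.cons_val_zero,
          Matrix.cons_val_one]
        refine ⟨by linear_combination hm1, by linear_combination hm2, by ring⟩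
      · rw [h, neg_add_cancel, ← neg_add', Affine.Point.xRep_neg, Affine.Point.xRep_neg]
        refine ⟨m, ?_⟩
        simp only [Affine.Point.xRep_zero, Affine.Point.xRep_some, Matrix.cons_val_zero,
          Matrix.cons_val_one]
        refine ⟨by linear_combination hm1, by linear_combination hm2, by ring⟩
    · have hg := addsub_generic a2 a4 x1 y1 x2 y2 hx e1 e2
      rw [sub_eq_add_neg (Affine.Point.some x1 y1 hP), Affine.Point.neg_some, Affine.Point.add_of_X_ne hx,
        Affine.Point.add_of_X_ne hx]
      simp only [Affine.Point.xRep_some, Matrix.cons_val_zero,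
          Matrix.cons_val_one, Affine.slope_of_X_ne hx, Affine.addX, Affine.negY]
      refine ⟨(x1 - x2) ^ 2, ?_, ?_, ?_⟩
      · linear_combination hg.1
      · linear_combination hg.2
      · ring
end FieldLevel

section PolyLevel
variable {k : Type*} [Field k]

lemma prim_v {R : Type*} [CommRing R] (A B C D : R) (h1 : IsCoprime A B) (h2 : IsCoprime C D) :
    ∃ x y z : R, x * (A * C) + y * (A * D + B * C) + z * (B * D) = 1 := by
  by_contra hcon
  have hI : Ideal.span {A * C, A * D + B * C, B * D} ≠ (⊤ : Ideal R) := by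
    intro h
    apply hcon
    have : (1 : R) ∈ Ideal.span {A * C, A * D + B * C, B * D} := by rw [h]; trivial
    obtain ⟨x, y, z, h⟩ := Submodule.mem_span_triple.1 this
    exact ⟨x, y, z, by simpa only [smul_eq_mul] using h⟩
  obtain ⟨M, hM, hle⟩ := Ideal.exists_le_maximal _ hI
  have hp := hM.isPrime
  have m1 : A * C ∈ M := hle (Ideal.subset_span (by simp))
  have m2 : A * D + B * C ∈ M := hle (Ideal.subset_span (by simp))
  have m3 : B * D ∈ M := hle (Ideal.subset_span (by simp))
  have n1 : ¬ (A ∈ M ∧ B ∈ M) := by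
    rintro ⟨ha, hb⟩
    obtain ⟨x, y, h⟩ := h1
    exact hp.ne_top ((Ideal.eq_top_iff_one M).2 (h ▸ M.add_mem (M.mul_mem_left _ ha) (M.mul_mem_left _ hb)))
  have n2 : ¬ (C ∈ M ∧ D ∈ M) := by
    rintro ⟨ha, hb⟩
    obtain ⟨x, y, h⟩ := h2
    exact hp.ne_top ((Ideal.eq_top_iff_one M).2 (h ▸ M.add_mem (M.mul_mem_left _ ha) (M.mul_mem_left _ hb)))
  rcases hp.mem_or_mem m1 with h | h <;> rcases hp.mem_or_mem m3 with h' | h'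
  · exact n1 ⟨h, h'⟩
  · have : B * C ∈ M := (M.add_mem_iff_right (M.mul_mem_right _ h)).1 m2
    rcases hp.mem_or_mem this with h'' | h''
    · exact n1 ⟨h, h''⟩
    · exact n2 ⟨h'', h'⟩
  · have : A * D ∈ M := (M.add_mem_iff_left (M.mul_mem_right _ h')).1 m2
    rcases hp.mem_or_mem this with h'' | h''
    · exact n1 ⟨h'', h'⟩
    · exact n2 ⟨h, h''⟩
  · exact n2 ⟨h, h'⟩

lemma prim_w (h2 : (2 : k) ≠ 0) (a b : k) (hb : b ≠ 0) (hab : a ^ 2 - 4 * b ≠ 0)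
    (A B : k[X]) (h1 : IsCoprime A B) :
    ∃ x y z : k[X], x * ((A * X - C b * B) ^ 2) +
      y * (2 * (A * X * (A + X * B) + 2 * C a * A * X * B + C b * B * (A + X * B))) +
      z * ((A - X * B) ^ 2) = 1 := by
  by_contra hcon
  set w1 := (A * X - C b * B) ^ 2 with hw1
  set w2 := (2 * (A * X * (A + X * B) + 2 * C a * A * X * B + C b * B * (A + X * B))) with hw2
  set w3 := (A - X * B) ^ 2 with hw3
  have hI : Ideal.span {w1, w2, w3} ≠ (⊤ : Ideal k[X]) := by
    intro h
    apply hcon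
    have : (1 : k[X]) ∈ Ideal.span {w1, w2, w3} := by rw [h]; trivial
    obtain ⟨x, y, z, h⟩ := Submodule.mem_span_triple.1 this
    exact ⟨x, y, z, by simpa only [smul_eq_mul] using h⟩
  obtain ⟨M, hM, hle⟩ := Ideal.exists_le_maximal _ hI
  have hp := hM.isPrime
  have m1 : w1 ∈ M := hle (Ideal.subset_span (by simp))
  have m2 : w2 ∈ M := hle (Ideal.subset_span (by simp))
  have m3 : w3 ∈ M := hle (Ideal.subset_span (by simp))
  have m1' := hp.mem_of_pow_mem _ m1
  have m3' := hp.mem_of_pow_mem _ m3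
  have hunit : ∀ c : k, c ≠ 0 → C c ∉ M := by
    intro c hc h
    exact hp.ne_top (M.eq_top_of_isUnit_mem h (isUnit_C.2 (isUnit_iff_ne_zero.2 hc)))
  have hB : B ∉ M := by
    intro hB
    have hA : A ∈ M := by
      have : A = (A - X * B) + X * B := by ring
      rw [this]; exact M.add_mem m3' (M.mul_mem_left _ hB)
    obtain ⟨x, y, h⟩ := h1
    exact hp.ne_top ((Ideal.eq_top_iff_one M).2 (h ▸ M.add_mem (M.mul_mem_left _ hA) (M.mul_mem_left _ hB)))
  have q1 : X ^ 2 - C b ∈ M := by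
    have : B * (X ^ 2 - C b) = (A * X - C b * B) - X * (A - X * B) := by ring
    have : B * (X ^ 2 - C b) ∈ M := this ▸ M.sub_mem m1' (M.mul_mem_left _ m3')
    exact (hp.mem_or_mem this).resolve_left hB
  have q2 : X * (X ^ 2 + C a * X + C b) ∈ M := by
    have : C (2 * 2) * (B ^ 2 * (X * (X ^ 2 + C a * X + C b))) = w2 - 2 * (A * X + 2 * X ^ 2 * B +
      2 * C a * X * B + C b * B) * (A - X * B) := by
      rw [hw2]; simp only [map_mul, map_ofNat]; ring
    have : C (2 * 2) * (B ^ 2 * (X * (X ^ 2 + C a * X + C b))) ∈ M :=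
      this ▸ M.sub_mem m2 (M.mul_mem_left _ m3')
    have := (hp.mem_or_mem this).resolve_left (hunit _ (mul_ne_zero h2 h2))
    exact (hp.mem_or_mem this).resolve_left (fun h => hB (hp.mem_of_pow_mem _ h))
  rcases hp.mem_or_mem q2 with h | h
  · apply hunit b hb
    have : C b = X * X - (X ^ 2 - C b) := by ring
    rw [this]; exact M.sub_mem (M.mul_mem_left _ h) q1
  · apply hunit (b * (a ^ 2 - 4 * b)) (mul_ne_zero hb hab)
    have : C (b * (a ^ 2 - 4 * b)) = (C a * X - 2 * C b) * (X ^ 2 + C a * X + C b) -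
       (C a * X - 2 * C b + C a ^ 2) * (X ^ 2 - C b) := by
      simp only [map_mul, map_sub, map_pow, map_ofNat]; ring
    rw [this]
    exact M.sub_mem (M.mul_mem_left _ h) (M.mul_mem_left _ q1)

/-- degree bookkeeping -/
lemma deg_step (a b : k) (A B A1 B1 A2 B2 u : k[X]) (hu : IsUnit u) (hg : B.degree < A.degree)
    (e1 : (A * X - C b * B) ^ 2 = u * (A1 * A2))
    (e2 : 2 * (A * X * (A + X * B) + 2 * C a * A * X * B + C b * B * (A + X * B)) =
      u * (A1 * B2 + B1 * A2))
    (e3 : (A - X * B) ^ 2 = u * (B1 * B2)) :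
    A1.natDegree + A2.natDegree = 2 * A.natDegree + 2 ∧ B1.degree < A1.degree ∧
      B2.degree < A2.degree := by
  have hA : A ≠ 0 := by rintro rfl; simp at hg
  set d := A.natDegree with hd
  have dA : A.degree = d := degree_eq_natDegree hA
  have hu0 : u.natDegree = 0 := natDegree_eq_zero_of_isUnit hu
  have hune : u ≠ 0 := hu.ne_zero
  -- degree of At - bB
  have hBd : (B.natDegree : ℤ) + 1 ≤ d ∨ B = 0 := by
    by_cases h : B = 0
    · right; exact h
    · left
      rw [degree_eq_natDegree h, dA] at hg
      have := Nat.cast_lt.1 hg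
      omega
  have hBn : B.natDegree ≤ d := by
    rcases hBd with h | h
    · omega
    · simp [h]
  have hXB : (X * B).natDegree ≤ d := by
    rcases hBd with h | h
    · refine natDegree_mul_le.trans ?_
      rw [natDegree_X]; omega
    · simp [h]
  have hAX : (A * X).natDegree = d + 1 := natDegree_mul_X hA
  have hbB : (C b * B).natDegree ≤ d := (natDegree_C_mul_le _ _).trans hBn
  have hC1 : (A * X - C b * B).natDegree = d + 1 := by
    rw [natDegree_sub_eq_left_of_natDegree_lt (by omega), hAX]
  have hC : (A1 * A2).natDegree = 2 * d + 2 := by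
    have h0 : A1 * A2 ≠ 0 := by
      intro h
      rw [h, mul_zero] at e1
      rw [pow_eq_zero_iff two_ne_zero] at e1
      rw [e1] at hC1; simp at hC1
    have := congrArg natDegree e1
    rw [natDegree_pow, hC1, natDegree_mul hune h0, hu0] at this
    omega
  have hA1 : A1 ≠ 0 := by rintro rfl; simp at hC
  have hA2 : A2 ≠ 0 := by rintro rfl; simp at hC
  rw [natDegree_mul hA1 hA2] at hC
  have hD : (B1 * B2).natDegree ≤ 2 * d := by
    by_cases h0 : B1 * B2 = 0
    · simp [h0]
    have := congrArg natDegree e3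
    rw [natDegree_pow, natDegree_mul hune h0, hu0] at this
    have h3 : (A - X * B).natDegree ≤ d := (natDegree_sub_le_of_le le_rfl hXB).trans (by simp [hd])
    omega
  have hApXB : (A + X * B).natDegree ≤ d := natDegree_add_le_of_degree_le le_rfl hXB
  have hN : (A1 * B2 + B1 * A2).natDegree ≤ 2 * d + 1 := by
    by_cases h0 : A1 * B2 + B1 * A2 = 0
    · simp [h0]
    have := congrArg natDegree e2
    rw [natDegree_mul hune h0, hu0] at this
    have h3 : (2 * (A * X * (A + X * B) + 2 * C a * A * X * B + C b * B * (A + X * B))).natDegree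
        ≤ 2 * d + 1 := by
      have e : (2 * (A * X * (A + X * B) + 2 * C a * A * X * B + C b * B * (A + X * B))) =
        C 2 * ((A * X) * (A + X * B) + C (2 * a) * (A * (X * B)) + (C b * B) * (A + X * B)) := by
        simp only [map_mul, map_ofNat]; ring
      rw [e]
      refine (natDegree_C_mul_le _ _).trans ?_
      refine natDegree_add_le_of_degree_le (natDegree_add_le_of_degree_le ?_ ?_) ?_
      · refine natDegree_mul_le.trans ?_; omega
      · refine (natDegree_C_mul_le _ _).trans (natDegree_mul_le.trans ?_); omega
      · refine natDegree_mul_le.trans ?_; omega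
    omega
  have key : ∀ A1 A2 B1 B2 : k[X], A1 ≠ 0 → A2 ≠ 0 → A1.natDegree + A2.natDegree = 2 * d + 2 →
      (B1 * B2).natDegree ≤ 2 * d → (A1 * B2 + B1 * A2).natDegree ≤ 2 * d + 1 →
      B1.degree < A1.degree := by
    intro A1 A2 B1 B2 hA1 hA2 hC hD hN
    by_contra hcon
    push Not at hcon
    have hB1 : B1 ≠ 0 := by
      rintro rfl
      rw [degree_zero, le_bot_iff, degree_eq_bot] at hcon
      exact hA1 hcon
    have h1 : A1.natDegree ≤ B1.natDegree := natDegree_le_natDegree hcon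
    have h2 : (B1 * A2).natDegree = B1.natDegree + A2.natDegree := natDegree_mul hB1 hA2
    have h3 : (A1 * B2).natDegree < (B1 * A2).natDegree := by
      by_cases hB2 : B2 = 0
      · simp [hB2]; omega
      · rw [natDegree_mul hB1 hB2] at hD
        rw [natDegree_mul hA1 hB2]
        omega
    rw [natDegree_add_eq_right_of_natDegree_lt h3] at hN
    omega
  refine ⟨hC, key A1 A2 B1 B2 hA1 hA2 hC hD hN, key A2 A1 B2 B1 hA2 hA1 (by omega) (by rwa [mul_comm]) ?_⟩
  have : A2 * B1 + B2 * A1 = A1 * B2 + B1 * A2 := by ring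
  rwa [this]

lemma proportional {R : Type*} [CommRing R] (v1 v2 v3 w1 w2 w3 : R)
    (h12 : w1 * v2 = w2 * v1) (h13 : w1 * v3 = w3 * v1) (h23 : w2 * v3 = w3 * v2)
    (hv : ∃ x y z : R, x * v1 + y * v2 + z * v3 = 1)
    (hw : ∃ x y z : R, x * w1 + y * w2 + z * w3 = 1) :
    ∃ u : R, IsUnit u ∧ w1 = u * v1 ∧ w2 = u * v2 ∧ w3 = u * v3 := by
  obtain ⟨x, y, z, hv⟩ := hv
  obtain ⟨x', y', z', hw⟩ := hw
  have a1 : w1 = (x * w1 + y * w2 + z * w3) * v1 := by linear_combination (-w1) * hv + y * h12 + z * h13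
  have a2 : w2 = (x * w1 + y * w2 + z * w3) * v2 := by linear_combination (-w2) * hv - x * h12 + z * h23
  have a3 : w3 = (x * w1 + y * w2 + z * w3) * v3 := by linear_combination (-w3) * hv - x * h13 - y * h23
  refine ⟨x * w1 + y * w2 + z * w3, ?_, a1, a2, a3⟩
  refine IsUnit.of_mul_eq_one (x' * v1 + y' * v2 + z' * v3) ?_
  linear_combination hw - x' * a1 - y' * a2 - z' * a3
end PolyLevel

section Hasse
open scoped Classical in
noncomputable instance instDecFR (p : ℕ) [Fact p.Prime] : DecidableEq (FractionRing (ZMod p)[X]) :=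
  Classical.decEq _

variable {p : ℕ} [Fact p.Prime]

noncomputable abbrev FF (a b : ZMod p) : (ZMod p)[X] := X * (X ^ 2 + C a * X + C b)

noncomputable abbrev phi (p : ℕ) [Fact p.Prime] : (ZMod p)[X] →+* FractionRing (ZMod p)[X] :=
  algebraMap _ _

lemma phi_inj : Function.Injective (phi p) := IsFractionRing.injective _ _

lemma FF_monic (a b : ZMod p) : (FF a b).Monic := by
  unfold FF; monicity!

lemma FF_ne (a b : ZMod p) : FF a b ≠ 0 := (FF_monic a b).ne_zero

lemma phiF_ne (a b : ZMod p) : phi p (FF a b) ≠ 0 := by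
  rw [Ne, map_eq_zero_iff _ phi_inj]; exact FF_ne a b

noncomputable abbrev WE (a b : ZMod p) : WeierstrassCurve.Affine (FractionRing (ZMod p)[X]) :=
  WC (phi p (C a * FF a b)) (phi p (C b * FF a b ^ 2))

def XRepr (a b : ZMod p) (P : (WE a b).Point) (A B : (ZMod p)[X]) : Prop :=
  IsCoprime A B ∧ ∃ κ : FractionRing (ZMod p)[X], κ ≠ 0 ∧
    phi p (FF a b * A) = κ * P.xRep 0 ∧ phi p B = κ * P.xRep 1

lemma rep_exists (a b : ZMod p) (P : (WE a b).Point) : ∃ A B, XRepr a b P A B := by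
  rcases P with _ | ⟨x, y, h⟩
  · refine ⟨1, 0, isCoprime_one_left, phi p (FF a b), phiF_ne a b, ?_, ?_⟩
    · simp [← Affine.Point.zero_def]
    · simp [← Affine.Point.zero_def]
  · obtain ⟨A, ⟨B, hB⟩, hAB, hx⟩ := IsFractionRing.exists_reduced_fraction (ZMod p)[X]
      (x / phi p (FF a b))
    have hB0 : B ≠ 0 := nonZeroDivisors.ne_zero hB
    have hB1 : phi p B ≠ 0 := by rwa [Ne, map_eq_zero_iff _ phi_inj]
    refine ⟨A, B, hAB.isCoprime, phi p B, hB1, ?_, by simp⟩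
    rw [IsFractionRing.mk'_eq_div, div_eq_div_iff hB1 (phiF_ne a b)] at hx
    rw [Affine.Point.xRep_some, map_mul]
    simp only [Matrix.cons_val_zero]
    linear_combination hx

lemma rep_unique (a b : ZMod p) (P : (WE a b).Point) (A B A' B' : (ZMod p)[X])
    (h : XRepr a b P A B) (h' : XRepr a b P A' B') : A.natDegree = A'.natDegree := by
  obtain ⟨hc, κ, hκ, e1, e2⟩ := h
  obtain ⟨hc', κ', hκ', e1', e2'⟩ := h'
  have : A * B' = A' * B := by
    apply phi_inj
    apply mul_left_cancel₀ (phiF_ne a b)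
    rw [map_mul] at e1 e1'
    rw [map_mul (phi p) A, map_mul (phi p) A', ← mul_assoc, ← mul_assoc, e1, e1', e2, e2']
    ring
  have d1 : A ∣ A' := hc.dvd_of_dvd_mul_right (this ▸ dvd_mul_right A B')
  have d2 : A' ∣ A := hc'.dvd_of_dvd_mul_right (this ▸ dvd_mul_right A' B)
  exact natDegree_eq_of_degree_eq (degree_eq_degree_of_associated (associated_of_dvd_dvd d1 d2))

lemma two_ne (hp : p ≠ 2) : (2 : ZMod p) ≠ 0 := by

  exact Ring.two_ne_zero (by rw [ZMod.ringChar_zmod_n]; exact hp)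

lemma two_neK (hp : p ≠ 2) : (2 : FractionRing (ZMod p)[X]) ≠ 0 := by
  have : (2 : FractionRing (ZMod p)[X]) = phi p (C 2) := by rw [map_ofNat C 2, map_ofNat]
  rw [this, Ne, map_eq_zero_iff _ phi_inj, C_eq_zero]
  exact two_ne hp

lemma nonsing_of (hp : p ≠ 2) (a b : ZMod p) (x y : FractionRing (ZMod p)[X]) (hy : y ≠ 0)
    (h : y ^ 2 = x ^ 3 + phi p (C a * FF a b) * x ^ 2 + phi p (C b * FF a b ^ 2) * x) :
    (WE a b).Nonsingular x y := by
  rw [Affine.nonsingular_iff, Affine.equation_iff]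
  refine ⟨by simp only [h]; ring, Or.inr ?_⟩
  intro h'
  have : 2 * y = 0 := by linear_combination h'
  exact hy ((mul_eq_zero.1 this).resolve_left (two_neK hp))

lemma nonsing_Q (hp : p ≠ 2) (a b : ZMod p) (ε : ZMod p) (hε : ε ^ 2 = 1) :
    (WE a b).Nonsingular (phi p (FF a b * X)) (phi p (C ε * FF a b ^ 2)) := by
  apply nonsing_of hp
  · rw [Ne, map_eq_zero_iff _ phi_inj]
    apply mul_ne_zero _ (pow_ne_zero _ (FF_ne a b))
    rw [Ne, C_eq_zero]; rintro rfl; simp at hε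
  · simp only [← map_pow, ← map_mul, ← map_add]
    congr 1
    have : C ε ^ 2 = (1 : (ZMod p)[X]) := by rw [← C_pow, hε, C_1]
    rw [mul_pow, this]
    unfold FF
    ring

lemma FF_pow (a b : ZMod p) : FF a b ^ p = X ^ p * ((X ^ p) ^ 2 + C a * X ^ p + C b) := by
  rw [← ZMod.expand_card]
  simp [FF]

lemma nonsing_P (hp : p ≠ 2) (a b : ZMod p) (q : ℕ) (hq : p = 2 * q + 1) :
    (WE a b).Nonsingular (phi p (FF a b * X ^ p)) (phi p (FF a b ^ (q + 2))) := by
  apply nonsing_of hp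
  · rw [Ne, map_eq_zero_iff _ phi_inj]
    exact pow_ne_zero _ (FF_ne a b)
  · simp only [← map_pow, ← map_mul, ← map_add]
    congr 1
    have : (FF a b ^ (q + 2)) ^ 2 = FF a b ^ 3 * FF a b ^ p := by
      rw [← pow_mul, ← pow_add]; congr 1; omega
    rw [this, FF_pow]
    ring

lemma step (hp : p ≠ 2) (a b : ZMod p) (hb : b ≠ 0) (hab : a ^ 2 - 4 * b ≠ 0)
    (Q : (WE a b).Point) (hQ : Q = .some _ _ (nonsing_Q hp a b 1 (by simp)))
    (P : (WE a b).Point) (A B A1 B1 A2 B2 : (ZMod p)[X]) (h : XRepr a b P A B)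
    (h1 : XRepr a b (P + Q) A1 B1) (h2 : XRepr a b (P - Q) A2 B2) (hg : B.degree < A.degree) :
    A1.natDegree + A2.natDegree = 2 * A.natDegree + 2 ∧ B1.degree < A1.degree ∧
      B2.degree < A2.degree := by
  obtain ⟨hc, κ, hκ, e1, e2⟩ := h
  obtain ⟨hc1, κ1, hκ1, e11, e12⟩ := h1
  obtain ⟨hc2, κ2, hκ2, e21, e22⟩ := h2
  have hyne : phi p (C 1 * FF a b ^ 2) ≠ 0 := by
    rw [Ne, map_eq_zero_iff _ phi_inj, C_1, one_mul]
    exact pow_ne_zero _ (FF_ne a b)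
  obtain ⟨m, m1, m2, m3⟩ := addsub (two_neK hp) _ _ P _ _
    (nonsing_Q hp a b 1 (by simp)) hyne
  rw [← hQ] at m1 m2 m3
  have hF := phiF_ne a b
  set f := phi p (FF a b) with hf
  generalize P.xRep 0 = x at *
  generalize P.xRep 1 = z at *
  generalize (P + Q).xRep 0 = x1 at *
  generalize (P + Q).xRep 1 = z1 at *
  generalize (P - Q).xRep 0 = x2 at *
  generalize (P - Q).xRep 1 = z2 at *
  simp only [map_mul, map_pow, ← hf] at e1 e11 e21 m1 m2 m3
  have hfx : x = f * phi p A / κ := by rw [eq_div_iff hκ]; linear_combination -e1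
  have hfz : z = phi p B / κ := by rw [eq_div_iff hκ]; linear_combination -e2
  have hfx1 : x1 = f * phi p A1 / κ1 := by rw [eq_div_iff hκ1]; linear_combination -e11
  have hfz1 : z1 = phi p B1 / κ1 := by rw [eq_div_iff hκ1]; linear_combination -e12
  have hfx2 : x2 = f * phi p A2 / κ2 := by rw [eq_div_iff hκ2]; linear_combination -e21
  have hfz2 : z2 = phi p B2 / κ2 := by rw [eq_div_iff hκ2]; linear_combination -e22
  subst hfx hfz hfx1 hfz1 hfx2 hfz2
  have hc : ∃ c : FractionRing (ZMod p)[X],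
      phi p ((A * X - C b * B) ^ 2) = c * phi p (A1 * A2) ∧
      phi p (2 * (A * X * (A + X * B) + 2 * C a * A * X * B + C b * B * (A + X * B))) =
        c * phi p (A1 * B2 + B1 * A2) ∧
      phi p ((A - X * B) ^ 2) = c * phi p (B1 * B2) := by
    refine ⟨m * κ ^ 2 / (κ1 * κ2 * f ^ 2), ?_, ?_, ?_⟩
    · simp only [map_mul, map_pow, map_sub]
      field_simp at m1 ⊢
      linear_combination m1
    · simp only [map_mul, map_pow, map_sub, map_add, map_ofNat]
      field_simp at m2 ⊢
      linear_combination m2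
    · simp only [map_mul, map_pow, map_sub]
      field_simp at m3 ⊢
      linear_combination m3
  obtain ⟨c, c1, c2, c3⟩ := hc
  obtain ⟨u, hu, u1, u2, u3⟩ := proportional (A1 * A2) (A1 * B2 + B1 * A2) (B1 * B2) _ _ _
    (phi_inj (by rw [map_mul, map_mul (phi p) (2 * _), c1, c2]; ring))
    (phi_inj (by rw [map_mul, map_mul (phi p) (_ ^ 2), c1, c3]; ring))
    (phi_inj (by rw [map_mul, map_mul (phi p) (_ ^ 2), c2, c3]; ring))
    (prim_v A1 B1 A2 B2 hc1 hc2) (prim_w (two_ne hp) a b hb hab A B (by assumption))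
  exact deg_step a b A B A1 B1 A2 B2 u hu hg u1 u2 u3



lemma natDegree_sub_le_of_le' {R : Type*} [Ring R] {n : ℕ} {f g : R[X]} (hf : f.natDegree ≤ n)
    (hg : g.natDegree ≤ n) : (f - g).natDegree ≤ n :=
  (natDegree_sub_le_of_le hf hg).trans (by simp)

lemma num_degree (a b ε : ZMod p) (hε : ε ^ 2 = 1) (q : ℕ) (hq : p = 2 * q + 1) :
    (FF a b * (FF a b ^ q - C ε) ^ 2 - (C a + X ^ p + X) * (X ^ p - X) ^ 2).natDegree
      ≤ 2 * p + 1 := by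
  have hpp : 2 ≤ p := (Fact.out : p.Prime).two_le
  have h1 : FF a b * (FF a b ^ q) ^ 2 = FF a b ^ p := by
    rw [← pow_mul, ← pow_succ']; congr 1; omega
  have hC : C ε ^ 2 = (1 : (ZMod p)[X]) := by rw [← C_pow, hε, C_1]
  have h2 : FF a b * (FF a b ^ q - C ε) ^ 2 - (C a + X ^ p + X) * (X ^ p - X) ^ 2 =
      C b * X ^ p - C (2 * ε) * FF a b ^ (q + 1) + FF a b + X ^ (2 * p + 1)
      + X ^ (p + 2) - X ^ 3 + C (2 * a) * X ^ (p + 1) - C a * X ^ 2 := by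
    have e1 : FF a b * (FF a b ^ q - C ε) ^ 2 = FF a b * (FF a b ^ q) ^ 2
      - 2 * C ε * FF a b ^ (q + 1) + FF a b * C ε ^ 2 := by ring
    rw [e1, h1, hC, FF_pow]
    simp only [map_mul, map_ofNat]
    ring
  rw [h2]
  have hF : (FF a b).natDegree ≤ 3 := by unfold FF; compute_degree
  have hFq : (FF a b ^ (q + 1)).natDegree ≤ (q + 1) * 3 := natDegree_pow_le_of_le _ hF
  refine natDegree_sub_le_of_le' ?_ ?_
  refine natDegree_add_le_of_degree_le ?_ ?_
  refine natDegree_sub_le_of_le' ?_ ?_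
  refine natDegree_add_le_of_degree_le ?_ ?_
  refine natDegree_add_le_of_degree_le ?_ ?_
  refine natDegree_add_le_of_degree_le ?_ ?_
  refine natDegree_sub_le_of_le' ?_ ?_
  · exact (natDegree_C_mul_X_pow_le _ _).trans (by omega)
  · exact (natDegree_C_mul_le _ _).trans (by omega)
  · omega
  · rw [natDegree_X_pow]
  · rw [natDegree_X_pow]; omega
  · rw [natDegree_X_pow]; omega
  · exact (natDegree_C_mul_X_pow_le _ _).trans (by omega)
  · exact (natDegree_C_mul_X_pow_le _ _).trans (by omega)

lemma chi_cast (hp : p ≠ 2) (q : ℕ) (hq : p = 2 * q + 1) (c : ZMod p) :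
    ((quadraticChar (ZMod p) c : ℤ) : ZMod p) = c ^ q := by
  rw [quadraticChar_eq_pow_of_char_ne_two' (by rw [ZMod.ringChar_zmod_n]; exact hp), ZMod.card]
  congr 1; omega

lemma chi_cases (c : ZMod p) : quadraticChar (ZMod p) c = 0 ∨ quadraticChar (ZMod p) c = 1 ∨
    quadraticChar (ZMod p) c = -1 := quadraticChar_isQuadratic (ZMod p) c

noncomputable def ee (a b : ZMod p) (ε : ℤ) (c : ZMod p) : ℕ :=
  (1 + ε * quadraticChar (ZMod p) ((FF a b).eval c)).toNat

lemma ee_cast (a b : ZMod p) (ε : ℤ) (hε : ε = 1 ∨ ε = -1) (c : ZMod p) :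
    (ee a b ε c : ℤ) = 1 + ε * quadraticChar (ZMod p) ((FF a b).eval c) := by
  unfold ee
  apply Int.toNat_of_nonneg
  rcases hε with rfl | rfl <;> rcases chi_cases ((FF a b).eval c) with h | h | h <;> rw [h] <;> norm_num

lemma frob_dvd (c : ZMod p) : (X - C c) ∣ ((X : (ZMod p)[X]) ^ p - X) := by
  rw [dvd_iff_isRoot, IsRoot.def]; simp

lemma ee_dvd_den (a b : ZMod p) (ε : ℤ) (hε : ε = 1 ∨ ε = -1) (c : ZMod p) :
    (X - C c) ^ (ee a b ε c) ∣ ((X : (ZMod p)[X]) ^ p - X) ^ 2 := by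
  have h : ee a b ε c ≤ 2 := by
    have := ee_cast a b ε hε c
    rcases hε with rfl | rfl <;> rcases chi_cases ((FF a b).eval c) with h | h | h <;>
      rw [h] at this <;> omega
  exact (pow_dvd_pow _ h).trans (pow_dvd_pow_of_dvd (frob_dvd c) 2)

lemma ee_dvd_num (hp : p ≠ 2) (a b : ZMod p) (ε : ℤ) (hε : ε = 1 ∨ ε = -1) (q : ℕ)
    (hq : p = 2 * q + 1) (c : ZMod p) :
    (X - C c) ^ (ee a b ε c) ∣
      (FF a b * (FF a b ^ q - C (ε : ZMod p)) ^ 2 - (C a + X ^ p + X) * (X ^ p - X) ^ 2) := by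
  refine dvd_sub ?_ (Dvd.dvd.mul_left (ee_dvd_den a b ε hε c) _)
  have hcast := ee_cast a b ε hε c
  by_cases h0 : (FF a b).eval c = 0
  · have : ee a b ε c = 1 := by
      rw [h0, quadraticChar_zero] at hcast; simpa using hcast
    rw [this, pow_one]
    exact Dvd.dvd.mul_right (dvd_iff_isRoot.2 h0) _
  · by_cases h1 : quadraticChar (ZMod p) ((FF a b).eval c) = ε
    · have : ee a b ε c = 2 := by
        rw [h1] at hcast
        rcases hε with rfl | rfl <;> omega
      rw [this]
      refine Dvd.dvd.mul_left (pow_dvd_pow_of_dvd ?_ 2) _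
      rw [dvd_iff_isRoot, IsRoot.def, eval_sub, eval_pow, eval_C, ← chi_cast hp q hq, h1, sub_self]
    · have : ee a b ε c = 0 := by
        have hne : quadraticChar (ZMod p) ((FF a b).eval c) ≠ 0 := by
          rwa [Ne, quadraticChar_eq_zero_iff]
        rcases chi_cases ((FF a b).eval c) with h | h | h
        · exact absurd h hne
        · rcases hε with rfl | rfl
          · exact absurd h h1
          · rw [h] at hcast; omega
        · rcases hε with rfl | rfl
          · rw [h] at hcast; omega
          · exact absurd h h1
      rw [this, pow_zero]; exact one_dvd _

lemma bound_deg (hp : p ≠ 2) (a b : ZMod p) (q : ℕ) (hq : p = 2 * q + 1)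
    (ε : ℤ) (hε : ε = 1 ∨ ε = -1) (hε' : ((ε : ZMod p)) ^ 2 = 1) (A B : (ZMod p)[X])
    (h : XRepr a b (.some _ _ (nonsing_P hp a b q hq) + .some _ _ (nonsing_Q hp a b ε hε')) A B) :
    (A.natDegree : ℤ) ≤ p + 1 - ε * ∑ c, quadraticChar (ZMod p) ((FF a b).eval c) := by
  have hp1 : 1 < p := (Fact.out : p.Prime).one_lt
  have hden : ((X : (ZMod p)[X]) ^ p - X) ≠ 0 := FiniteField.X_pow_card_sub_X_ne_zero _ hp1
  have hdend : ((X : (ZMod p)[X]) ^ p - X).natDegree = p :=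
    FiniteField.X_pow_card_sub_X_natDegree_eq _ hp1
  have hF := phiF_ne a b
  have hdK : phi p X ^ p - phi p X ≠ 0 := by
    rw [← map_pow, ← map_sub, Ne, map_eq_zero_iff _ phi_inj]; exact hden
  have hxne : phi p (FF a b * X ^ p) ≠ phi p (FF a b * X) := by
    rw [map_mul, map_mul (phi p) (FF a b) X, Ne, mul_right_inj' hF, map_pow]
    exact sub_ne_zero.1 hdK
  obtain ⟨hc, κ, hκ, e1, e2⟩ := h
  rw [Affine.Point.add_of_X_ne hxne, Affine.Point.xRep_some] at e1 e2
  simp only [Matrix.cons_val_zero, Matrix.cons_val_one, mul_one, Affine.slope_of_X_ne hxne,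
    Affine.addX] at e1 e2
  set N := (FF a b * (FF a b ^ q - C (ε : ZMod p)) ^ 2 - (C a + X ^ p + X) * (X ^ p - X) ^ 2)
    with hN
  have hB : B ≠ 0 := by
    rintro rfl
    rw [map_zero] at e2; exact hκ e2.symm
  have key : A * (X ^ p - X) ^ 2 = B * N := by
    apply phi_inj
    rw [hN]
    generalize hf : FF a b = f at *
    simp only [map_mul, map_pow, map_sub, map_add] at e1 ⊢
    rw [← e2] at e1
    have e3 : phi p f * phi p X ^ p - phi p f * phi p X = phi p f * (phi p X ^ p - phi p X) := by
      ring
    rw [e3] at e1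
    field_simp at e1
    apply mul_left_cancel₀ (pow_ne_zero 3 hF)
    linear_combination e1
  have hBd : B ∣ (X ^ p - X) ^ 2 := hc.symm.dvd_of_dvd_mul_left (key ▸ dvd_mul_right B N)
  obtain ⟨k, hk⟩ := hBd
  have hNk : N = A * k := by
    apply mul_left_cancel₀ hB
    rw [← key, hk]; ring
  have hk0 : k ≠ 0 := by
    rintro rfl
    rw [mul_zero] at hk
    exact hden (pow_eq_zero_iff two_ne_zero |>.1 hk)
  set H := ∏ c : ZMod p, ((X : (ZMod p)[X]) - C c) ^ (ee a b ε c) with hH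
  have hcop : ((Finset.univ : Finset (ZMod p)) : Set (ZMod p)).Pairwise
      (Function.onFun IsCoprime fun c => ((X : (ZMod p)[X]) - C c) ^ (ee a b ε c)) := by
    intro c _ d _ hcd
    exact (isCoprime_X_sub_C_of_isUnit_sub (sub_ne_zero.2 hcd).isUnit).pow
  have hHN : H ∣ N := Finset.prod_dvd_of_coprime hcop (fun c _ => ee_dvd_num hp a b ε hε q hq c)
  have hHD : H ∣ (X ^ p - X) ^ 2 :=
    Finset.prod_dvd_of_coprime hcop (fun c _ => ee_dvd_den a b ε hε c)
  have hHk : H ∣ k := by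
    obtain ⟨s, t, hst⟩ := hc
    have : k = s * N + t * (X ^ p - X) ^ 2 := by
      rw [hNk, hk]; linear_combination (-k) * hst
    rw [this]
    exact dvd_add (Dvd.dvd.mul_left hHN _) (Dvd.dvd.mul_left hHD _)
  have hHdeg : (H.natDegree : ℤ) = p + ε * ∑ c, quadraticChar (ZMod p) ((FF a b).eval c) := by
    rw [hH, natDegree_prod _ _ (fun c _ => pow_ne_zero _ (X_sub_C_ne_zero c))]
    simp only [natDegree_pow, natDegree_X_sub_C, mul_one]
    push_cast
    rw [Finset.sum_congr rfl (fun c _ => ee_cast a b ε hε c), Finset.sum_add_distrib,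
      Finset.mul_sum]
    simp [ZMod.card]
  have hkd : H.natDegree ≤ k.natDegree := natDegree_le_of_dvd hHk hk0
  by_cases hA : A = 0
  · have : k.natDegree ≤ ((X : (ZMod p)[X]) ^ p - X).natDegree * 2 := by
      rw [mul_comm, ← natDegree_pow, hk]
      exact natDegree_le_of_dvd (dvd_mul_left _ _) (mul_ne_zero hB hk0)
    rw [hdend] at this
    simp only [hA, natDegree_zero]
    push_cast
    omega
  · have h1 := num_degree a b (ε : ZMod p) hε' q hq
    rw [← hN, hNk, natDegree_mul hA hk0] at h1
    omega

lemma quad_rec (d : ℤ → ℤ) (h : ∀ n, d (n + 1) + d (n - 1) = 2 * d n + 2) (n : ℤ) :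
    d n = n ^ 2 + n * (d 1 - d 0 - 1) + d 0 ∧
    d (n + 1) = (n + 1) ^ 2 + (n + 1) * (d 1 - d 0 - 1) + d 0 := by
  induction n using Int.induction_on with
  | zero => constructor <;> simp
  | succ i ih =>
    refine ⟨ih.2, ?_⟩
    have := h (i + 1)
    rw [add_sub_cancel_right] at this
    linear_combination this - ih.1 + 2 * ih.2
  | pred i ih =>
    have := h (-i)
    rw [sub_add_cancel]
    refine ⟨?_, ih.1⟩
    linear_combination this - ih.2 + 2 * ih.1

theorem hasse (hp : p ≠ 2) (a b : ZMod p) (hb : b ≠ 0) (hab : a ^ 2 - 4 * b ≠ 0) :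
    (∑ c : ZMod p, quadraticChar (ZMod p) (c * (c ^ 2 + a * c + b))) ^ 2 ≤ 4 * (p : ℤ) := by
  have hodd : Odd p := (Fact.out : p.Prime).odd_of_ne_two hp
  obtain ⟨q, hq⟩ := hodd
  obtain ⟨Q, hQ⟩ : ∃ Q : (WE a b).Point, Q = .some _ _ (nonsing_Q hp a b 1 (by simp)) := ⟨_, rfl⟩
  obtain ⟨P, hP⟩ : ∃ P : (WE a b).Point, P = .some _ _ (nonsing_P hp a b q hq) := ⟨_, rfl⟩
  choose A B hAB using fun n : ℤ => rep_exists a b (P + n • Q)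
  have hR : ∀ n : ℤ, XRepr a b ((P + n • Q) + Q) (A (n + 1)) (B (n + 1)) := by
    intro n
    have := hAB (n + 1)
    rwa [add_zsmul, one_zsmul, ← add_assoc] at this
  have hL : ∀ n : ℤ, XRepr a b ((P + n • Q) - Q) (A (n - 1)) (B (n - 1)) := by
    intro n
    have := hAB (n - 1)
    rwa [sub_zsmul, one_zsmul, ← sub_eq_add_neg, ← add_sub_assoc] at this
  have st := fun n : ℤ => step hp a b hb hab Q hQ _ _ _ _ _ _ _ (hAB n) (hR n) (hL n)
  have hP0 : XRepr a b P (X ^ p) 1 := by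
    refine ⟨isCoprime_one_right, 1, one_ne_zero, ?_, ?_⟩
    · rw [hP, Affine.Point.xRep_some]; simp
    · rw [hP, Affine.Point.xRep_some]; simp
  have hAB0 : XRepr a b P (A 0) (B 0) := by
    have := hAB 0
    rwa [zero_zsmul, add_zero] at this
  have d0 : (A 0).natDegree = p := by
    rw [rep_unique a b P _ _ _ _ hAB0 hP0, natDegree_X_pow]
  have hp1 : 1 < p := (Fact.out : p.Prime).one_lt
  have g0 : (B 0).degree < (A 0).degree := by
    obtain ⟨hc, κ, hκ, e1, e2⟩ := hAB0
    rw [hP, Affine.Point.xRep_some] at e1 e2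
    simp only [Matrix.cons_val_zero, Matrix.cons_val_one, mul_one] at e1 e2
    rw [← e2, ← map_mul] at e1
    have h1 := phi_inj e1
    have h2 : A 0 = B 0 * X ^ p := by
      apply mul_left_cancel₀ (FF_ne a b)
      rw [h1]; ring
    have hB : B 0 ≠ 0 := by
      intro hB
      rw [hB, map_zero] at e2; exact hκ e2.symm
    rw [h2]
    apply degree_lt_degree
    rw [natDegree_mul hB (by simp), natDegree_X_pow]
    omega
  have good : ∀ n : ℤ, (B n).degree < (A n).degree := by
    intro n
    induction n using Int.induction_on with
    | zero => exact g0
    | succ i ih => exact (st i ih).2.1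
    | pred i ih => exact (st (-i) ih).2.2
  have hrec := quad_rec (fun n => ((A n).natDegree : ℤ)) (fun n => by
    have := (st n (good n)).1
    omega)
  set S := ∑ c : ZMod p, quadraticChar (ZMod p) (c * (c ^ 2 + a * c + b)) with hS
  have hS' : ∑ c : ZMod p, quadraticChar (ZMod p) ((FF a b).eval c) = S := by
    rw [hS]; refine Finset.sum_congr rfl fun c _ => ?_
    simp [FF]
  have b1 : ((A 1).natDegree : ℤ) ≤ p + 1 - S := by
    have h := hR 0
    rw [zero_zsmul, add_zero, zero_add, hP, hQ] at h
    have := bound_deg hp a b q hq 1 (Or.inl rfl) (by simp) (A 1) (B 1) (by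
      convert h using 3; simp)
    rwa [hS', one_mul] at this
  have b2 : ((A (-1)).natDegree : ℤ) ≤ p + 1 + S := by
    have h := hL 0
    rw [zero_zsmul, add_zero, zero_sub, hP, hQ, sub_eq_add_neg, Affine.Point.neg_some] at h
    have := bound_deg hp a b q hq (-1) (Or.inr rfl) (by simp) (A (-1)) (B (-1)) (by
      convert h using 3; simp [Affine.negY])
    rw [hS'] at this
    linarith
  have s0 := (st 0 (good 0)).1
  rw [zero_add, zero_sub, d0] at s0
  have d1 : ((A 1).natDegree : ℤ) = p + 1 - S := by omega
  have pos : ∀ n : ℤ, 0 ≤ n ^ 2 - n * S + p := by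
    intro n
    have := (hrec n).1
    simp only [d1, d0] at this
    have h0 : (0 : ℤ) ≤ (A n).natDegree := by positivity
    rw [this] at h0
    linarith
  rcases Int.even_or_odd' S with ⟨k, hk | hk⟩
  · have := pos k
    rw [hk] at this ⊢
    nlinarith
  · have h1 := pos k
    rw [hk] at h1 ⊢
    have h2 : k * (k + 1) ≤ p := by nlinarith
    have h3 : k * (k + 1) ≠ p := by
      intro h
      have := Int.even_mul_succ_self k
      rw [h] at this
      have h4 : Even p := by exact_mod_cast this
      rw [hq] at h4
      exact absurd h4 (by simp)
    have h4 : k * (k + 1) < p := lt_of_le_of_ne h2 h3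
    nlinarith

end Hasse

end HassePart

section CharSums
variable {p : ℕ} [Fact p.Prime]

/-- The real-valued quadratic character. -/
noncomputable def chi (x : ZMod p) : ℝ := ((quadraticChar (ZMod p) x : ℤ) : ℝ)

lemma chi_mul (x y : ZMod p) : chi (x * y) = chi x * chi y := by
  unfold chi
  rw [map_mul]; push_cast; rfl

lemma chi_zero : chi (0 : ZMod p) = 0 := by simp [chi]

lemma chi_sq {x : ZMod p} (hx : x ≠ 0) : chi x ^ 2 = 1 := by
  unfold chi
  have := quadraticChar_sq_one hx
  exact_mod_cast this

lemma chi_one : chi (1 : ZMod p) = 1 := by simp [chi]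

lemma chi_abs {x : ZMod p} (hx : x ≠ 0) : |chi x| = 1 := by
  have := chi_sq hx
  rw [sq] at this
  rcases mul_self_eq_one_iff.1 this with h | h <;> simp [h]

lemma chi_sum (hp : p ≠ 2) : ∑ x : ZMod p, chi x = 0 := by
  unfold chi
  have := quadraticChar_sum_zero (F := ZMod p) (by rw [ZMod.ringChar_zmod_n]; exact hp)
  exact_mod_cast this

lemma chi_sum_shift (hp : p ≠ 2) (a : ZMod p) : ∑ x : ZMod p, chi (x + a) = 0 := by
  rw [← chi_sum hp]
  exact Equiv.sum_comp (Equiv.addRight a) (fun x => chi x)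

lemma chi_sum_lin (hp : p ≠ 2) (u : ZMod p) (hu : u ≠ 0) : ∑ x : ZMod p, chi (1 + u * x) = 0 := by
  rw [← chi_sum hp]
  exact Equiv.sum_comp ((Equiv.mulLeft₀ u hu).trans (Equiv.addLeft 1)) (fun x => chi x)

lemma chi_inv_mul {x : ZMod p} (hx : x ≠ 0) (u : ZMod p) :
    chi (x⁻¹ + u) = chi x * chi (1 + u * x) := by
  have h : 1 + u * x = x * (x⁻¹ + u) := by field_simp
  rw [h, chi_mul, ← mul_assoc, ← sq, chi_sq hx, one_mul]

/-- Inversion as a permutation of `ZMod p`. -/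
def invP (p : ℕ) [Fact p.Prime] : ZMod p ≃ ZMod p := ⟨fun x => x⁻¹, fun x => x⁻¹, inv_inv, inv_inv⟩

lemma invP_apply (x : ZMod p) : invP p x = x⁻¹ := rfl

lemma sum2_base (hp : p ≠ 2) (u : ZMod p) (hu : u ≠ 0) :
    ∑ x : ZMod p, chi x * chi (x + u) = -1 := by
  rw [← Equiv.sum_comp (invP p)]
  have : ∀ x : ZMod p, chi (invP p x) * chi (invP p x + u) =
      chi (1 + u * x) - (if x = 0 then 1 else 0) := by
    intro x
    simp only [invP_apply]
    by_cases hx : x = 0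
    · simp [hx, chi_zero, chi_one]
    · have h1 := chi_inv_mul hx 0
      simp only [add_zero, zero_mul, chi_one, mul_one] at h1
      rw [h1, chi_inv_mul hx u, if_neg hx, ← mul_assoc, ← sq, chi_sq hx]; ring
  rw [Finset.sum_congr rfl (fun x _ => this x), Finset.sum_sub_distrib, chi_sum_lin hp u hu]
  simp

lemma sum2 (hp : p ≠ 2) (a b : ZMod p) (hab : a ≠ b) :
    ∑ x : ZMod p, chi (x + a) * chi (x + b) = -1 := by
  rw [← sum2_base hp (b - a) (sub_ne_zero.2 hab.symm),
    ← Equiv.sum_comp (Equiv.addRight a) (fun x => chi x * chi (x + (b - a)))]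
  refine Finset.sum_congr rfl fun x _ => ?_
  simp

lemma sum3 (hp : p ≠ 2) (a b c : ZMod p) (hab : a ≠ b) (hac : a ≠ c) (hbc : b ≠ c) :
    |∑ x : ZMod p, chi (x + a) * (chi (x + b) * chi (x + c))| ≤ 2 * √(p : ℝ) := by
  have h1 : ∑ x : ZMod p, chi (x + a) * (chi (x + b) * chi (x + c)) =
      ((∑ x : ZMod p, quadraticChar (ZMod p)
        (x * (x ^ 2 + ((b - a) + (c - a)) * x + (b - a) * (c - a))) : ℤ) : ℝ) := by
    push_cast
    rw [← Equiv.sum_comp (Equiv.addRight a) (fun x : ZMod p => ((quadraticChar (ZMod p)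
      (x * (x ^ 2 + ((b - a) + (c - a)) * x + (b - a) * (c - a))) : ℤ) : ℝ))]
    refine Finset.sum_congr rfl fun x _ => ?_
    rw [← chi_mul, ← chi_mul]
    unfold chi
    congr 2
    simp only [Equiv.coe_addRight]
    ring_nf
  have h2 := hasse hp ((b - a) + (c - a)) ((b - a) * (c - a))
    (mul_ne_zero (sub_ne_zero.2 hab.symm) (sub_ne_zero.2 hac.symm)) (by
      have : ((b - a) + (c - a)) ^ 2 - 4 * ((b - a) * (c - a)) = (b - c) ^ 2 := by ring
      rw [this]
      exact pow_ne_zero _ (sub_ne_zero.2 hbc))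
  rw [h1]
  set S := ∑ x : ZMod p, quadraticChar (ZMod p)
        (x * (x ^ 2 + ((b - a) + (c - a)) * x + (b - a) * (c - a)))
  have h3 : (S : ℝ) ^ 2 ≤ 4 * p := by exact_mod_cast h2
  have h4 := Real.abs_le_sqrt h3
  have h5 : √(4 * (p : ℝ)) = 2 * √(p : ℝ) := by
    rw [Real.sqrt_mul (by norm_num), show (4 : ℝ) = 2 ^ 2 by norm_num, Real.sqrt_sq (by norm_num)]
  rwa [h5] at h4

lemma sum4_base (hp : p ≠ 2) (u v w : ZMod p) (hu : u ≠ 0) (hv : v ≠ 0) (hw : w ≠ 0)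
    (huv : u ≠ v) (huw : u ≠ w) (hvw : v ≠ w) :
    ∑ x : ZMod p, chi x * (chi (x + u) * (chi (x + v) * chi (x + w))) ≤ 2 * √(p : ℝ) - 1 := by
  rw [← Equiv.sum_comp (invP p)]
  have : ∀ x : ZMod p, chi (invP p x) * (chi (invP p x + u) *
      (chi (invP p x + v) * chi (invP p x + w))) =
      chi (u * v * w) * (chi (x + u⁻¹) * (chi (x + v⁻¹) * chi (x + w⁻¹)))
        - (if x = 0 then 1 else 0) := by
    intro x
    have e : ∀ u : ZMod p, u ≠ 0 → chi (1 + u * x) = chi u * chi (x + u⁻¹) := by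
      intro u hu
      rw [← chi_mul]; congr 1; field_simp; ring
    simp only [invP_apply]
    rw [chi_mul, chi_mul]
    have e0 : chi u * chi v * chi w * (chi (x + u⁻¹) * (chi (x + v⁻¹) * chi (x + w⁻¹))) =
        chi (1 + u * x) * chi (1 + v * x) * chi (1 + w * x) := by
      rw [e u hu, e v hv, e w hw]; ring
    rw [e0]
    by_cases hx : x = 0
    · simp [hx, chi_zero, chi_one]
    · have h1 := chi_inv_mul hx 0
      simp only [add_zero, zero_mul, chi_one, mul_one] at h1
      rw [h1, chi_inv_mul hx u, chi_inv_mul hx v, chi_inv_mul hx w, if_neg hx]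
      have := chi_sq hx
      linear_combination ((chi x ^ 2 + 1) * chi (1 + u * x) * chi (1 + v * x) * chi (1 + w * x)) * this
  rw [Finset.sum_congr rfl (fun x _ => this x), Finset.sum_sub_distrib, ← Finset.mul_sum]
  have h := sum3 hp u⁻¹ v⁻¹ w⁻¹ (by simpa using huv) (by simpa using huw) (by simpa using hvw)
  have h2 : |chi (u * v * w) * ∑ x : ZMod p, (chi (x + u⁻¹) * (chi (x + v⁻¹) * chi (x + w⁻¹)))|
      ≤ 2 * √(p : ℝ) := by
    rw [abs_mul, chi_abs (mul_ne_zero (mul_ne_zero hu hv) hw), one_mul]; exact h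
  have h3 := (le_abs_self _).trans h2
  simp only [Finset.sum_ite_eq', Finset.mem_univ, if_true]
  linarith

lemma sum4 (hp : p ≠ 2) (a b c d : ZMod p) (hab : a ≠ b) (hac : a ≠ c) (had : a ≠ d)
    (hbc : b ≠ c) (hbd : b ≠ d) (hcd : c ≠ d) :
    ∑ x : ZMod p, chi (x + a) * (chi (x + b) * (chi (x + c) * chi (x + d))) ≤
      2 * √(p : ℝ) - 1 := by
  have h := sum4_base hp (b - a) (c - a) (d - a) (sub_ne_zero.2 hab.symm) (sub_ne_zero.2 hac.symm)
    (sub_ne_zero.2 had.symm) (by simpa using hbc) (by simpa using hbd) (by simpa using hcd)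
  rw [← Equiv.sum_comp (Equiv.addRight a)] at h
  simpa using h
end CharSums

section Esymm
variable {ι : Type*} [DecidableEq ι]

lemma E2_eq (s : Finset ι) (u : ι → ℝ) : ∑ a ∈ s, u a * ∑ b ∈ s.erase a, u b =
    (∑ a ∈ s, u a) ^ 2 - ∑ a ∈ s, u a ^ 2 := by
  have : ∀ a ∈ s, u a * ∑ b ∈ s.erase a, u b = u a * (∑ a ∈ s, u a) - u a ^ 2 := by
    intro a ha
    rw [Finset.sum_erase_eq_sub ha]; ring
  rw [Finset.sum_congr rfl this, Finset.sum_sub_distrib, ← Finset.sum_mul]; ring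

lemma E3_eq (s : Finset ι) (u : ι → ℝ) :
    ∑ a ∈ s, u a * ∑ b ∈ s.erase a, u b * ∑ c ∈ (s.erase a).erase b, u c =
    (∑ a ∈ s, u a) ^ 3 - 3 * (∑ a ∈ s, u a) * (∑ a ∈ s, u a ^ 2) + 2 * ∑ a ∈ s, u a ^ 3 := by
  have : ∀ a ∈ s, u a * ∑ b ∈ s.erase a, u b * ∑ c ∈ (s.erase a).erase b, u c =
      u a * ((∑ a ∈ s, u a) ^ 2 - ∑ a ∈ s, u a ^ 2) - u a ^ 2 * (2 * ∑ a ∈ s, u a)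
        + u a ^ 3 * 2 := by
    intro a ha
    rw [E2_eq, Finset.sum_erase_eq_sub ha, Finset.sum_erase_eq_sub ha]; ring
  rw [Finset.sum_congr rfl this, Finset.sum_add_distrib, Finset.sum_sub_distrib, ← Finset.sum_mul,
    ← Finset.sum_mul, ← Finset.sum_mul]; ring

lemma E4_eq (s : Finset ι) (u : ι → ℝ) :
    ∑ a ∈ s, u a * ∑ b ∈ s.erase a, u b * ∑ c ∈ (s.erase a).erase b, u c *
      ∑ d ∈ ((s.erase a).erase b).erase c, u d =
    (∑ a ∈ s, u a) ^ 4 - 6 * (∑ a ∈ s, u a) ^ 2 * (∑ a ∈ s, u a ^ 2) +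
      3 * (∑ a ∈ s, u a ^ 2) ^ 2 +
      8 * (∑ a ∈ s, u a) * (∑ a ∈ s, u a ^ 3) - 6 * ∑ a ∈ s, u a ^ 4 := by
  set p1 := ∑ a ∈ s, u a with hp1
  set p2 := ∑ a ∈ s, u a ^ 2 with hp2
  set p3 := ∑ a ∈ s, u a ^ 3 with hp3
  have : ∀ a ∈ s, u a * ∑ b ∈ s.erase a, u b * ∑ c ∈ (s.erase a).erase b, u c *
      ∑ d ∈ ((s.erase a).erase b).erase c, u d =
      u a * (p1 ^ 3 - 3 * p1 * p2 + 2 * p3) - u a ^ 2 * (3 * p1 ^ 2 - 3 * p2)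
      + u a ^ 3 * (6 * p1) - u a ^ 4 * 6 := by
    intro a ha
    rw [E3_eq, Finset.sum_erase_eq_sub ha, Finset.sum_erase_eq_sub ha, Finset.sum_erase_eq_sub ha]
    rw [← hp1, ← hp2, ← hp3]; ring
  rw [Finset.sum_congr rfl this, Finset.sum_sub_distrib, Finset.sum_add_distrib,
    Finset.sum_sub_distrib, ← Finset.sum_mul,
    ← Finset.sum_mul, ← Finset.sum_mul, ← Finset.sum_mul, ← hp1, ← hp2, ← hp3]; ring
end Esymm

section Moments
variable {p : ℕ} [Fact p.Prime]

lemma mom2 (hp : p ≠ 2) (A : Finset (ZMod p)) :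
    ∑ x : ZMod p, ∑ a ∈ A, chi (x + a) * ∑ b ∈ A.erase a, chi (x + b) =
      -((A.card : ℝ) ^ 2 - A.card) := by
  have h1 := E2_eq A (fun _ => (1 : ℝ))
  simp only [one_pow, Finset.sum_const, nsmul_eq_mul, mul_one, one_mul] at h1
  rw [← h1, ← Finset.sum_neg_distrib, Finset.sum_comm]
  refine Finset.sum_congr rfl fun a ha => ?_
  simp only [Finset.mul_sum]
  rw [Finset.sum_comm, Finset.sum_congr rfl (g := fun _ => (-1 : ℝ))]
  · simp
  · intro b hb
    exact sum2 hp a b (Finset.ne_of_mem_erase hb).symm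

lemma mom3 (hp : p ≠ 2) (A : Finset (ZMod p)) :
    ∑ x : ZMod p, ∑ a ∈ A, chi (x + a) * ∑ b ∈ A.erase a, chi (x + b) *
      ∑ c ∈ (A.erase a).erase b, chi (x + c) ≤
      (2 * √(p : ℝ)) * ((A.card : ℝ) ^ 3 - 3 * (A.card : ℝ) ^ 2 + 2 * A.card) := by
  have h1 := E3_eq A (fun _ => (1 : ℝ))
  simp only [one_pow, Finset.sum_const (1 : ℝ), nsmul_eq_mul, mul_one] at h1
  have h2 : (A.card : ℝ) ^ 3 - 3 * (A.card : ℝ) ^ 2 + 2 * A.card =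
    (A.card : ℝ) ^ 3 - 3 * A.card * A.card + 2 * A.card := by ring
  rw [h2, ← h1]
  have h3 : ∀ s : Finset (ZMod p), (s.card : ℝ) = ∑ c ∈ s, (1 : ℝ) := by simp
  simp only [h3, Finset.mul_sum]
  rw [Finset.sum_comm]
  refine Finset.sum_le_sum fun a ha => ?_
  rw [Finset.sum_comm]
  refine Finset.sum_le_sum fun b hb => ?_
  rw [Finset.sum_comm]
  refine Finset.sum_le_sum fun c hc => ?_
  simp only [mul_one]
  rw [Finset.mem_erase, Finset.mem_erase] at hc
  rw [Finset.mem_erase] at hb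
  exact (le_abs_self _).trans (sum3 hp a b c hb.1.symm hc.2.1.symm hc.1.symm)

lemma mom4 (hp : p ≠ 2) (A : Finset (ZMod p)) :
    ∑ x : ZMod p, ∑ a ∈ A, chi (x + a) * ∑ b ∈ A.erase a, chi (x + b) *
      ∑ c ∈ (A.erase a).erase b, chi (x + c) * ∑ d ∈ ((A.erase a).erase b).erase c, chi (x + d) ≤
      (2 * √(p : ℝ) - 1) * ((A.card : ℝ) ^ 4 - 6 * (A.card : ℝ) ^ 3 + 11 * (A.card : ℝ) ^ 2
        - 6 * A.card) := by
  have h1 := E4_eq A (fun _ => (1 : ℝ))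
  simp only [one_pow, Finset.sum_const (1 : ℝ), nsmul_eq_mul, mul_one] at h1
  have h2 : (A.card : ℝ) ^ 4 - 6 * (A.card : ℝ) ^ 3 + 11 * (A.card : ℝ) ^ 2
        - 6 * A.card =
    (A.card : ℝ) ^ 4 - 6 * (A.card : ℝ) ^ 2 * A.card + 3 * (A.card : ℝ) ^ 2 +
      8 * A.card * A.card - 6 * A.card := by ring
  rw [h2, ← h1]
  have h3 : ∀ s : Finset (ZMod p), (s.card : ℝ) = ∑ c ∈ s, (1 : ℝ) := by simp
  simp only [h3, Finset.mul_sum]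
  rw [Finset.sum_comm]
  refine Finset.sum_le_sum fun a ha => ?_
  rw [Finset.sum_comm]
  refine Finset.sum_le_sum fun b hb => ?_
  rw [Finset.sum_comm]
  refine Finset.sum_le_sum fun c hc => ?_
  rw [Finset.sum_comm]
  refine Finset.sum_le_sum fun d hd => ?_
  simp only [mul_one]
  rw [Finset.mem_erase, Finset.mem_erase, Finset.mem_erase] at hd
  rw [Finset.mem_erase, Finset.mem_erase] at hc
  rw [Finset.mem_erase] at hb
  exact sum4 hp a b c d hb.1.symm hc.2.1.symm hd.2.2.1.symm hc.1.symm hd.2.1.symm hd.1.symm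

/-- indicator of `-x ∈ A` -/
noncomputable def dl (A : Finset (ZMod p)) (x : ZMod p) : ℝ := if -x ∈ A then 1 else 0

lemma dl_sum (A : Finset (ZMod p)) : ∑ x : ZMod p, dl A x = A.card := by
  unfold dl
  rw [← Equiv.sum_comp (Equiv.neg (ZMod p))]
  simp

lemma p2_eq (A : Finset (ZMod p)) (x : ZMod p) :
    ∑ a ∈ A, chi (x + a) ^ 2 = A.card - dl A x := by
  have : ∀ a ∈ A, chi (x + a) ^ 2 = 1 - (if a = -x then 1 else 0) := by
    intro a _
    by_cases h : a = -x
    · simp [h, chi_zero]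
    · rw [if_neg h, chi_sq, sub_zero]
      intro h'; exact h (eq_neg_of_add_eq_zero_right h')
  rw [Finset.sum_congr rfl this, Finset.sum_sub_distrib]
  simp [dl]

lemma chi_cube (x : ZMod p) : chi x ^ 3 = chi x := by
  by_cases h : x = 0
  · simp [h, chi_zero]
  · rw [pow_succ, chi_sq h, one_mul]

lemma pointwise_bound (A : Finset (ZMod p)) (x : ZMod p) (η S : ℝ)
    (hη : (2 ≤ A.card ∧ η = 1) ∨ (A.card = 1 ∧ η = 0)) (hS : S = ∑ a ∈ A, chi (x + a)) :
    S ^ 2 * (S + 2) ^ 2 ≤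
      (∑ a ∈ A, chi (x + a) * ∑ b ∈ A.erase a, chi (x + b) *
      ∑ c ∈ (A.erase a).erase b, chi (x + c) * ∑ d ∈ ((A.erase a).erase b).erase c, chi (x + d))
      + 4 * (∑ a ∈ A, chi (x + a) * ∑ b ∈ A.erase a, chi (x + b) *
      ∑ c ∈ (A.erase a).erase b, chi (x + c))
      + (6 * A.card - 4) * (∑ a ∈ A, chi (x + a) * ∑ b ∈ A.erase a, chi (x + b))
      + (12 * A.card - 8) * S
      + (3 * (A.card : ℝ) ^ 2 + 2 * A.card) + dl A x * (6 * η - 5) := by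
  have q3 : ∑ a ∈ A, chi (x + a) ^ 3 = S := by
    rw [hS]; exact Finset.sum_congr rfl fun a _ => chi_cube _
  have q4 : ∑ a ∈ A, chi (x + a) ^ 4 = A.card - dl A x := by
    rw [← p2_eq]; refine Finset.sum_congr rfl fun a _ => ?_
    rw [pow_succ, chi_cube, sq]
  rw [E4_eq A (fun a => chi (x + a)), E3_eq A (fun a => chi (x + a)),
    E2_eq A (fun a => chi (x + a)), q3, q4, p2_eq, ← hS]
  have hd : dl A x = 0 ∨ dl A x = 1 := by
    unfold dl; split_ifs <;> simp
  rcases hd with hd | hd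
  · rw [hd]
    apply le_of_eq; ring
  · rw [hd]
    have hv : -η ≤ S ^ 2 + 2 * S := by
      rcases hη with ⟨_, h⟩ | ⟨h1, h⟩
      · rw [h]; nlinarith [sq_nonneg (S + 1)]
      · obtain ⟨a, rfl⟩ := Finset.card_eq_one.1 h1
        have : -x = a := by
          unfold dl at hd
          by_contra hne
          simp [hne] at hd
        subst this
        have : S = 0 := by rw [hS]; simp [chi_zero]
        rw [h, this]; simp
    linarith

lemma total_bound (hp : p ≠ 2) (A : Finset (ZMod p)) (η : ℝ)
    (hη : (2 ≤ A.card ∧ η = 1) ∨ (A.card = 1 ∧ η = 0)) :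
    ∑ x : ZMod p, (∑ a ∈ A, chi (x + a)) ^ 2 * ((∑ a ∈ A, chi (x + a)) + 2) ^ 2 ≤
      (2 * √(p : ℝ) - 1) * ((A.card : ℝ) ^ 4 - 6 * (A.card : ℝ) ^ 3 + 11 * (A.card : ℝ) ^ 2
        - 6 * A.card) +
      4 * ((2 * √(p : ℝ)) * ((A.card : ℝ) ^ 3 - 3 * (A.card : ℝ) ^ 2 + 2 * A.card)) +
      (6 * A.card - 4) * (-((A.card : ℝ) ^ 2 - A.card)) +
      p * (3 * (A.card : ℝ) ^ 2 + 2 * A.card) + A.card * (6 * η - 5) := by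
  refine (Finset.sum_le_sum fun x _ => pointwise_bound A x η _ hη rfl).trans ?_
  have hS : ∑ x : ZMod p, ∑ a ∈ A, chi (x + a) = 0 := by
    rw [Finset.sum_comm]
    exact Finset.sum_eq_zero fun a _ => chi_sum_shift hp a
  have hdl : ∑ x : ZMod p, dl A x * (6 * η - 5) = A.card * (6 * η - 5) := by
    rw [← Finset.sum_mul, dl_sum]
  simp only [Finset.sum_add_distrib]
  rw [← Finset.mul_sum, ← Finset.mul_sum, ← Finset.mul_sum, hdl, hS, mom2 hp]
  have h3 := mom3 hp A
  have h4 := mom4 hp A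
  have hc : ∑ x : ZMod p, 3 * (A.card : ℝ) ^ 2 + ∑ x : ZMod p, 2 * (A.card : ℝ) =
      p * (3 * (A.card : ℝ) ^ 2 + 2 * A.card) := by
    simp [ZMod.card]; ring
  linarith
end Moments

theorem stmt_3 (p : ℕ) [Fact p.Prime] (hp : p ≠ 2) (A B : Finset (ZMod p))
    (hA : A.Nonempty) (hB : B.Nonempty) (h : A + B ⊆ Rp p) :
    (B.card : ℝ) * A.card * (A.card + 2) ^ 2 ≤
      2 * Real.sqrt p * ((A.card : ℝ) ^ 2 - 1) * ((A.card : ℝ) - 2)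
        - (A.card : ℝ) ^ 3 + 11 * A.card - 15 + p * (3 * A.card + 2) := by
  have hn : 0 < A.card := hA.card_pos
  have hlow : (B.card : ℝ) * ((A.card : ℝ) ^ 2 * (A.card + 2) ^ 2) ≤
      ∑ x : ZMod p, (∑ a ∈ A, chi (x + a)) ^ 2 * ((∑ a ∈ A, chi (x + a)) + 2) ^ 2 := by
    rw [← nsmul_eq_mul, ← Finset.sum_const]
    refine le_trans (le_of_eq ?_) (Finset.sum_le_sum_of_subset_of_nonneg (Finset.subset_univ B)
      (fun x _ _ => by positivity))
    refine Finset.sum_congr rfl fun x hx => ?_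
    have : ∑ a ∈ A, chi (x + a) = A.card := by
      rw [Finset.sum_congr rfl (g := fun _ => (1 : ℝ))]
      · simp
      · intro a ha
        have hm := h (Finset.add_mem_add ha hx)
        simp only [Rp, Finset.mem_filter, Finset.mem_univ, true_and] at hm
        rw [add_comm]
        unfold chi
        rw [(quadraticChar_one_iff_isSquare hm.1).2 hm.2]
        simp
    rw [this]
  have hfin : ∀ η : ℝ, ((2 ≤ A.card ∧ η = 1) ∨ (A.card = 1 ∧ η = 0)) →
      0 ≤ 12 * (A.card : ℝ) - 12 - 6 * η → 
      (B.card : ℝ) * A.card * (A.card + 2) ^ 2 ≤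
      2 * Real.sqrt p * ((A.card : ℝ) ^ 2 - 1) * ((A.card : ℝ) - 2)
        - (A.card : ℝ) ^ 3 + 11 * A.card - 15 + p * (3 * A.card + 2) := by
    intro η hη h0
    have ht := hlow.trans (total_bound hp A η hη)
    have hn' : (0 : ℝ) < A.card := by exact_mod_cast hn
    have h1 := mul_nonneg hn'.le h0
    refine le_of_mul_le_mul_left ?_ hn'
    linarith
  rcases Nat.lt_or_ge 1 A.card with h2 | h2
  · have : (2 : ℝ) ≤ A.card := by exact_mod_cast h2
    exact hfin 1 (Or.inl ⟨h2, rfl⟩) (by linarith)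
  · have h1 : A.card = 1 := by omega
    exact hfin 0 (Or.inr ⟨h1, rfl⟩) (by rw [h1]; norm_num)
end

section
/- Let p be an odd prime and suppose A, B ⊆ 𝔽_p satisfy A + B = R_p with |A| ≥ 2 and |B| ≥ 2, where R_p is the set of nonzero quadratic residues mod p. Then (1/4)√p + 1/8 ≤ |A| and |A| < 2√p − 1, and the same bounds hold for |B|. -/
open scoped Pointwise

open Polynomial

def PhiH {R : Type*} [CommRing R] (a b t u v x z : R) : R :=
  (u - t * v) ^ 2 * x ^ 2 - 2 * ((u * t + a * v) * (u + t * v) + 2 * b * v ^ 2) * x * z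
    + ((u * t - a * v) ^ 2 - 4 * b * v * (u + t * v)) * z ^ 2

lemma deg_C_mul_le' {F : Type*} [Field F] (c : F) (q : F[X]) : (C c * q).degree ≤ q.degree := by
  by_cases h : c = 0
  · simp [h]
  · rw [degree_C_mul h]

lemma PhiH_prim {F : Type*} [Field F] (a b : F) (h2 : (2 : F) ≠ 0)
    (hd : 4 * a ^ 3 + 27 * b ^ 2 ≠ 0) (u v π : F[X]) (hc : IsCoprime u v) (hp : Prime π)
    (h1 : π ∣ (u - X * v) ^ 2)
    (h3 : π ∣ 2 * ((u * X + C a * v) * (u + X * v) + 2 * C b * v ^ 2))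
    (h4 : π ∣ (u * X - C a * v) ^ 2 - 4 * C b * v * (u + X * v)) : False := by
  have h1' : π ∣ u - X * v := hp.dvd_of_dvd_pow h1
  obtain ⟨w, hw⟩ := h1'
  have hu : u = X * v + π * w := by linear_combination hw
  have hv : ¬ π ∣ v := by
    intro hv
    have : π ∣ u := by rw [hu]; exact dvd_add (hv.mul_left _) (dvd_mul_right _ _)
    exact hp.not_isUnit (hc.isUnit_of_dvd' this hv)
  have e3 : π ∣ v ^ 2 * (4 * (X ^ 3 + C a * X + C b)) := by
    obtain ⟨c, hcc⟩ := h3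
    rw [hu] at hcc
    refine ⟨c - 2 * (w * X * (2 * X * v + π * w) + (X * v * X + C a * v) * w), ?_⟩
    linear_combination hcc
  have e4 : π ∣ v ^ 2 * ((X ^ 2 - C a) ^ 2 - 8 * C b * X) := by
    obtain ⟨c, hcc⟩ := h4
    rw [hu] at hcc
    refine ⟨c - (w * X * (2 * (X ^ 2 * v - C a * v) + π * w * X) - 4 * C b * v * w), ?_⟩
    linear_combination hcc
  have e3' := (hp.dvd_or_dvd e3).resolve_left fun h => hv (hp.dvd_of_dvd_pow h)
  have e4' := (hp.dvd_or_dvd e4).resolve_left fun h => hv (hp.dvd_of_dvd_pow h)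
  have hC : π ∣ C (4 * (4 * a ^ 3 + 27 * b ^ 2)) := by
    have : C (4 * (4 * a ^ 3 + 27 * b ^ 2)) =
        4 * (3 * X ^ 2 + 4 * C a) * ((X ^ 2 - C a) ^ 2 - 8 * C b * X)
        - (3 * X ^ 3 - 5 * C a * X - 27 * C b) * (4 * (X ^ 3 + C a * X + C b)) := by
      simp only [map_mul, map_add, map_pow, map_ofNat]
      ring
    rw [this]
    exact dvd_sub (e4'.mul_left _) (e3'.mul_left _)
  have h44 : (4 : F) ≠ 0 := by
    have : (4 : F) = 2 * 2 := by norm_num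
    rw [this]; exact mul_ne_zero h2 h2
  exact hp.not_isUnit (isUnit_of_dvd_unit hC (isUnit_C.mpr (mul_ne_zero h44 hd).isUnit))

lemma PhiH_step {F : Type*} [Field F] (a b : F) (h2 : (2 : F) ≠ 0)
    (hd : 4 * a ^ 3 + 27 * b ^ 2 ≠ 0) (u v u' v' : F[X]) (hc : IsCoprime u v)
    (hc' : IsCoprime u' v') (hdeg : v.degree < u.degree) (hdeg' : v'.degree < u'.degree)
    (hΦ : PhiH (C a) (C b) X u' v' u v = 0) :
    ∃ u'' v'' : F[X], IsCoprime u'' v'' ∧ v''.degree < u''.degree ∧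
      PhiH (C a) (C b) X u'' v'' u' v' = 0 ∧
      u.natDegree + u''.natDegree = 2 * u'.natDegree + 2 := by
  have hu0 : u ≠ 0 := by rintro rfl; simp at hdeg
  have hu0' : u' ≠ 0 := by rintro rfl; simp at hdeg'
  set G1 := (u' - X * v') ^ 2 with hG1
  set G2 := 2 * ((u' * X + C a * v') * (u' + X * v') + 2 * C b * v' ^ 2) with hG2
  set G3 := (u' * X - C a * v') ^ 2 - 4 * C b * v' * (u' + X * v') with hG3
  have hQ : G1 * u ^ 2 - G2 * u * v + G3 * v ^ 2 = 0 := hΦ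
  -- factor
  obtain ⟨u'', v'', f1, f2, f3⟩ : ∃ u'' v'', G1 = v * v'' ∧ G2 = u * v'' + v * u'' ∧
      G3 = u * u'' := by
    obtain ⟨r, s, hrs⟩ := hc
    by_cases hv : v = 0
    · subst hv
      have hr : r * u = 1 := by simpa using hrs
      have hG10 : G1 = 0 := by
        have : G1 * u ^ 2 = 0 := by simpa using hQ
        exact (mul_eq_zero.mp this).resolve_right (pow_ne_zero _ hu0)
      refine ⟨r * G3, r * G2, by simp [hG10], ?_, ?_⟩
      · linear_combination (-G2) * hr
      · linear_combination (-G3) * hr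
    · have d1 : v ∣ G1 := by
        have : v ∣ u ^ 2 * G1 := ⟨G2 * u - G3 * v, by linear_combination hQ⟩
        exact (IsCoprime.pow_right (IsCoprime.symm ⟨r, s, hrs⟩)).dvd_of_dvd_mul_left this
      have d3 : u ∣ G3 := by
        have : u ∣ v ^ 2 * G3 := ⟨G2 * v - G1 * u, by linear_combination hQ⟩
        exact (IsCoprime.pow_right (⟨r, s, hrs⟩)).dvd_of_dvd_mul_left this
      obtain ⟨v'', e1⟩ := d1
      obtain ⟨u'', e3⟩ := d3
      refine ⟨u'', v'', e1, ?_, e3⟩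
      have : (u * v) * (G2 - (u * v'' + v * u'')) = 0 := by
        rw [e1, e3] at hQ
        linear_combination -hQ
      have := (mul_eq_zero.mp this).resolve_left (mul_ne_zero hu0 hv)
      linear_combination this
  -- degree of G3
  set d := u'.natDegree with hd'
  have hdu : u'.degree = d := degree_eq_natDegree hu0'
  have dX : (X * v').degree ≤ u'.degree := by
    rw [degree_mul, degree_X]
    rw [hdu] at hdeg' ⊢
    by_cases hv : v' = 0
    · simp [hv]
    · rw [degree_eq_natDegree hv] at hdeg' ⊢
      norm_cast at *
      omega
  have dCv : ∀ c : F, (C c * v').degree ≤ v'.degree := fun c => deg_C_mul_le' c v'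
  have dsum : (u' + X * v').degree ≤ u'.degree :=
    (degree_add_le _ _).trans (max_le le_rfl dX)
  have duX : (u' * X).degree = ((d + 1 : ℕ) : WithBot ℕ) := by
    rw [degree_mul, degree_X, hdu]; rfl
  have dv' : v'.degree < ((d : ℕ) : WithBot ℕ) := hdu ▸ hdeg'
  have dlt : ((d : ℕ) : WithBot ℕ) < ((d + 1 : ℕ) : WithBot ℕ) := by exact_mod_cast Nat.lt_succ_self d
  have dG3a : (u' * X - C a * v').degree = ((d + 1 : ℕ) : WithBot ℕ) := by
    rw [degree_sub_eq_left_of_degree_lt, duX]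
    rw [duX]
    exact ((dCv a).trans_lt dv').trans dlt
  have dbig : (4 * C b * v' * (u' + X * v')).degree < ((2 * d + 2 : ℕ) : WithBot ℕ) := by
    have e : 4 * C b * v' * (u' + X * v') = (C (4 * b) * v') * (u' + X * v') := by
      simp only [map_mul, map_ofNat]
    rw [e, degree_mul]
    calc _ ≤ ((d : ℕ) : WithBot ℕ) + ((d : ℕ) : WithBot ℕ) :=
          add_le_add ((dCv _).trans dv'.le) (dsum.trans hdu.le)
      _ < _ := by norm_cast; omega
  have dG3 : G3.degree = ((2 * d + 2 : ℕ) : WithBot ℕ) := by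
    have e : ((u' * X - C a * v') ^ 2).degree = ((2 * d + 2 : ℕ) : WithBot ℕ) := by
      rw [degree_pow, dG3a]
      norm_cast
    rw [hG3, degree_sub_eq_left_of_degree_lt, e]
    rw [e]; exact dbig
  have dG2 : G2.degree < ((2 * d + 2 : ℕ) : WithBot ℕ) := by
    have e : G2 = C 2 * ((u' * X + C a * v') * (u' + X * v')) + C (4 * b) * v' * v' := by
      simp only [hG2, map_mul, map_ofNat]; ring
    rw [e]
    refine (degree_add_le _ _).trans_lt (max_lt ?_ ?_)
    · refine (deg_C_mul_le' _ _).trans_lt ?_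
      rw [degree_mul]
      calc _ ≤ ((d + 1 : ℕ) : WithBot ℕ) + ((d : ℕ) : WithBot ℕ) := by
            refine add_le_add ?_ (dsum.trans hdu.le)
            refine (degree_add_le _ _).trans (max_le duX.le ?_)
            exact ((dCv a).trans dv'.le).trans dlt.le
        _ < _ := by norm_cast; omega
    · rw [degree_mul]
      calc _ ≤ ((d : ℕ) : WithBot ℕ) + ((d : ℕ) : WithBot ℕ) :=
            add_le_add ((dCv _).trans dv'.le) dv'.le
        _ < _ := by norm_cast; omega
  have hG30 : G3 ≠ 0 := by
    intro h; rw [h, degree_zero] at dG3; exact absurd dG3.symm (WithBot.coe_ne_bot)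
  have hu0'' : u'' ≠ 0 := by rintro rfl; simp [f3] at hG30
  refine ⟨u'', v'', ?_, ?_, ?_, ?_⟩
  · refine isCoprime_of_prime_dvd (fun h => hu0'' h.1) ?_
    intro π hπ h5 h6
    exact PhiH_prim a b h2 hd u' v' π hc' hπ (by rw [← hG1, f1]; exact h6.mul_left _)
      (by rw [← hG2, f2]; exact dvd_add (h6.mul_left _) (h5.mul_left _))
      (by rw [← hG3, f3]; exact h5.mul_left _)
  · by_contra hcon
    push Not at hcon
    have k1 : (v * u'').degree < (u * v'').degree := by
      rw [degree_mul, degree_mul]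
      have hv0 : v'' ≠ 0 := by rintro rfl; simp at hcon; exact hu0'' hcon
      calc v.degree + u''.degree < u.degree + u''.degree := by
            apply WithBot.add_lt_add_right _ hdeg
            simpa using hu0''
        _ ≤ _ := by gcongr
    have k2 : G2.degree = (u * v'').degree := by
      rw [f2, degree_add_eq_left_of_degree_lt k1]
    rw [f3, degree_mul] at dG3
    rw [k2, degree_mul, ← dG3] at dG2
    exact absurd dG2 (not_lt.mpr (by gcongr))
  · have : PhiH (C a) (C b) X u'' v'' u' v' = G1 * u'' ^ 2 - G2 * u'' * v'' + G3 * v'' ^ 2 := by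
      rw [hG1, hG2, hG3, PhiH]; ring
    rw [this, f1, f2, f3]; ring
  · rw [← natDegree_mul hu0 hu0'', ← f3]
    exact natDegree_eq_of_degree_eq_some dG3

lemma PhiH_seq {F : Type*} [Field F] (a b : F) (h2 : (2 : F) ≠ 0)
    (hd : 4 * a ^ 3 + 27 * b ^ 2 ≠ 0) (u v u' v' : F[X]) (hc : IsCoprime u v)
    (hc' : IsCoprime u' v') (hdeg : v.degree < u.degree) (hdeg' : v'.degree < u'.degree)
    (hΦ : PhiH (C a) (C b) X u' v' u v = 0) (n : ℕ) :
    0 ≤ (u.natDegree : ℤ) + n * ((u'.natDegree : ℤ) - u.natDegree) + n * (n - 1) := by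
  induction n generalizing u v u' v' with
  | zero => simp
  | succ n ih =>
    obtain ⟨u'', v'', h1, h3, h4, h5⟩ := PhiH_step a b h2 hd u v u' v' hc hc' hdeg hdeg' hΦ
    have := ih u' v' u'' v'' hc' h1 hdeg' h3 h4
    have h5' : (u.natDegree : ℤ) + u''.natDegree = 2 * u'.natDegree + 2 := by exact_mod_cast h5
    have h6 : (u''.natDegree : ℤ) = 2 * u'.natDegree + 2 - u.natDegree := by linarith
    rw [h6] at this
    push_cast
    linarith
lemma chi_val {p : ℕ} [Fact p.Prime] (x : ZMod p) :
    quadraticChar (ZMod p) x = 0 ∨ quadraticChar (ZMod p) x = 1 ∨ quadraticChar (ZMod p) x = -1 := by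
  by_cases h : x = 0
  · left; simp [h]
  · right; exact quadraticChar_dichotomy h

lemma X_pow_sub_eq_prod (p : ℕ) [Fact p.Prime] :
    (X ^ p - X : (ZMod p)[X]) = ∏ r : ZMod p, (X - C r) := by
  have hp : p.Prime := Fact.out
  have hr : (X ^ p - X : (ZMod p)[X]).roots = Finset.univ.val := by
    have := FiniteField.roots_X_pow_card_sub_X (ZMod p)
    rwa [ZMod.card] at this
  have hm : (X ^ p - X : (ZMod p)[X]).Monic := by
    refine monic_X_pow_sub ?_
    rw [degree_X]
    exact_mod_cast hp.one_lt
  have hd := FiniteField.X_pow_card_sub_X_natDegree_eq (ZMod p) hp.one_lt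
  have := prod_multiset_X_sub_C_of_monic_of_roots_card_eq hm (by
    rw [hr, hd]
    have := ZMod.card p
    rwa [Fintype.card] at this)
  rw [hr] at this
  exact this.symm

lemma N_natDegree (p : ℕ) [Fact p.Prime] (hp2 : p ≠ 2) (a b e : ZMod p) :
    (((X ^ 3 + C a * X + C b : (ZMod p)[X]) * ((X ^ 3 + C a * X + C b) ^ (p / 2) + C e) ^ 2
      - (X ^ p + X) * (X ^ p - X) ^ 2)).natDegree = 2 * p + 1 ∨ e ^ 2 ≠ 1 := by
  by_cases he : e ^ 2 = 1
  swap
  · right; exact he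
  left
  have hp : p.Prime := Fact.out
  have hodd : p % 2 = 1 := hp.eq_two_or_odd.resolve_left hp2
  have hp3 : 3 ≤ p := by have := hp.two_le; omega
  set f : (ZMod p)[X] := X ^ 3 + C a * X + C b with hf
  have hfp : f * (f ^ (p / 2)) ^ 2 = X ^ (3 * p) + C a * X ^ p + C b := by
    have h1 : f * (f ^ (p / 2)) ^ 2 = f ^ p := by
      rw [← pow_mul, ← pow_succ']
      congr 1; omega
    rw [h1, ← ZMod.expand_card, hf]
    simp [pow_mul]
    ring
  have hC : (C e : (ZMod p)[X]) ^ 2 = 1 := by rw [← C_pow, he, C_1]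
  have key : f * (f ^ (p / 2) + C e) ^ 2 - (X ^ p + X) * (X ^ p - X) ^ 2 =
      X ^ (2 * p + 1) + (C a * X ^ p + C b + C (2 * e) * f ^ (p / 2 + 1) + f
        + X ^ (p + 2) - X ^ 3) := by
    have : f * (f ^ (p / 2) + C e) ^ 2 = (X ^ (3 * p) + C a * X ^ p + C b)
        + 2 * C e * f ^ (p / 2 + 1) + f := by
      rw [← hfp]
      linear_combination f * hC
    rw [this]
    simp only [map_mul, map_ofNat]
    ring
  rw [key]
  have hf3 : f.natDegree ≤ 3 := by rw [hf]; compute_degree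
  have hfq : (f ^ (p / 2 + 1)).natDegree ≤ 2 * p := by
    refine (natDegree_pow_le).trans ?_
    calc (p / 2 + 1) * f.natDegree ≤ (p / 2 + 1) * 3 := by gcongr
      _ ≤ 2 * p := by omega
  have hrest : (C a * X ^ p + C b + C (2 * e) * f ^ (p / 2 + 1) + f
        + X ^ (p + 2) - X ^ 3).natDegree ≤ 2 * p := by
    refine (natDegree_sub_le _ _).trans (max_le ?_ ?_)
    · refine (natDegree_add_le _ _).trans (max_le ?_ ?_)
      · refine (natDegree_add_le _ _).trans (max_le ?_ ?_)
        · refine (natDegree_add_le _ _).trans (max_le ?_ ?_)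
          · refine (natDegree_add_le _ _).trans (max_le ?_ ?_)
            · exact (natDegree_C_mul_X_pow_le _ _).trans (by omega)
            · simp
          · exact (natDegree_C_mul_le _ _).trans hfq
        · omega
      · rw [natDegree_X_pow]; omega
    · rw [natDegree_X_pow]; omega
  rw [natDegree_add_eq_left_of_natDegree_lt, natDegree_X_pow]
  rw [natDegree_X_pow]; omega

lemma start_pair (p : ℕ) [Fact p.Prime] (hp2 : p ≠ 2) (a b : ZMod p)
    (hd : 4 * a ^ 3 + 27 * b ^ 2 ≠ 0) (ε : ℤ) (hε : ε = 1 ∨ ε = -1) :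
    ∃ u v : (ZMod p)[X], IsCoprime u v ∧ v.degree < u.degree ∧
      PhiH (C a) (C b) X u v (X ^ p) 1 = 0 ∧
      (u.natDegree : ℤ) = p + 1 + ε * ∑ r : ZMod p, quadraticChar (ZMod p) (r ^ 3 + a * r + b) := by
  have hp : p.Prime := Fact.out
  have hodd : p % 2 = 1 := hp.eq_two_or_odd.resolve_left hp2
  have h2 : (2 : ZMod p) ≠ 0 := by
    intro h
    have : ((2 : ℕ) : ZMod p) = 0 := by exact_mod_cast h
    rw [ZMod.natCast_eq_zero_iff] at this
    exact hp2 ((Nat.prime_dvd_prime_iff_eq hp Nat.prime_two).mp this)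
  have hchar : ringChar (ZMod p) ≠ 2 := by rwa [ZMod.ringChar_zmod_n]
  obtain ⟨f, hf⟩ : ∃ f : (ZMod p)[X], f = X ^ 3 + C a * X + C b := ⟨_, rfl⟩
  set χ : ZMod p → ℤ := fun r => quadraticChar (ZMod p) (r ^ 3 + a * r + b) with hχ
  have hfr : ∀ r, f.eval r = r ^ 3 + a * r + b := by intro r; simp [hf]
  have hpow : ∀ r, (f.eval r) ^ (p / 2) = ((χ r : ℤ) : ZMod p) := by
    intro r
    rw [hfr, hχ]
    have := quadraticChar_eq_pow_of_char_ne_two' hchar (r ^ 3 + a * r + b)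
    rw [this, ZMod.card]
  set E : ZMod p := (ε : ZMod p) with hE
  have hE2 : E ^ 2 = 1 := by rcases hε with h | h <;> simp [hE, h]
  set N := f * (f ^ (p / 2) + C E) ^ 2 - (X ^ p + X) * (X ^ p - X) ^ 2 with hN
  have hNdeg : N.natDegree = 2 * p + 1 := by
    rw [hN, hf]
    exact (N_natDegree p hp2 a b E).resolve_right (not_not.mpr hE2)
  have hN0 : N ≠ 0 := by intro h; rw [h] at hNdeg; simp at hNdeg
  set e : ZMod p → ℕ := fun r => (1 - ε * χ r).toNat with he
  set e' : ZMod p → ℕ := fun r => (1 + ε * χ r).toNat with he'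
  have hχv : ∀ r, χ r = 0 ∨ χ r = 1 ∨ χ r = -1 := fun r => chi_val _
  have hee : ∀ r, e r + e' r = 2 := by
    intro r
    rcases hε with h | h <;> rcases hχv r with h' | h' | h' <;> simp [he, he', h, h']
  have hez : ∀ r, ((e r : ℕ) : ℤ) = 1 - ε * χ r := by
    intro r
    rcases hε with h | h <;> rcases hχv r with h' | h' | h' <;> simp [he, h, h']
  have hez' : ∀ r, ((e' r : ℕ) : ℤ) = 1 + ε * χ r := by
    intro r
    rcases hε with h | h <;> rcases hχv r with h' | h' | h' <;> simp [he', h, h']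
  set W : (ZMod p)[X] := X ^ p - X with hW
  have hWp : W = ∏ r : ZMod p, (X - C r) := X_pow_sub_eq_prod p
  set g : (ZMod p)[X] := ∏ r : ZMod p, (X - C r) ^ e r with hg
  set v : (ZMod p)[X] := ∏ r : ZMod p, (X - C r) ^ e' r with hv
  have hgv : g * v = W ^ 2 := by
    rw [hg, hv, hWp, ← Finset.prod_mul_distrib, ← Finset.prod_pow]
    refine Finset.prod_congr rfl fun r _ => ?_
    rw [← pow_add, hee]
  have hWr : ∀ r, (X - C r) ∣ W := by
    intro r; rw [hWp]; exact Finset.dvd_prod_of_mem _ (Finset.mem_univ r)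
  have hNr : ∀ r, (X - C r) ^ e r ∣ N := by
    intro r
    have hW2 : ∀ k ≤ 2, (X - C r) ^ k ∣ (X ^ p + X) * W ^ 2 := by
      intro k hk
      exact ((pow_dvd_pow _ hk).trans (pow_dvd_pow_of_dvd (hWr r) 2)).mul_left _
    have hle : e r ≤ 2 := by have := hee r; omega
    refine dvd_sub ?_ (hW2 _ hle)
    by_cases h0 : χ r = 0
    · have : e r = 1 := by have := hez r; rw [h0] at this; simp at this; exact_mod_cast this
      rw [this, pow_one]
      refine Dvd.dvd.mul_right ?_ _
      rw [dvd_iff_isRoot, IsRoot, hfr]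
      exact quadraticChar_eq_zero_iff.mp h0
    · by_cases h1 : χ r = ε
      · have : e r = 0 := by
          have := hez r
          rw [h1] at this
          rcases hε with h | h <;> rw [h] at this <;> simp at this <;> exact_mod_cast this
        rw [this, pow_zero]; exact one_dvd _
      · have h1' : χ r = -ε := by
          rcases hε with h | h <;> rcases hχv r with h' | h' | h' <;> simp_all
        refine Dvd.dvd.mul_left ?_ _
        refine (pow_dvd_pow _ hle).trans (pow_dvd_pow_of_dvd ?_ 2)
        rw [dvd_iff_isRoot, IsRoot, eval_add, eval_pow, hpow, h1', eval_C, hE]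
        push_cast; ring
  have hgN : g ∣ N := by
    refine Finset.prod_dvd_of_coprime ?_ (fun r _ => hNr r)
    intro r _ s _ hrs
    exact IsCoprime.pow (pairwise_coprime_X_sub_C (s := id) Function.injective_id hrs)
  obtain ⟨u, hu⟩ := hgN
  have hg0 : g ≠ 0 := by rintro h; rw [h] at hu; simp at hu; exact hN0 hu
  have hu0 : u ≠ 0 := by rintro h; rw [h] at hu; simp at hu; exact hN0 hu
  have hdg : (g.natDegree : ℤ) = p - ε * ∑ r, χ r := by
    rw [hg, natDegree_prod_of_monic _ _ (fun r _ => (monic_X_sub_C r).pow _)]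
    simp only [natDegree_pow, natDegree_X_sub_C, mul_one]
    push_cast
    rw [Finset.sum_congr rfl (fun r _ => hez r), Finset.sum_sub_distrib, ← Finset.mul_sum]
    simp [ZMod.card]
  have hdv : (v.natDegree : ℤ) = p + ε * ∑ r, χ r := by
    rw [hv, natDegree_prod_of_monic _ _ (fun r _ => (monic_X_sub_C r).pow _)]
    simp only [natDegree_pow, natDegree_X_sub_C, mul_one]
    push_cast
    rw [Finset.sum_congr rfl (fun r _ => hez' r), Finset.sum_add_distrib, ← Finset.mul_sum]
    simp [ZMod.card]
  have hdu : (u.natDegree : ℤ) = p + 1 + ε * ∑ r, χ r := by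
    have := natDegree_mul hg0 hu0
    rw [← hu, hNdeg] at this
    have : (2 * (p : ℤ) + 1) = g.natDegree + u.natDegree := by exact_mod_cast this
    linarith
  refine ⟨u, v, ?_, ?_, ?_, hdu⟩
  · refine IsCoprime.prod_right fun r _ => ?_
    by_cases h0 : χ r = -ε
    · have : e' r = 0 := by
        have := hez' r
        rw [h0] at this
        rcases hε with h | h <;> rw [h] at this <;> simp at this <;> exact_mod_cast this
      rw [this, pow_zero]; exact isCoprime_one_right
    · refine IsCoprime.pow_right ?_
      have hur : ¬ (X - C r) ∣ u := by
        intro hdiv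
        have hWroot : W.eval r = 0 := (dvd_iff_isRoot.mp (hWr r))
        by_cases h1 : χ r = 0
        · have he1 : e r = 1 := by have := hez r; rw [h1] at this; simp at this; exact_mod_cast this
          have hgr : (X - C r) ∣ g := by
            have := Finset.dvd_prod_of_mem (fun r => (X - C r : (ZMod p)[X]) ^ e r) (Finset.mem_univ r)
            simpa [he1] using this
          have hN2 : (X - C r) ^ 2 ∣ N := by rw [hu, pow_two]; exact mul_dvd_mul hgr hdiv
          have hN3 : (X - C r) ^ 2 ∣ f * (f ^ (p / 2) + C E) ^ 2 := by
            have : f * (f ^ (p / 2) + C E) ^ 2 = N + (X ^ p + X) * W ^ 2 := by rw [hN]; ring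
            rw [this]
            exact dvd_add hN2 ((pow_dvd_pow_of_dvd (hWr r) 2).mul_left _)
          have hcop : IsCoprime ((X - C r) ^ 2) ((f ^ (p / 2) + C E) ^ 2) := by
            refine IsCoprime.pow ?_
            refine ((prime_X_sub_C r).irreducible.coprime_iff_not_dvd).mpr ?_
            rw [dvd_iff_isRoot, IsRoot, eval_add, eval_pow, hpow, h1, eval_C]
            intro h
            have : E = 0 := by simpa using h
            rw [this] at hE2; simp at hE2
          have hf2 : (X - C r) ^ 2 ∣ f := hcop.dvd_of_dvd_mul_right hN3
          have hfz : r ^ 3 + a * r + b = 0 := quadraticChar_eq_zero_iff.mp h1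
          have hfd : 3 * r ^ 2 + a = 0 := by
            obtain ⟨k, hk⟩ := hf2
            rw [pow_two] at hk
            have := congrArg (fun q => (derivative q).eval r) hk
            simp [hf, derivative_mul] at this
            linear_combination this
          apply hd
          have ha : a = -3 * r ^ 2 := by linear_combination hfd
          have hb : b = 2 * r ^ 3 := by linear_combination hfz - r * hfd
          rw [hb, ha]; ring
        · have h2' : χ r = ε := by
            rcases hε with h | h <;> rcases hχv r with h' | h' | h' <;> simp_all
          have hNr0 : N.eval r = 0 := by
            rw [hu, eval_mul, (dvd_iff_isRoot.mp hdiv : u.eval r = 0), mul_zero]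
          rw [hN, eval_sub, eval_mul, eval_mul, eval_pow, eval_pow, eval_add, eval_pow, hpow, h2',
            hWroot, eval_C, ← hE] at hNr0
          have h4 : f.eval r * (2 * E) ^ 2 = 0 := by linear_combination hNr0
          have hEne : E ≠ 0 := by intro h; rw [h] at hE2; simp at hE2
          have := (mul_eq_zero.mp h4).resolve_right (pow_ne_zero _ (mul_ne_zero h2 hEne))
          rw [hfr] at this
          exact h1 (quadraticChar_eq_zero_iff.mpr this)
      exact (((prime_X_sub_C r).irreducible.coprime_iff_not_dvd).mpr hur).symm
  · have : v.natDegree < u.natDegree := by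
      have : (v.natDegree : ℤ) < u.natDegree := by rw [hdv, hdu]; linarith
      exact_mod_cast this
    exact degree_lt_degree this
  · have hW0 : W ≠ 0 := by
      intro h; rw [h] at hgv
      have hv0 : v ≠ 0 := (monic_prod_of_monic _ _ (fun r _ => (monic_X_sub_C r).pow _)).ne_zero
      simp at hgv
      exact hgv.elim hg0 hv0
    have hfp : f * (f ^ (p / 2)) ^ 2 = (X ^ p) ^ 3 + C a * X ^ p + C b := by
      have h1 : f * (f ^ (p / 2)) ^ 2 = f ^ p := by
        rw [← pow_mul, ← pow_succ']
        congr 1; omega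
      rw [h1, ← ZMod.expand_card, hf]
      simp
    have hC : (C E : (ZMod p)[X]) ^ 2 = 1 := by rw [← C_pow, hE2, C_1]
    have hz : g ^ 2 * PhiH (C a) (C b) X u v (X ^ p) 1 = 0 := by
      have e1 : g ^ 2 * PhiH (C a) (C b) X u v (X ^ p) 1 =
          PhiH (C a) (C b) X (g * u) (g * v) (X ^ p) 1 := by rw [PhiH, PhiH]; ring
      rw [e1, ← hu, hgv, hN]
      rw [hf] at hfp ⊢
      rw [hW]
      generalize (X ^ 3 + C a * X + C b : (ZMod p)[X]) ^ (p / 2) = y at hfp ⊢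
      generalize (X ^ p : (ZMod p)[X]) = x at hfp ⊢
      have hNe : (X ^ 3 + C a * X + C b) * (y + C E) ^ 2 - (x + X) * (x - X) ^ 2 =
          ((x * X + C a) * (x + X) + 2 * C b) + 2 * (X ^ 3 + C a * X + C b) * C E * y := by
        linear_combination hfp + (X ^ 3 + C a * X + C b) * hC
      rw [hNe, PhiH]
      linear_combination (x - X) ^ 2 * (4 * (X ^ 3 + C a * X + C b) ^ 2 * y ^ 2 * hC
        + 4 * (X ^ 3 + C a * X + C b) * hfp)
    exact (mul_eq_zero.mp hz).resolve_left (pow_ne_zero _ hg0)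

lemma hasse_quad (p : ℕ) [Fact p.Prime] (hp2 : p ≠ 2) (a b : ZMod p)
    (hd : 4 * a ^ 3 + 27 * b ^ 2 ≠ 0) (ε : ℤ) (hε : ε = 1 ∨ ε = -1) (n : ℕ) :
    0 ≤ (p : ℤ) + ε * (∑ r : ZMod p, quadraticChar (ZMod p) (r ^ 3 + a * r + b)) * n + n ^ 2 := by
  have hp : p.Prime := Fact.out
  have h2 : (2 : ZMod p) ≠ 0 := by
    intro h
    have : ((2 : ℕ) : ZMod p) = 0 := by exact_mod_cast h
    rw [ZMod.natCast_eq_zero_iff] at this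
    exact hp2 ((Nat.prime_dvd_prime_iff_eq hp Nat.prime_two).mp this)
  obtain ⟨u, v, hc, hdeg, hΦ, hu⟩ := start_pair p hp2 a b hd ε hε
  have := PhiH_seq a b h2 hd (X ^ p) 1 u v isCoprime_one_right hc
    (by rw [degree_one, degree_X_pow]; exact_mod_cast hp.pos) hdeg hΦ n
  rw [natDegree_X_pow, hu] at this
  linarith

lemma hasse_s4 (p : ℕ) [Fact p.Prime] (hp2 : p ≠ 2) (a b : ZMod p)
    (hd : 4 * a ^ 3 + 27 * b ^ 2 ≠ 0) :
    (∑ r : ZMod p, quadraticChar (ZMod p) (r ^ 3 + a * r + b)) ^ 2 < 4 * (p : ℤ) := by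
  have hp : p.Prime := Fact.out
  have h1 := fun n => hasse_quad p hp2 a b hd 1 (Or.inl rfl) n
  have h2 := fun n => hasse_quad p hp2 a b hd (-1) (Or.inr rfl) n
  generalize (∑ r : ZMod p, quadraticChar (ZMod p) (r ^ 3 + a * r + b)) = T at *
  have h3 : ∀ n : ℕ, 0 ≤ (p : ℤ) - (T.natAbs : ℤ) * n + n ^ 2 := by
    intro n
    rcases Int.natAbs_eq T with h | h
    · have := h2 n; rw [h] at this; simpa [sub_eq_add_neg] using this
    · have := h1 n; rw [h] at this; simpa [sub_eq_add_neg] using this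
  rw [← Int.natAbs_sq]
  generalize T.natAbs = t at *
  obtain ⟨k, hk | hk⟩ : ∃ k, t = 2 * k ∨ t = 2 * k + 1 := ⟨t / 2, by omega⟩
  · have := h3 k
    have hkp : k ^ 2 ≤ p := by rw [hk] at this; push_cast at this; zify; linarith
    have hne : k ^ 2 ≠ p := by
      intro h
      exact (Nat.Prime.prime hp).not_isSquare ⟨k, by rw [← h, pow_two]⟩
    have : k ^ 2 < p := lt_of_le_of_ne hkp hne
    rw [hk]; zify at this; push_cast; linarith
  · have := h3 k
    have hkp : k ^ 2 + k ≤ p := by rw [hk] at this; push_cast at this; zify; linarith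
    have hne : k ^ 2 + k ≠ p := by
      intro h
      have h2k : 2 ∣ k ^ 2 + k := by
        have := (Nat.even_mul_succ_self k).two_dvd
        rwa [show k ^ 2 + k = k * (k + 1) by ring]
      rw [h] at h2k
      exact hp2 ((Nat.prime_dvd_prime_iff_eq Nat.prime_two hp).mp h2k).symm
    have : k ^ 2 + k < p := lt_of_le_of_ne hkp hne
    rw [hk]; zify at this; push_cast; linarith

lemma cubic_bound (p : ℕ) [Fact p.Prime] (hp2 : p ≠ 2) (hp3 : p ≠ 3) (r₁ r₂ r₃ : ZMod p)
    (h12 : r₁ ≠ r₂) (h13 : r₁ ≠ r₃) (h23 : r₂ ≠ r₃) :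
    (∑ y : ZMod p, quadraticChar (ZMod p) ((y + r₁) * (y + r₂) * (y + r₃))) ^ 2 < 4 * (p : ℤ) := by
  have hp : p.Prime := Fact.out
  have h3 : (3 : ZMod p) ≠ 0 := by
    intro h
    have : ((3 : ℕ) : ZMod p) = 0 := by exact_mod_cast h
    rw [ZMod.natCast_eq_zero_iff] at this
    exact hp3 ((Nat.prime_dvd_prime_iff_eq hp Nat.prime_three).mp this)
  obtain ⟨s, hs⟩ : ∃ s : ZMod p, 3 * s = r₁ + r₂ + r₃ := ⟨(r₁ + r₂ + r₃) / 3, by field_simp⟩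
  obtain ⟨q₁, hq₁⟩ : ∃ q, r₁ = q + s := ⟨r₁ - s, by ring⟩
  obtain ⟨q₂, hq₂⟩ : ∃ q, r₂ = q + s := ⟨r₂ - s, by ring⟩
  obtain ⟨q₃, hq₃⟩ : ∃ q, r₃ = q + s := ⟨r₃ - s, by ring⟩
  have hq : q₃ = - q₁ - q₂ := by linear_combination hq₁ + hq₂ + hq₃ - hs - hq₁ * 2 - hq₂ * 2 - hq₃ * 2
  subst hq₁ hq₂ hq₃
  have hd : 4 * (q₁ * q₂ + q₁ * q₃ + q₂ * q₃) ^ 3 + 27 * (q₁ * q₂ * q₃) ^ 2 ≠ 0 := by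
    have h12' : q₁ - q₂ ≠ 0 := fun h => h12 (by rw [sub_eq_zero.mp h])
    have h13' : q₁ - q₃ ≠ 0 := fun h => h13 (by rw [sub_eq_zero.mp h])
    have h23' : q₂ - q₃ ≠ 0 := fun h => h23 (by rw [sub_eq_zero.mp h])
    have : 4 * (q₁ * q₂ + q₁ * q₃ + q₂ * q₃) ^ 3 + 27 * (q₁ * q₂ * q₃) ^ 2 =
        - ((q₁ - q₂) * (q₁ - q₃) * (q₂ - q₃)) ^ 2 := by rw [hq]; ring
    rw [this]
    exact neg_ne_zero.mpr (pow_ne_zero _ (mul_ne_zero (mul_ne_zero h12' h13') h23'))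
  have := hasse_s4 p hp2 _ _ hd
  rw [← Equiv.sum_comp (Equiv.addRight s)] at this
  refine lt_of_eq_of_lt ?_ this
  congr 1
  refine Finset.sum_congr rfl fun y _ => ?_
  congr 1
  simp only [Equiv.coe_addRight]
  rw [hq]; ring

lemma chi_sq_s4 {p : ℕ} [Fact p.Prime] (x : ZMod p) :
    quadraticChar (ZMod p) x ^ 2 = if x = 0 then 0 else 1 := by
  split_ifs with h
  · simp [h]
  · exact quadraticChar_sq_one h

lemma cubic_even (p : ℕ) [Fact p.Prime] (hp2 : p ≠ 2) (r₁ r₂ r₃ : ZMod p)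
    (h12 : r₁ ≠ r₂) (h13 : r₁ ≠ r₃) (h23 : r₂ ≠ r₃) :
    ∃ j : ℤ, (∑ y : ZMod p, quadraticChar (ZMod p) ((y + r₁) * (y + r₂) * (y + r₃))) = 2 * j := by
  have hp : p.Prime := Fact.out
  have hodd : p % 2 = 1 := hp.eq_two_or_odd.resolve_left hp2
  have h1 : (2 : ℤ) ∣ (∑ y : ZMod p, quadraticChar (ZMod p) ((y + r₁) * (y + r₂) * (y + r₃)) ^ 2) -
      (∑ y : ZMod p, quadraticChar (ZMod p) ((y + r₁) * (y + r₂) * (y + r₃))) := by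
    rw [← Finset.sum_sub_distrib]
    refine Finset.dvd_sum fun y _ => ?_
    rcases chi_val ((y + r₁) * (y + r₂) * (y + r₃)) with h | h | h <;> rw [h] <;> norm_num
  have h2 : (∑ y : ZMod p, quadraticChar (ZMod p) ((y + r₁) * (y + r₂) * (y + r₃)) ^ 2) = p - 3 := by
    have : ∀ y : ZMod p, quadraticChar (ZMod p) ((y + r₁) * (y + r₂) * (y + r₃)) ^ 2 =
        1 - (if y ∈ ({-r₁, -r₂, -r₃} : Finset (ZMod p)) then 1 else 0) := by
      intro y
      rw [chi_sq_s4]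
      simp only [mul_eq_zero, add_eq_zero_iff_eq_neg, Finset.mem_insert, Finset.mem_singleton, or_assoc]
      split_ifs <;> simp
    rw [Finset.sum_congr rfl (fun y _ => this y), Finset.sum_sub_distrib, Finset.sum_ite_mem,
      Finset.univ_inter, Finset.sum_const, Finset.sum_const, Finset.card_univ, ZMod.card,
      Finset.card_eq_three.mpr ⟨-r₁, -r₂, -r₃, by simpa, by simpa, by simpa, rfl⟩]
    simp
  rw [h2] at h1
  generalize (∑ y : ZMod p, quadraticChar (ZMod p) ((y + r₁) * (y + r₂) * (y + r₃))) = T at *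
  exact ⟨T / 2, by omega⟩

lemma W3_bound (p : ℕ) [Fact p.Prime] (hp2 : p ≠ 2) (hp3 : p ≠ 3) (k : ℕ) (hk : p ≤ (k + 1) ^ 2)
    (r₁ r₂ r₃ : ZMod p) (h12 : r₁ ≠ r₂) (h13 : r₁ ≠ r₃) (h23 : r₂ ≠ r₃) :
    |∑ y : ZMod p, quadraticChar (ZMod p) ((y + r₁) * (y + r₂) * (y + r₃))| ≤ 2 * k := by
  obtain ⟨j, hj⟩ := cubic_even p hp2 r₁ r₂ r₃ h12 h13 h23
  have h := cubic_bound p hp2 hp3 r₁ r₂ r₃ h12 h13 h23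
  rw [hj] at h ⊢
  zify at hk
  have : j ^ 2 < (k + 1 : ℤ) ^ 2 := by nlinarith
  have := abs_lt_of_sq_lt_sq this (by positivity)
  rw [abs_mul]
  have : |j| ≤ k := by linarith
  simp only [Nat.abs_ofNat]
  linarith

lemma W4_bound (p : ℕ) [Fact p.Prime] (hp2 : p ≠ 2) (hp3 : p ≠ 3) (k : ℕ) (hk : p ≤ (k + 1) ^ 2)
    (r₁ r₂ r₃ r₄ : ZMod p) (h12 : r₁ ≠ r₂) (h13 : r₁ ≠ r₃) (h23 : r₂ ≠ r₃)
    (h14 : r₁ ≠ r₄) (h24 : r₂ ≠ r₄) (h34 : r₃ ≠ r₄) :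
    ∑ y : ZMod p, quadraticChar (ZMod p) ((y + r₁) * (y + r₂) * (y + r₃) * (y + r₄)) ≤ 2 * k - 1 := by
  obtain ⟨s₁, h₁⟩ : ∃ s, r₁ = s⁻¹ + r₄ := ⟨(r₁ - r₄)⁻¹, by simp⟩
  obtain ⟨s₂, h₂⟩ : ∃ s, r₂ = s⁻¹ + r₄ := ⟨(r₂ - r₄)⁻¹, by simp⟩
  obtain ⟨s₃, h₃⟩ : ∃ s, r₃ = s⁻¹ + r₄ := ⟨(r₃ - r₄)⁻¹, by simp⟩
  subst h₁ h₂ h₃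
  have n1 : s₁ ≠ 0 := by rintro rfl; simp at h14
  have n2 : s₂ ≠ 0 := by rintro rfl; simp at h24
  have n3 : s₃ ≠ 0 := by rintro rfl; simp at h34
  have hb := W3_bound p hp2 hp3 k hk s₁ s₂ s₃ (by rintro rfl; exact h12 rfl)
    (by rintro rfl; exact h13 rfl) (by rintro rfl; exact h23 rfl)
  have e : ∑ y : ZMod p, quadraticChar (ZMod p) ((y + (s₁⁻¹ + r₄)) * (y + (s₂⁻¹ + r₄)) * (y + (s₃⁻¹ + r₄)) * (y + r₄))
      = quadraticChar (ZMod p) (s₁ * s₂ * s₃)⁻¹ *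
        (∑ y : ZMod p, quadraticChar (ZMod p) ((y + s₁) * (y + s₂) * (y + s₃))) - 1 := by
    have e1 := Equiv.sum_comp (Equiv.addRight r₄) (fun y => quadraticChar (ZMod p) ((y + s₁⁻¹) * (y + s₂⁻¹) * (y + s₃⁻¹) * y))
    have e2 := Equiv.sum_comp (Equiv.inv (ZMod p)) (fun y => quadraticChar (ZMod p) ((y + s₁⁻¹) * (y + s₂⁻¹) * (y + s₃⁻¹) * y))
    have e3 : ∀ y : ZMod p, quadraticChar (ZMod p) ((y⁻¹ + s₁⁻¹) * (y⁻¹ + s₂⁻¹) * (y⁻¹ + s₃⁻¹) * y⁻¹) =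
        quadraticChar (ZMod p) (s₁ * s₂ * s₃)⁻¹ * quadraticChar (ZMod p) ((y + s₁) * (y + s₂) * (y + s₃))
        - (if y = 0 then 1 else 0) := by
      intro y
      rw [← map_mul]
      split_ifs with hy
      · subst hy
        have : (s₁ * s₂ * s₃)⁻¹ * ((0 + s₁) * (0 + s₂) * (0 + s₃)) = 1 := by
          simp only [zero_add]
          exact inv_mul_cancel₀ (mul_ne_zero (mul_ne_zero n1 n2) n3)
        rw [this]
        simp
      · have : (s₁ * s₂ * s₃)⁻¹ * ((y + s₁) * (y + s₂) * (y + s₃)) =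
          ((y⁻¹ + s₁⁻¹) * (y⁻¹ + s₂⁻¹) * (y⁻¹ + s₃⁻¹) * y⁻¹) * (y ^ 2) ^ 2 := by
          field_simp
          ring
        rw [this, map_mul _ _ ((y ^ 2) ^ 2), map_pow _ (y ^ 2), quadraticChar_sq_one (pow_ne_zero _ hy)]
        simp
    simp only [Equiv.coe_addRight, Equiv.inv_apply] at e1 e2
    rw [Finset.sum_congr rfl (fun y _ => e3 y)] at e2
    rw [Finset.sum_sub_distrib, ← Finset.mul_sum] at e2
    simp only [Finset.sum_ite_eq', Finset.mem_univ, if_true] at e2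
    rw [e2, ← e1]
    refine Finset.sum_congr rfl fun y _ => ?_
    congr 1
    ring
  rw [e]
  have := abs_le.mp hb
  rcases chi_val (s₁ * s₂ * s₃)⁻¹ with h | h | h <;> rw [h] <;> linarith
lemma W1_sum (p : ℕ) [Fact p.Prime] (hp2 : p ≠ 2) (r : ZMod p) :
    ∑ y : ZMod p, quadraticChar (ZMod p) (y + r) = 0 := by
  have e1 := Equiv.sum_comp (Equiv.addRight r) (fun y => quadraticChar (ZMod p) y)
  simp only [Equiv.coe_addRight] at e1
  rw [e1]
  exact quadraticChar_sum_zero (by rwa [ZMod.ringChar_zmod_n])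

lemma W2_sum (p : ℕ) [Fact p.Prime] (hp2 : p ≠ 2) (r s : ZMod p) (h : r ≠ s) :
    ∑ y : ZMod p, quadraticChar (ZMod p) (y + r) * quadraticChar (ZMod p) (y + s) = -1 := by
  have ht : r - s ≠ 0 := sub_ne_zero.mpr h
  have e1 := Equiv.sum_comp (Equiv.addRight s) (fun y => quadraticChar (ZMod p) ((y + (r - s)) * y))
  have e2 := Equiv.sum_comp (Equiv.inv (ZMod p)) (fun y => quadraticChar (ZMod p) ((y + (r - s)) * y))
  have e3 : ∀ y : ZMod p, quadraticChar (ZMod p) ((y⁻¹ + (r - s)) * y⁻¹) =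
      quadraticChar (ZMod p) (r - s) * quadraticChar (ZMod p) (y + (r - s)⁻¹)
        - (if y = 0 then 1 else 0) := by
    intro y
    rw [← map_mul]
    split_ifs with hy
    · subst hy
      rw [zero_add, mul_inv_cancel₀ ht]
      simp
    · have : (r - s) * (y + (r - s)⁻¹) = ((y⁻¹ + (r - s)) * y⁻¹) * y ^ 2 := by
        field_simp
        ring
      rw [this, map_mul _ _ (y ^ 2), map_pow _ y, quadraticChar_sq_one hy]
      simp
  simp only [Equiv.coe_addRight, Equiv.inv_apply] at e1 e2
  rw [Finset.sum_congr rfl (fun y _ => e3 y)] at e2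
  rw [Finset.sum_sub_distrib, ← Finset.mul_sum, W1_sum p hp2] at e2
  simp only [Finset.sum_ite_eq', Finset.mem_univ, if_true, mul_zero, zero_sub] at e2
  rw [e2, ← e1]
  refine Finset.sum_congr rfl fun y _ => ?_
  rw [← map_mul]
  congr 1
  ring

lemma mem_Rp (p : ℕ) [Fact p.Prime] (x : ZMod p) :
    x ∈ Rp p ↔ quadraticChar (ZMod p) x = 1 := by
  rw [Rp, Finset.mem_filter]
  constructor
  · rintro ⟨_, h0, hs⟩
    exact (quadraticChar_one_iff_isSquare h0).mpr hs
  · intro h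
    have h0 : x ≠ 0 := by rintro rfl; simp at h
    exact ⟨Finset.mem_univ _, h0, (quadraticChar_one_iff_isSquare h0).mp h⟩

lemma card_Rp (p : ℕ) [Fact p.Prime] (hp2 : p ≠ 2) : 2 * ((Rp p).card : ℤ) = p - 1 := by
  have h1 : ∀ x : ZMod p, 1 + quadraticChar (ZMod p) x - (if x = 0 then 1 else 0) =
      (if x ∈ Rp p then 2 else 0) := by
    intro x
    simp only [mem_Rp]
    by_cases hx : x = 0
    · simp [hx]
    · rcases quadraticChar_dichotomy hx with h | h <;> simp [h, hx]
  have h2 := Finset.sum_congr (rfl : (Finset.univ : Finset (ZMod p)) = Finset.univ) (fun x _ => h1 x)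
  rw [Finset.sum_sub_distrib, Finset.sum_add_distrib,
    quadraticChar_sum_zero (by rwa [ZMod.ringChar_zmod_n]), Finset.sum_ite_mem,
      Finset.univ_inter] at h2
  simp [ZMod.card] at h2
  linarith

/-- sum over ordered triples of distinct elements -/
lemma triple_sum {ι : Type*} [DecidableEq ι] (B : Finset ι) (f : ι → ℤ) :
    ∑ a ∈ B, ∑ b ∈ B.erase a, ∑ c ∈ (B.erase a).erase b, f a * f b * f c =
      (∑ a ∈ B, f a) ^ 3 - 3 * (∑ a ∈ B, f a) * (∑ a ∈ B, f a ^ 2) + 2 * ∑ a ∈ B, f a ^ 3 := by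
  set s := ∑ a ∈ B, f a with hs
  have h1 : ∀ a ∈ B, ∑ b ∈ B.erase a, ∑ c ∈ (B.erase a).erase b, f a * f b * f c =
      f a * s ^ 2 - 2 * s * f a ^ 2 + 2 * f a ^ 3 - f a * (∑ a ∈ B, f a ^ 2) := by
    intro a ha
    have h2 : ∀ b ∈ B.erase a, ∑ c ∈ (B.erase a).erase b, f a * f b * f c =
        (f a * (s - f a)) * f b - f a * f b ^ 2 := by
      intro b hb
      rw [← Finset.mul_sum, Finset.sum_erase_eq_sub hb, Finset.sum_erase_eq_sub ha, ← hs]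
      ring
    rw [Finset.sum_congr rfl h2, Finset.sum_sub_distrib, ← Finset.mul_sum, ← Finset.mul_sum,
      Finset.sum_erase_eq_sub ha, Finset.sum_erase_eq_sub ha, ← hs]
    ring
  rw [Finset.sum_congr rfl h1]
  simp only [Finset.sum_sub_distrib, Finset.sum_add_distrib, ← Finset.mul_sum, ← Finset.sum_mul, ← hs]
  ring

/-- sum over ordered quadruples of distinct elements -/
lemma quad_sum {ι : Type*} [DecidableEq ι] (B : Finset ι) (f : ι → ℤ) :
    ∑ a ∈ B, ∑ b ∈ B.erase a, ∑ c ∈ (B.erase a).erase b, ∑ d ∈ ((B.erase a).erase b).erase c,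
      f a * f b * f c * f d =
      (∑ a ∈ B, f a) ^ 4 - 6 * (∑ a ∈ B, f a) ^ 2 * (∑ a ∈ B, f a ^ 2)
        + 3 * (∑ a ∈ B, f a ^ 2) ^ 2 + 8 * (∑ a ∈ B, f a) * (∑ a ∈ B, f a ^ 3)
        - 6 * ∑ a ∈ B, f a ^ 4 := by
  have h1 : ∀ a ∈ B, ∑ b ∈ B.erase a, ∑ c ∈ (B.erase a).erase b, ∑ d ∈ ((B.erase a).erase b).erase c,
      f a * f b * f c * f d = f a * (((∑ a ∈ B, f a) - f a) ^ 3
        - 3 * ((∑ a ∈ B, f a) - f a) * ((∑ a ∈ B, f a ^ 2) - f a ^ 2)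
        + 2 * ((∑ a ∈ B, f a ^ 3) - f a ^ 3)) := by
    intro a ha
    rw [← Finset.sum_erase_eq_sub ha, ← Finset.sum_erase_eq_sub ha, ← Finset.sum_erase_eq_sub ha,
      ← triple_sum]
    simp only [Finset.mul_sum, mul_assoc]
  rw [Finset.sum_congr rfl h1]
  generalize hs : ∑ a ∈ B, f a = s
  generalize hs2 : ∑ a ∈ B, f a ^ 2 = s2
  generalize hs3 : ∑ a ∈ B, f a ^ 3 = s3
  have h3 : ∀ a ∈ B, f a * ((s - f a) ^ 3 - 3 * (s - f a) * (s2 - f a ^ 2) + 2 * (s3 - f a ^ 3)) =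
      (s ^ 3 - 3 * s * s2 + 2 * s3) * f a + (3 * s2 - 3 * s ^ 2) * f a ^ 2 + (6 * s) * f a ^ 3
        - 6 * f a ^ 4 := by
    intro a _; ring
  rw [Finset.sum_congr rfl h3]
  simp only [Finset.sum_sub_distrib, Finset.sum_add_distrib, ← Finset.mul_sum, hs, hs2, hs3]
  ring
lemma triple_bound (p : ℕ) [Fact p.Prime] (hp2 : p ≠ 2) (hp3 : p ≠ 3) (k : ℕ)
    (hk : p ≤ (k + 1) ^ 2) (B : Finset (ZMod p)) :
    ∑ y : ZMod p, ∑ a ∈ B, ∑ b ∈ B.erase a, ∑ c ∈ (B.erase a).erase b,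
      quadraticChar (ZMod p) (y + a) * quadraticChar (ZMod p) (y + b) * quadraticChar (ZMod p) (y + c)
      ≤ (2 * k) * ((B.card : ℤ) ^ 3 - 3 * B.card ^ 2 + 2 * B.card) := by
  have h1 := triple_sum B (fun _ => (1 : ℤ))
  have h2 : ((B.card : ℤ) ^ 3 - 3 * B.card ^ 2 + 2 * B.card) =
      ∑ a ∈ B, ∑ b ∈ B.erase a, ∑ c ∈ (B.erase a).erase b, 1 := by
    simp only [mul_one, one_pow] at h1
    rw [h1]; simp; ring
  rw [h2]
  simp only [Finset.mul_sum, mul_one]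
  rw [Finset.sum_comm]
  refine Finset.sum_le_sum fun a ha => ?_
  rw [Finset.sum_comm]
  refine Finset.sum_le_sum fun b hb => ?_
  rw [Finset.sum_comm]
  refine Finset.sum_le_sum fun c hc => ?_
  simp only [← map_mul]
  simp only [Finset.mem_erase] at hb hc
  exact (le_abs_self _).trans (W3_bound p hp2 hp3 k hk a b c (Ne.symm hb.1) (Ne.symm hc.2.1) (Ne.symm hc.1))

lemma quad_bound (p : ℕ) [Fact p.Prime] (hp2 : p ≠ 2) (hp3 : p ≠ 3) (k : ℕ)
    (hk : p ≤ (k + 1) ^ 2) (B : Finset (ZMod p)) :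
    ∑ y : ZMod p, ∑ a ∈ B, ∑ b ∈ B.erase a, ∑ c ∈ (B.erase a).erase b,
      ∑ d ∈ ((B.erase a).erase b).erase c,
      quadraticChar (ZMod p) (y + a) * quadraticChar (ZMod p) (y + b) * quadraticChar (ZMod p) (y + c)
        * quadraticChar (ZMod p) (y + d)
      ≤ (2 * k - 1) * ((B.card : ℤ) ^ 4 - 6 * B.card ^ 3 + 11 * B.card ^ 2 - 6 * B.card) := by
  have h1 := quad_sum B (fun _ => (1 : ℤ))
  have h2 : ((B.card : ℤ) ^ 4 - 6 * B.card ^ 3 + 11 * B.card ^ 2 - 6 * B.card) =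
      ∑ a ∈ B, ∑ b ∈ B.erase a, ∑ c ∈ (B.erase a).erase b,
        ∑ d ∈ ((B.erase a).erase b).erase c, 1 := by
    simp only [mul_one, one_pow] at h1
    rw [h1]; simp; ring
  rw [h2]
  simp only [Finset.mul_sum, mul_one]
  rw [Finset.sum_comm]
  refine Finset.sum_le_sum fun a ha => ?_
  rw [Finset.sum_comm]
  refine Finset.sum_le_sum fun b hb => ?_
  rw [Finset.sum_comm]
  refine Finset.sum_le_sum fun c hc => ?_
  rw [Finset.sum_comm]
  refine Finset.sum_le_sum fun d hd => ?_
  simp only [← map_mul]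
  simp only [Finset.mem_erase] at hb hc hd
  exact W4_bound p hp2 hp3 k hk a b c d (Ne.symm hb.1) (Ne.symm hc.2.1) (Ne.symm hc.1)
    (Ne.symm hd.2.2.1) (Ne.symm hd.2.1) (Ne.symm hd.1)

lemma S1_sum (p : ℕ) [Fact p.Prime] (hp2 : p ≠ 2) (B : Finset (ZMod p)) :
    ∑ y : ZMod p, ∑ b ∈ B, quadraticChar (ZMod p) (y + b) = 0 := by
  rw [Finset.sum_comm]
  exact Finset.sum_eq_zero fun b _ => W1_sum p hp2 b

lemma sq_sum (p : ℕ) [Fact p.Prime] (r : ZMod p) :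
    ∑ y : ZMod p, quadraticChar (ZMod p) (y + r) ^ 2 = p - 1 := by
  have : ∀ y : ZMod p, quadraticChar (ZMod p) (y + r) ^ 2 = 1 - (if y = -r then 1 else 0) := by
    intro y
    rw [chi_sq_s4]
    simp only [add_eq_zero_iff_eq_neg]
    split_ifs <;> simp
  rw [Finset.sum_congr rfl (fun y _ => this y), Finset.sum_sub_distrib]
  simp [ZMod.card]

lemma S2_sum (p : ℕ) [Fact p.Prime] (hp2 : p ≠ 2) (B : Finset (ZMod p)) :
    ∑ y : ZMod p, (∑ b ∈ B, quadraticChar (ZMod p) (y + b)) ^ 2 = B.card * p - B.card ^ 2 := by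
  simp only [pow_two, Finset.sum_mul_sum]
  rw [Finset.sum_comm]
  have : ∀ a ∈ B, ∑ y : ZMod p, ∑ b ∈ B, quadraticChar (ZMod p) (y + a) * quadraticChar (ZMod p) (y + b)
      = p - B.card := by
    intro a ha
    rw [Finset.sum_comm, ← Finset.add_sum_erase _ _ ha]
    have h1 := sq_sum p a
    simp only [pow_two] at h1
    rw [h1, Finset.sum_congr rfl (g := fun _ => (-1 : ℤ)) (fun b hb =>
      W2_sum p hp2 a b (Ne.symm (Finset.ne_of_mem_erase hb)))]
    rw [Finset.sum_const, Finset.card_erase_of_mem ha]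
    have : 1 ≤ B.card := Finset.card_pos.mpr ⟨a, ha⟩
    simp; push_cast [this]; ring
  rw [Finset.sum_congr rfl this, Finset.sum_const, nsmul_eq_mul]
  ring

/-- pointwise data -/
lemma pt_sums (p : ℕ) [Fact p.Prime] (B : Finset (ZMod p)) (y : ZMod p) :
    (∑ b ∈ B, quadraticChar (ZMod p) (y + b) ^ 2 = B.card - (if -y ∈ B then 1 else 0)) ∧
    (∑ b ∈ B, quadraticChar (ZMod p) (y + b) ^ 3 = ∑ b ∈ B, quadraticChar (ZMod p) (y + b)) ∧
    (∑ b ∈ B, quadraticChar (ZMod p) (y + b) ^ 4 = B.card - (if -y ∈ B then 1 else 0)) := by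
  have h1 : ∑ b ∈ B, quadraticChar (ZMod p) (y + b) ^ 2 = B.card - (if -y ∈ B then 1 else 0) := by
    have : ∀ b ∈ B, quadraticChar (ZMod p) (y + b) ^ 2 = 1 - (if -y = b then 1 else 0) := by
      intro b _
      rw [chi_sq_s4]
      simp only [neg_eq_iff_add_eq_zero]
      split_ifs <;> simp
    rw [Finset.sum_congr rfl this, Finset.sum_sub_distrib, Finset.sum_ite_eq]
    simp
  refine ⟨h1, Finset.sum_congr rfl fun b _ => ?_, ?_⟩
  · rcases chi_val (y + b) with h | h | h <;> rw [h] <;> norm_num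
  · rw [← h1]
    refine Finset.sum_congr rfl fun b _ => ?_
    rcases chi_val (y + b) with h | h | h <;> rw [h] <;> norm_num

lemma main_ge3 (p : ℕ) [Fact p.Prime] (hp2 : p ≠ 2) (hp3 : p ≠ 3) (k : ℕ)
    (hk : p ≤ (k + 1) ^ 2) (A B : Finset (ZMod p)) (hB : 3 ≤ B.card)
    (h : A + B = Rp p) (hmn : (p : ℤ) - 1 ≤ 2 * (A.card * B.card)) :
    (A.card : ℤ) + 1 ≤ 2 * k := by
  set χ := quadraticChar (ZMod p) with hχ
  set n : ℤ := (B.card : ℤ) with hn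
  set m : ℤ := (A.card : ℤ) with hm
  have hn3 : 3 ≤ n := by rw [hn]; exact_mod_cast hB
  have hm0 : 0 ≤ m := by rw [hm]; positivity
  set S : ZMod p → ℤ := fun y => ∑ b ∈ B, χ (y + b) with hS
  set z : ZMod p → ℤ := fun y => if -y ∈ B then 1 else 0 with hz
  have hD : ∑ y : ZMod p, ((S y ^ 4 - 6 * S y ^ 2 * (n - z y) + 3 * (n - z y) ^ 2 + 8 * S y * S y
      - 6 * (n - z y)) + 4 * (S y ^ 3 - 3 * S y * (n - z y) + 2 * S y)) ≤
      (2 * k - 1) * (n ^ 4 - 6 * n ^ 3 + 11 * n ^ 2 - 6 * n) + 4 * ((2 * k) * (n ^ 3 - 3 * n ^ 2 + 2 * n)) := by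
    have h3 := triple_bound p hp2 hp3 k hk B
    have h4 := quad_bound p hp2 hp3 k hk B
    rw [Finset.sum_add_distrib, ← Finset.mul_sum]
    refine add_le_add (le_trans (le_of_eq ?_) h4) (mul_le_mul_of_nonneg_left (le_trans (le_of_eq ?_) h3) (by norm_num))
    · refine Finset.sum_congr rfl fun y _ => ?_
      obtain ⟨e2, e3, e4⟩ := pt_sums p B y
      rw [quad_sum B (fun b => quadraticChar (ZMod p) (y + b)), e2, e3, e4]
    · refine Finset.sum_congr rfl fun y _ => ?_
      obtain ⟨e2, e3, e4⟩ := pt_sums p B y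
      rw [triple_sum B (fun b => quadraticChar (ZMod p) (y + b)), e2, e3]
  have hχA : ∀ y ∈ A, ∀ b ∈ B, χ (y + b) = 1 := by
    intro y hy b hb
    exact (mem_Rp p _).mp (h ▸ Finset.add_mem_add hy hb)
  have hSA : ∀ y ∈ A, S y = n := by
    intro y hy
    simp only [hS]
    rw [Finset.sum_congr rfl (hχA y hy)]; simp [hn]
  have hzA : ∀ y ∈ A, z y = 0 := by
    intro y hy
    simp only [hz]
    rw [if_neg]
    intro hb
    have := hχA y hy _ hb
    rw [add_neg_cancel, hχ, quadraticChar_zero] at this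
    exact zero_ne_one this
  have hz01 : ∀ y, z y = 0 ∨ z y = 1 := by
    intro y; simp only [hz]; split_ifs <;> simp
  have hzs : ∑ y, z y = n := by
    simp only [hz]
    have := Equiv.sum_comp (Equiv.neg (ZMod p)) (fun y => if y ∈ B then (1 : ℤ) else 0)
    simp only [Equiv.neg_apply] at this
    rw [this, Finset.sum_ite_mem, Finset.univ_inter]
    simp [hn]
  have hS1 : ∑ y, S y = 0 := S1_sum p hp2 B
  have hS2 : ∑ y, S y ^ 2 = n * p - n ^ 2 := S2_sum p hp2 B
  -- lower bound function
  have hL : ∀ y, (-4 * (5 * n - 2) * S y ^ 2 - 4 * (10 * n - 4) * S y + (11 * n ^ 2 - 20 * n - 4)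
      - (24 * n - 12) * z y) + (if y ∈ A then (4 * (n ^ 4 - 6 * n ^ 3 + 11 * n ^ 2 - 6 * n + 4 * (n ^ 3 - 3 * n ^ 2 + 2 * n))
        - (-4 * (5 * n - 2) * n ^ 2 - 4 * (10 * n - 4) * n + (11 * n ^ 2 - 20 * n - 4))) else 0) ≤
      4 * ((S y ^ 4 - 6 * S y ^ 2 * (n - z y) + 3 * (n - z y) ^ 2 + 8 * S y * S y
      - 6 * (n - z y)) + 4 * (S y ^ 3 - 3 * S y * (n - z y) + 2 * S y)) := by
    intro y
    split_ifs with hy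
    · rw [hSA y hy, hzA y hy]
      apply le_of_eq; ring
    · rcases hz01 y with h0 | h0 <;> rw [h0]
      · nlinarith [sq_nonneg (2 * S y ^ 2 + 4 * S y + 2 - n)]
      · nlinarith [sq_nonneg (2 * S y ^ 2 + 4 * S y + 2 - n), sq_nonneg (S y + 1)]
  have hsum := Finset.sum_le_sum (s := Finset.univ) (fun y _ => hL y)
  rw [← Finset.mul_sum, Finset.sum_add_distrib, Finset.sum_ite_mem, Finset.univ_inter,
    Finset.sum_sub_distrib, Finset.sum_add_distrib, Finset.sum_sub_distrib, ← Finset.mul_sum,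
    ← Finset.mul_sum, ← Finset.mul_sum, hS1, hS2, hzs, Finset.sum_const, Finset.sum_const,
    Finset.card_univ, ZMod.card, nsmul_eq_mul, nsmul_eq_mul, ← hm] at hsum
  by_contra hcon
  push Not at hcon
  have hcon' : 2 * (k : ℤ) ≤ m := by linarith
  have hn4 : 0 ≤ n ^ 4 - 6 * n ^ 3 + 11 * n ^ 2 - 6 * n := by
    have : n ^ 4 - 6 * n ^ 3 + 11 * n ^ 2 - 6 * n = n * (n - 1) * (n - 2) * (n - 3) := by ring
    rw [this]
    have : 0 ≤ n - 1 := by linarith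
    have : 0 ≤ n - 2 := by linarith
    have : 0 ≤ n - 3 := by linarith
    positivity
  have hn3' : 0 ≤ n ^ 3 - 3 * n ^ 2 + 2 * n := by
    have : n ^ 3 - 3 * n ^ 2 + 2 * n = n * (n - 1) * (n - 2) := by ring
    rw [this]
    have : 0 ≤ n - 1 := by linarith
    have : 0 ≤ n - 2 := by linarith
    positivity
  have q1 := mul_le_mul_of_nonneg_right hcon' hn4
  have q2 := mul_le_mul_of_nonneg_right hcon' hn3'
  have q3 : (p - 1 : ℤ) * (20 * n ^ 2 + 21 * n + 4) ≤ 2 * (m * n) * (20 * n ^ 2 + 21 * n + 4) :=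
    mul_le_mul_of_nonneg_right hmn (by positivity)
  have q4 : 0 ≤ (p : ℤ) * (2 * n ^ 2 - 3 * n - 4) := mul_nonneg (by positivity) (by nlinarith)
  have q5 : 0 < 40 * n ^ 3 - 84 * n ^ 2 + 3 * n - 4 := by nlinarith [sq_nonneg n, mul_nonneg (sq_nonneg n) (sub_nonneg.mpr hn3)]
  linarith

lemma main_two (p : ℕ) [Fact p.Prime] (hp2 : p ≠ 2) (hp3 : p ≠ 3) (A B : Finset (ZMod p))
    (hB : B.card = 2) (h : A + B = Rp p) : p ≤ 56 ∧ 4 * (A.card : ℤ) = p - 1 := by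
  obtain ⟨b₁, b₂, hb, rfl⟩ := Finset.card_eq_two.mp hB
  have hχA : ∀ y ∈ A, ∀ b ∈ ({b₁, b₂} : Finset (ZMod p)), quadraticChar (ZMod p) (y + b) = 1 := by
    intro y hy b hb
    exact (mem_Rp p _).mp (h ▸ Finset.add_mem_add hy hb)
  have h2 : (2 : ZMod p) ≠ 0 := by
    have hp : p.Prime := Fact.out
    intro h
    have : ((2 : ℕ) : ZMod p) = 0 := by exact_mod_cast h
    rw [ZMod.natCast_eq_zero_iff] at this
    exact hp2 ((Nat.prime_dvd_prime_iff_eq hp Nat.prime_two).mp this)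
  set X : Finset (ZMod p) := Finset.univ.filter (fun y => quadraticChar (ZMod p) (y + b₁) = 1 ∧
    quadraticChar (ZMod p) (y + b₂) = 1) with hX
  have hAX : A ⊆ X := by
    intro y hy
    rw [hX, Finset.mem_filter]
    exact ⟨Finset.mem_univ _, hχA y hy _ (by simp), hχA y hy _ (by simp)⟩
  have hX4 : 4 * (X.card : ℤ) ≤ p - 1 := by
    have e : ∑ y : ZMod p, (1 + quadraticChar (ZMod p) (y + b₁)) * (1 + quadraticChar (ZMod p) (y + b₂)) = p - 1 := by
      have : ∀ y : ZMod p, (1 + quadraticChar (ZMod p) (y + b₁)) * (1 + quadraticChar (ZMod p) (y + b₂)) =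
        1 + quadraticChar (ZMod p) (y + b₁) + quadraticChar (ZMod p) (y + b₂) +
          quadraticChar (ZMod p) (y + b₁) * quadraticChar (ZMod p) (y + b₂) := by intro y; ring
      rw [Finset.sum_congr rfl (fun y _ => this y), Finset.sum_add_distrib, Finset.sum_add_distrib,
        Finset.sum_add_distrib, W1_sum p hp2, W1_sum p hp2, W2_sum p hp2 _ _ hb]
      simp [ZMod.card]; ring
    have e2 : ∑ y : ZMod p, (if y ∈ X then (4 : ℤ) else 0) ≤
        ∑ y : ZMod p, (1 + quadraticChar (ZMod p) (y + b₁)) * (1 + quadraticChar (ZMod p) (y + b₂)) := by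
      refine Finset.sum_le_sum fun y _ => ?_
      split_ifs with hy
      · rw [hX, Finset.mem_filter] at hy
        rw [hy.2.1, hy.2.2]; norm_num
      · rcases chi_val (y + b₁) with h | h | h <;> rcases chi_val (y + b₂) with h' | h' | h' <;>
          rw [h, h'] <;> norm_num
    rw [e, Finset.sum_ite_mem, Finset.univ_inter, Finset.sum_const, nsmul_eq_mul] at e2
    linarith
  have hR := card_Rp p hp2
  have hun : A + {b₁, b₂} = (A.image (· + b₁)) ∪ (A.image (· + b₂)) := by
    ext x
    simp [Finset.mem_add]
    aesop
  have hcard := Finset.card_union_add_card_inter (A.image (· + b₁)) (A.image (· + b₂))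
  rw [← hun, h, Finset.card_image_of_injective _ (add_left_injective b₁),
    Finset.card_image_of_injective _ (add_left_injective b₂)] at hcard
  have hAXc := Finset.card_le_card hAX
  have hi : ((A.image (· + b₁)) ∩ (A.image (· + b₂))).card = 0 := by omega
  have hm : 4 * (A.card : ℤ) = p - 1 := by omega
  have hAeq : A = X := Finset.eq_of_subset_of_card_le hAX (by omega)
  refine ⟨?_, hm⟩
  rw [Finset.card_eq_zero] at hi
  obtain ⟨d, hd⟩ : ∃ d, d = b₂ - b₁ := ⟨_, rfl⟩
  have hd0 : d ≠ 0 := by rw [hd]; exact sub_ne_zero.mpr (Ne.symm hb)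
  have hno : ∀ u, ¬ (quadraticChar (ZMod p) (u + 0) = 1 ∧ quadraticChar (ZMod p) (u + d) = 1 ∧
      quadraticChar (ZMod p) (u + 2 * d) = 1) := by
    rintro u ⟨h0, h1, h2⟩
    have m1 : u - b₁ ∈ A := by
      rw [hAeq, hX, Finset.mem_filter]
      refine ⟨Finset.mem_univ _, ?_, ?_⟩
      · rw [← h0]; congr 1; ring
      · rw [← h1, hd]; congr 1; ring
    have m2 : u - b₁ + d ∈ A := by
      rw [hAeq, hX, Finset.mem_filter]
      refine ⟨Finset.mem_univ _, ?_, ?_⟩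
      · rw [← h1]; congr 1; ring
      · rw [← h2, hd]; congr 1; ring
    have : u + d ∈ (A.image (· + b₁)) ∩ (A.image (· + b₂)) := by
      rw [Finset.mem_inter, Finset.mem_image, Finset.mem_image]
      exact ⟨⟨_, m2, by ring⟩, ⟨_, m1, by rw [hd]; ring⟩⟩
    rw [hi] at this
    simp at this
  have n1 : (0 : ZMod p) ≠ d := Ne.symm hd0
  have n2 : (0 : ZMod p) ≠ 2 * d := Ne.symm (mul_ne_zero h2 hd0)
  have n3 : d ≠ 2 * d := by
    intro h; apply hd0; linear_combination -h
  have hT := cubic_bound p hp2 hp3 0 d (2 * d) n1 n2 n3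
  have e : ∑ y : ZMod p, (1 + quadraticChar (ZMod p) (y + 0)) * (1 + quadraticChar (ZMod p) (y + d)) *
      (1 + quadraticChar (ZMod p) (y + 2 * d)) = p - 3 +
      ∑ y : ZMod p, quadraticChar (ZMod p) ((y + 0) * (y + d) * (y + 2 * d)) := by
    have : ∀ y : ZMod p, (1 + quadraticChar (ZMod p) (y + 0)) * (1 + quadraticChar (ZMod p) (y + d)) *
      (1 + quadraticChar (ZMod p) (y + 2 * d)) =
        1 + quadraticChar (ZMod p) (y + 0) + quadraticChar (ZMod p) (y + d) + quadraticChar (ZMod p) (y + 2 * d) +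
          quadraticChar (ZMod p) (y + 0) * quadraticChar (ZMod p) (y + d) +
          quadraticChar (ZMod p) (y + 0) * quadraticChar (ZMod p) (y + 2 * d) +
          quadraticChar (ZMod p) (y + d) * quadraticChar (ZMod p) (y + 2 * d) +
          quadraticChar (ZMod p) ((y + 0) * (y + d) * (y + 2 * d)) := by
      intro y; rw [map_mul, map_mul]; ring
    rw [Finset.sum_congr rfl (fun y _ => this y)]
    simp only [Finset.sum_add_distrib]
    rw [W1_sum p hp2, W1_sum p hp2, W1_sum p hp2, W2_sum p hp2 _ _ n1, W2_sum p hp2 _ _ n2, W2_sum p hp2 _ _ n3]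
    simp [ZMod.card]; ring
  have e2 : ∑ y : ZMod p, (1 + quadraticChar (ZMod p) (y + 0)) * (1 + quadraticChar (ZMod p) (y + d)) *
      (1 + quadraticChar (ZMod p) (y + 2 * d)) ≤
      ∑ y : ZMod p, (4 * (if y = -0 then (1 : ℤ) else 0) + 4 * (if y = -d then (1 : ℤ) else 0) +
        4 * (if y = -(2 * d) then (1 : ℤ) else 0)) := by
    refine Finset.sum_le_sum fun y _ => ?_
    have hno' := hno y
    simp only [← add_eq_zero_iff_eq_neg, ← quadraticChar_eq_zero_iff]
    rcases chi_val (y + 0) with h | h | h <;> rcases chi_val (y + d) with h' | h' | h' <;>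
      rcases chi_val (y + 2 * d) with h'' | h'' | h'' <;> rw [h, h', h''] at hno' ⊢ <;> revert hno' <;> norm_num
  rw [e] at e2
  simp only [Finset.sum_add_distrib, ← Finset.mul_sum, Finset.sum_ite_eq', Finset.mem_univ, if_true] at e2
  generalize ∑ y : ZMod p, quadraticChar (ZMod p) ((y + 0) * (y + d) * (y + 2 * d)) = T at *
  by_contra hcon
  have : (57 : ℤ) ≤ p := by exact_mod_cast (by omega : 57 ≤ p)
  nlinarith

lemma main_int (p : ℕ) [Fact p.Prime] (hp2 : p ≠ 2) (A B : Finset (ZMod p))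
    (hA : 2 ≤ A.card) (hB : 2 ≤ B.card) (h : A + B = Rp p) :
    ((A.card : ℤ) + 1) ^ 2 < 4 * p ∧ 4 * (p : ℤ) ≤ (8 * B.card - 1) ^ 2 := by
  have hR := card_Rp p hp2
  have hle := Finset.card_add_le (s := A) (t := B)
  rw [h] at hle
  have hmn : (p : ℤ) - 1 ≤ 2 * (A.card * B.card) := by rw [← hR]; exact_mod_cast Nat.mul_le_mul_left 2 hle
  have hAR : A.card ≤ (Rp p).card := by
    rw [← h]; exact Finset.card_le_card_add_right (Finset.card_pos.mp (by omega))
  have hp5 : 5 ≤ p := by omega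
  have hp3 : p ≠ 3 := by omega
  rcases hB.eq_or_lt with hB2 | hB3
  · obtain ⟨h1, h2⟩ := main_two p hp2 hp3 A B hB2.symm h
    have h1' : (p : ℤ) ≤ 56 := by exact_mod_cast h1
    have h5' : (5 : ℤ) ≤ p := by exact_mod_cast hp5
    rw [← hB2]
    constructor
    · have : (p : ℤ) = 4 * A.card + 1 := by linarith
      rw [this] at h1' ⊢
      have : (A.card : ℤ) ≤ 13 := by omega
      nlinarith
    · push_cast; linarith
  · set k := Nat.sqrt (p - 1) with hk
    have hk1 : p ≤ (k + 1) ^ 2 := by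
      have := Nat.lt_succ_sqrt (p - 1)
      rw [← hk] at this
      rw [pow_two]
      have : p - 1 < (k + 1) * (k + 1) := this
      omega
    have hk2 : (k : ℤ) ^ 2 ≤ p - 1 := by
      have := Nat.sqrt_le (p - 1)
      rw [← hk] at this
      have : k * k + 1 ≤ p := by omega
      zify at this
      nlinarith
    have hm := main_ge3 p hp2 hp3 k hk1 A B hB3 h hmn
    have hm2 : (2 : ℤ) ≤ A.card := by exact_mod_cast hA
    generalize (A.card : ℤ) = m at *
    have hn : (3 : ℤ) ≤ B.card := by exact_mod_cast hB3
    generalize (B.card : ℤ) = n at *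
    generalize (p : ℤ) = P at *
    constructor
    · nlinarith
    · have h1 : m * n ≤ (2 * k - 1) * n := mul_le_mul_of_nonneg_right (by linarith) (by linarith)
      have hkn : (k : ℤ) < 4 * n := by
        by_contra hc
        push Not at hc
        nlinarith
      have : (2 * (k : ℤ) - 1) * n ≤ (8 * n - 3) * n := mul_le_mul_of_nonneg_right (by linarith) (by linarith)
      nlinarith

theorem stmt_4 (p : ℕ) [Fact p.Prime] (hp : p ≠ 2) (A B : Finset (ZMod p))
    (hA : 2 ≤ A.card) (hB : 2 ≤ B.card) (h : A + B = Rp p) :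
    ((1 / 4) * Real.sqrt p + 1 / 8 ≤ A.card ∧ (A.card : ℝ) < 2 * Real.sqrt p - 1) ∧
    ((1 / 4) * Real.sqrt p + 1 / 8 ≤ B.card ∧ (B.card : ℝ) < 2 * Real.sqrt p - 1) := by
  obtain ⟨h1, h2⟩ := main_int p hp A B hA hB h
  obtain ⟨h3, h4⟩ := main_int p hp B A hB hA (by rw [add_comm]; exact h)
  have up : ∀ m : ℕ, ((m : ℤ) + 1) ^ 2 < 4 * p → (m : ℝ) < 2 * Real.sqrt p - 1 := by
    intro m hm
    have hm' : ((m : ℝ) + 1) ^ 2 < 4 * p := by exact_mod_cast hm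
    have : ((m : ℝ) + 1) / 2 < Real.sqrt p := Real.lt_sqrt_of_sq_lt (by linarith)
    linarith
  have lo : ∀ m : ℕ, 2 ≤ m → 4 * (p : ℤ) ≤ (8 * m - 1) ^ 2 → (1 / 4) * Real.sqrt p + 1 / 8 ≤ (m : ℝ) := by
    intro m hm2 hm
    have hm' : 4 * (p : ℝ) ≤ (8 * m - 1) ^ 2 := by exact_mod_cast hm
    have h2 : (2 : ℝ) ≤ m := by exact_mod_cast hm2
    have : Real.sqrt p ≤ (8 * m - 1) / 2 := Real.sqrt_le_iff.mpr ⟨by linarith, by linarith⟩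
    linarith
  exact ⟨⟨lo _ hA h4, up _ h1⟩, ⟨lo _ hB h2, up _ h3⟩⟩
end

section
/- Let p be a prime and suppose A, B ⊆ 𝔽_p satisfy A + B = R_p with |A|, |B| ≥ 2. If there exists η ∈ [0, 1/2) with 𝔄(A,B) ≤ η(p−1), then the additive energy satisfies E(A,B) ≥ (1/2 + (2^{2−4η} − 2^{3−2η}η + 4η − 1)/(2 − 4η))·(p−1). -/
open scoped Pointwise

def repCount {p : ℕ} (A B : Finset (ZMod p)) (x : ZMod p) : ℕ :=
  ((A ×ˢ B).filter fun ab => ab.1 + ab.2 = x).card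

def uniqueRep {p : ℕ} (A B : Finset (ZMod p)) : ℕ :=
  ((A + B).filter fun x => repCount A B x = 1).card

def addEnergy' {p : ℕ} (A B : Finset (ZMod p)) : ℕ :=
  (((A ×ˢ A) ×ˢ B ×ˢ B).filter fun t => t.1.1 + t.2.1 = t.1.2 + t.2.2).card

theorem aux_Rp_card (p : ℕ) [Fact p.Prime] : p - 1 ≤ 2 * (Rp p).card := by
  classical
  have himg : ((Finset.univ : Finset (ZMod p)).erase 0).image (fun x => x ^ 2) ⊆ Rp p := by
    intro y hy
    simp only [Finset.mem_image, Finset.mem_erase] at hy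
    obtain ⟨x, ⟨hx, -⟩, rfl⟩ := hy
    simp only [Rp, Finset.mem_filter, Finset.mem_univ, true_and]
    exact ⟨pow_ne_zero 2 hx, ⟨x, by ring⟩⟩
  have h1 : ((Finset.univ : Finset (ZMod p)).erase 0).card = p - 1 := by
    rw [Finset.card_erase_of_mem (Finset.mem_univ _), Finset.card_univ, ZMod.card]
  rw [← h1]
  refine (Finset.card_le_mul_card_image (f := fun x : ZMod p => x ^ 2) _ 2 ?_).trans
    (Nat.mul_le_mul_left 2 (Finset.card_le_card himg))
  intro y hy
  simp only [Finset.mem_image, Finset.mem_erase] at hy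
  obtain ⟨x, -, rfl⟩ := hy
  refine (Finset.card_le_card (t := {x, -x}) ?_).trans Finset.card_le_two
  intro z hz
  simp only [Finset.mem_filter] at hz
  simpa using sq_eq_sq_iff_eq_or_eq_neg.mp hz.2

theorem aux_energy {p : ℕ} (A B : Finset (ZMod p)) :
    ∑ x ∈ A + B, (repCount A B x) ^ 2 ≤ addEnergy' A B := by
  classical
  unfold addEnergy'
  rw [Finset.card_eq_sum_card_fiberwise (f := fun t => t.1.1 + t.2.1) (t := A + B)]
  · refine Finset.sum_le_sum fun x _ => ?_
    rw [repCount, sq, ← Finset.card_product]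
    refine Finset.card_le_card_of_injOn
      (fun q => ((q.1.1, q.2.1), (q.1.2, q.2.2))) ?_ ?_
    · rintro ⟨⟨a, b⟩, ⟨c, d⟩⟩ hq
      simp only [Finset.coe_product, Set.mem_prod, Finset.mem_coe, Finset.mem_filter,
        Finset.mem_product] at hq ⊢
      obtain ⟨⟨⟨h1, h2⟩, h3⟩, ⟨h4, h5⟩, h6⟩ := hq
      exact ⟨⟨⟨⟨h1, h4⟩, h2, h5⟩, h3.trans h6.symm⟩, h3⟩
    · rintro ⟨⟨a, b⟩, ⟨c, d⟩⟩ _ ⟨⟨a', b'⟩, ⟨c', d'⟩⟩ _ hq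
      simp only [Prod.mk.injEq] at hq ⊢
      tauto
  · rintro ⟨⟨a, b⟩, ⟨c, d⟩⟩ hq
    simp only [Finset.mem_coe, Finset.mem_filter, Finset.mem_product] at hq ⊢
    exact Finset.add_mem_add hq.1.1.1 hq.1.2.1

theorem aux_count {p : ℕ} (A B : Finset (ZMod p)) :
    4 * (A + B).card ≤ addEnergy' A B + 3 * uniqueRep A B := by
  classical
  refine le_trans ?_ (Nat.add_le_add_right (aux_energy A B) _)
  rw [uniqueRep, Finset.card_filter, Finset.mul_sum, ← Finset.sum_add_distrib, mul_comm,
    ← smul_eq_mul]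
  refine Finset.card_nsmul_le_sum _ _ _ fun x hx => ?_
  have hpos : 0 < repCount A B x := by
    obtain ⟨a, ha, b, hb, hab⟩ := Finset.mem_add.mp hx
    exact Finset.card_pos.mpr ⟨(a, b), by simp [ha, hb, hab]⟩
  split_ifs with h1
  · simp [h1]
  · have : 2 ≤ repCount A B x := by omega
    nlinarith

theorem aux_ineq (η : ℝ) (hη0 : 0 ≤ η) (hη1 : η < 1 / 2) :
    1 / 2 + ((2 : ℝ) ^ (2 - 4 * η) - (2 : ℝ) ^ (3 - 2 * η) * η + 4 * η - 1)
        / (2 - 4 * η) ≤ 2 - 3 * η := by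
  have hb : (2 : ℝ) ^ (1 - 2 * η) ≤ 1 + (1 - 2 * η) := by
    have := rpow_one_add_le_one_add_mul_self (s := 1) (by norm_num)
      (p := 1 - 2 * η) (by linarith) (by linarith)
    norm_num at this ⊢
    linarith
  have h1 : (1 : ℝ) ≤ (2 : ℝ) ^ (1 - 2 * η) :=
    Real.one_le_rpow (by norm_num) (by linarith)
  have e1 : (2 : ℝ) ^ (2 - 4 * η) = (2 : ℝ) ^ (1 - 2 * η) * (2 : ℝ) ^ (1 - 2 * η) := by
    rw [← Real.rpow_add (by norm_num)]; congr 1; ring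
  have e2 : (2 : ℝ) ^ (3 - 2 * η) = (2 : ℝ) ^ (1 - 2 * η) * 4 := by
    rw [show (3 - 2 * η) = (1 - 2 * η) + 2 by ring, Real.rpow_add (by norm_num)]; norm_num
  rw [e1, e2]
  generalize (2 : ℝ) ^ (1 - 2 * η) = s at hb h1
  have : (s * s - s * 4 * η + 4 * η - 1) / (2 - 4 * η) ≤ 3 / 2 - 3 * η := by
    rw [div_le_iff₀ (by linarith)]
    nlinarith [mul_nonneg (sub_nonneg.2 hb) (by linarith : 0 ≤ s - 2 * η + 2 * (1 - 2 * η))]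
  linarith

theorem stmt_7 (p : ℕ) [Fact p.Prime] (A B : Finset (ZMod p))
    (hA : 2 ≤ A.card) (hB : 2 ≤ B.card) (h : A + B = Rp p)
    (η : ℝ) (hη0 : 0 ≤ η) (hη1 : η < 1 / 2)
    (hu : (uniqueRep A B : ℝ) ≤ η * ((p : ℝ) - 1)) :
    (addEnergy' A B : ℝ) ≥
      (1 / 2 + ((2 : ℝ) ^ (2 - 4 * η) - (2 : ℝ) ^ (3 - 2 * η) * η + 4 * η - 1)
        / (2 - 4 * η)) * ((p : ℝ) - 1) := by
  have hcard := aux_count A B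
  rw [h] at hcard
  have hR := aux_Rp_card p
  have hp : 1 ≤ p := (Fact.out : p.Prime).one_lt.le
  have hnat : 2 * (p - 1) ≤ addEnergy' A B + 3 * uniqueRep A B := by omega
  have hreal : 2 * ((p : ℝ) - 1) ≤ addEnergy' A B + 3 * uniqueRep A B := by
    have := (Nat.cast_le (α := ℝ)).mpr hnat
    push_cast [Nat.cast_sub hp] at this
    exact this
  have hp0 : (0 : ℝ) ≤ (p : ℝ) - 1 := by
    have : (1 : ℝ) ≤ p := by exact_mod_cast hp
    linarith
  have := mul_le_mul_of_nonneg_right (aux_ineq η hη0 hη1) hp0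
  refine ge_iff_le.mpr (this.trans ?_)
  linarith
end
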